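/- For all y, x ∈ W, the Kazhdan–Lusztig polynomial p_{y,x} is a polynomial in v (with no negative powers of v) all of whose coefficients are nonnegative integers. -/

import Mathlib

open LaurentPolynomial

/-- The Bruhat order on a Coxeter group: `y ≤ x` iff some reduced expression for `x`
admits a subword that is a reduced expression for `y`. -/
def bruhatLE {B W : Type} [Group W] {M : CoxeterMatrix B} (cs : CoxeterSystem M W)
    (y x : W) : Prop :=
  ∃ ω : List B, cs.IsReduced ω ∧ cs.wordProd ω = x ∧
    ∃ ω' : List B, ω'.Sublist ω ∧ cs.IsReduced ω' ∧ cs.wordProd ω' = y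

/-- The strict Bruhat order. -/
def bruhatLT {B W : Type} [Group W] {M : CoxeterMatrix B} (cs : CoxeterSystem M W)
    (y x : W) : Prop :=
  bruhatLE cs y x ∧ y ≠ x

/-- `H`, a `ℤ[v,v⁻¹]`-algebra with basis `h = (h_x)_{x ∈ W}`, is the Hecke algebra of the
Coxeter system `cs`: the unit is `h_e` and multiplication satisfies the usual rules
`h_s h_x = h_{sx}` if `ℓ(sx) > ℓ(x)` and `h_s h_x = (v⁻¹ - v) h_x + h_{sx}` if
`ℓ(sx) < ℓ(x)`.  Here `v := T 1` is the Laurent variable. -/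
def IsHeckeAlgebra {B W : Type} [Group W] {M : CoxeterMatrix B} (cs : CoxeterSystem M W)
    {H : Type} [Ring H] [Algebra (LaurentPolynomial ℤ) H]
    (h : Module.Basis W (LaurentPolynomial ℤ) H) : Prop :=
  h 1 = 1 ∧
  ∀ (i : B) (x : W),
    (cs.length (cs.simple i * x) > cs.length x →
      h (cs.simple i) * h x = h (cs.simple i * x)) ∧
    (cs.length (cs.simple i * x) < cs.length x →
      h (cs.simple i) * h x = (T (-1) - T 1 : LaurentPolynomial ℤ) • h x + h (cs.simple i * x))

/-- `d : H → H` is the bar involution: a ring homomorphism with `d(vⁿ a) = v⁻ⁿ d(a)` and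
`d(h_x) = (h_{x⁻¹})⁻¹`. -/
def IsBarInvolution {W H : Type} [Group W] [Ring H] [Algebra (LaurentPolynomial ℤ) H]
    (h : W → H) (d : H →+* H) : Prop :=
  (∀ (n : ℤ) (a : H), d ((T n : LaurentPolynomial ℤ) • a) = (T (-n) : LaurentPolynomial ℤ) • d a) ∧
  ∀ x : W, d (h x) = Ring.inverse (h x⁻¹)

/-- `b = (b_x)_{x ∈ W}` is the Kazhdan–Lusztig family: each `b_x` is self-dual for the bar
involution `d` and `b_x ∈ h_x + Σ_{y < x} v ℤ[v] h_y`, expressed through the coordinates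
`h.repr (b x) y ∈ ℤ[v,v⁻¹]` of `b_x` in the standard basis. -/
def IsKLFamily {B W : Type} [Group W] {M : CoxeterMatrix B} (cs : CoxeterSystem M W)
    {H : Type} [Ring H] [Algebra (LaurentPolynomial ℤ) H]
    (h : Module.Basis W (LaurentPolynomial ℤ) H) (d : H →+* H) (b : W → H) : Prop :=
  ∀ x : W,
    d (b x) = b x ∧
    h.repr (b x) x = 1 ∧
    ∀ y : W, y ≠ x →
      (¬ bruhatLT cs y x → h.repr (b x) y = 0) ∧
      ∀ k : ℤ, k ≤ 0 → (h.repr (b x) y).coeff k = 0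

namespace KL

open Module

noncomputable section

section

/-! ### The geometric representation -/

variable {B W : Type} [Group W] {M : CoxeterMatrix B} (cs : CoxeterSystem M W)

/-- Weights: the span of the simple roots together with one extra strictly dominant weight. -/
abbrev Wt (B : Type) := Option B →₀ ℝ

/-- The simple root `α s`. -/
def root (s : B) : Wt B := Finsupp.single (some s) 1

/-- The dominant weight. -/
def rho : Wt B := Finsupp.single none 1

variable (M) in
/-- The simple coroot, as a linear form on weights. -/
def coroot (s : B) : Wt B →ₗ[ℝ] ℝ :=
  Finsupp.linearCombination ℝ (fun o : Option B => o.elim 1 (fun t => -2 * Real.cos (Real.pi / M s t)))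

@[simp] lemma coroot_rho (s : B) : coroot M s rho = 1 := by simp [coroot, rho]

lemma coroot_root (s t : B) : coroot M s (root t) = -2 * Real.cos (Real.pi / M s t) := by
  simp [coroot, root]

@[simp] lemma coroot_root_self (s : B) : coroot M s (root s) = 2 := by
  simp [coroot_root]

lemma coroot_root_comm (s t : B) : coroot M s (root t) = coroot M t (root s) := by
  simp [coroot_root, M.symmetric s t]

variable (M) in
/-- The simple reflection on weights. -/
def sref (s : B) : End ℝ (Wt B) := LinearMap.id - (coroot M s).smulRight (root s)

lemma sref_apply (s : B) (l : Wt B) : sref M s l = l - coroot M s l • root s := by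
  simp [sref]

@[simp] lemma sref_root (s : B) : sref M s (root s) = -root s := by
  simp [sref_apply, two_smul]

@[simp] lemma sref_sref (s : B) (l : Wt B) : sref M s (sref M s l) = l := by
  rw [sref_apply, sref_apply]; simp; module

/-- Coefficients governing rank two root systems. -/
def cheb (c : ℝ) : ℕ → ℝ
  | 0 => 0
  | 1 => 1
  | n + 2 => c * cheb c (n + 1) - cheb c n

lemma cheb_sin (x : ℝ) (n : ℕ) : cheb (2 * Real.cos x) n * Real.sin x = Real.sin (n * x) := by
  induction n using Nat.twoStepInduction with
  | zero => simp [cheb]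
  | one => simp [cheb]
  | more n ih1 ih2 =>
    rw [cheb, sub_mul, mul_assoc, ih1, ih2]
    push_cast
    have h1 : ((n : ℝ) + 2) * x = (n + 1) * x + x := by ring
    have h2 : (n : ℝ) * x = (n + 1) * x - x := by ring
    rw [h1, h2, Real.sin_add, Real.sin_sub]; ring

lemma cheb_two (n : ℕ) : cheb 2 n = n := by
  induction n using Nat.twoStepInduction with
  | zero => simp [cheb]
  | one => simp [cheb]
  | more n ih1 ih2 => rw [cheb, ih1, ih2]; push_cast; ring

lemma cheb_nonneg {m n : ℕ} (hm : m ≠ 1) (h : m = 0 ∨ n ≤ m) :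
    0 ≤ cheb (2 * Real.cos (Real.pi / m)) n := by
  rcases Nat.eq_zero_or_pos m with rfl | hm0
  · simp [cheb_two]
  · have hm2 : (2 : ℝ) ≤ m := by exact_mod_cast (by lia : 2 ≤ m)
    have hn : (n : ℝ) ≤ m := by exact_mod_cast (by lia : n ≤ m)
    have hpos : 0 < Real.sin (Real.pi / m) := by
      apply Real.sin_pos_of_pos_of_lt_pi (by positivity)
      exact div_lt_self Real.pi_pos (by linarith)
    have := cheb_sin (Real.pi / m) n
    have h2 : 0 ≤ Real.sin (n * (Real.pi / m)) := by
      apply Real.sin_nonneg_of_nonneg_of_le_pi (by positivity)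
      rw [mul_div_assoc', div_le_iff₀ (by linarith)]
      nlinarith [Real.pi_pos]
    rw [← this] at h2
    exact nonneg_of_mul_nonneg_left h2 hpos

/-- The alternating composite `⋯ s t` of `n` simple reflections applied to `α s`. -/
lemma alternating_root (s t : B) (n : ℕ) :
    ((CoxeterSystem.alternatingWord s t n).map (sref M)).prod (root s) =
      cheb (2 * Real.cos (Real.pi / M s t)) (n + 1) • root (if Even n then s else t) +
      cheb (2 * Real.cos (Real.pi / M s t)) n • root (if Even n then t else s) := by
  induction n with
  | zero => simp [CoxeterSystem.alternatingWord, cheb]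
  | succ n ih =>
    rw [CoxeterSystem.alternatingWord_succ', List.map_cons, List.prod_cons, Module.End.mul_apply,
      ih, cheb]
    by_cases hn : Even n
    · have h1 : ¬ Even (n + 1) := by simpa [Nat.even_add_one] using hn
      simp only [hn, h1, if_true, if_false, map_add, map_smul, sref_root]
      rw [sref_apply, coroot_root, M.symmetric t s]
      module
    · have h1 : Even (n + 1) := by simpa [Nat.even_add_one] using hn
      simp only [hn, h1, if_true, if_false, map_add, map_smul, sref_root]
      rw [sref_apply, coroot_root]
      module

lemma alternating_even (s t : B) (n : ℕ) :
    ((CoxeterSystem.alternatingWord s t (2 * n)).map (sref M)).prod = (sref M s * sref M t) ^ n := by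
  induction n with
  | zero => simp [CoxeterSystem.alternatingWord]
  | succ n ih =>
    rw [show 2 * (n + 1) = 2 * n + 1 + 1 by ring, CoxeterSystem.alternatingWord_succ',
      CoxeterSystem.alternatingWord_succ', List.map_cons, List.map_cons, List.prod_cons,
      List.prod_cons, ih, pow_succ']
    have : ¬ Even (2 * n + 1) := by simp
    simp [this, mul_assoc]

lemma sref_mul_sref_pow_root {s t : B} (hst : s ≠ t) :
    ((sref M s * sref M t) ^ M s t) (root s) = root s := by
  rcases Nat.eq_zero_or_pos (M s t) with h0 | h0
  · simp [h0]
  have h1 : M s t ≠ 1 := M.off_diagonal s t hst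
  have hm2 : (2 : ℝ) ≤ M s t := by exact_mod_cast (by lia : 2 ≤ M s t)
  have hpos : 0 < Real.sin (Real.pi / M s t) := by
    apply Real.sin_pos_of_pos_of_lt_pi (by positivity)
    exact div_lt_self Real.pi_pos (by linarith)
  rw [← alternating_even, alternating_root]
  have e1 : cheb (2 * Real.cos (Real.pi / M s t)) (2 * M s t) = 0 := by
    have := cheb_sin (Real.pi / M s t) (2 * M s t)
    rw [show ((2 * M s t : ℕ) : ℝ) * (Real.pi / M s t) = 2 * Real.pi by push_cast; field_simp,
      Real.sin_two_pi] at this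
    simpa [hpos.ne'] using this
  have e2 : cheb (2 * Real.cos (Real.pi / M s t)) (2 * M s t + 1) = 1 := by
    have := cheb_sin (Real.pi / M s t) (2 * M s t + 1)
    rw [show ((2 * M s t + 1 : ℕ) : ℝ) * (Real.pi / M s t) = Real.pi / M s t + 2 * Real.pi by
      push_cast; field_simp; ring, Real.sin_add_two_pi] at this
    simpa [hpos.ne'] using this
  simp [e1, e2]

lemma sref_liftable : M.IsLiftable (sref M) := by
  intro s t
  by_cases hst : s = t
  · subst hst
    refine LinearMap.ext fun l => ?_
    simp
  rcases Nat.eq_zero_or_pos (M s t) with h0 | h0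
  · simp [h0]
  have hm2 : (2 : ℝ) ≤ M s t := by
    have h1 : M s t ≠ 1 := M.off_diagonal s t hst
    exact_mod_cast (by lia : 2 ≤ M s t)
  set g := (sref M s * sref M t) ^ M s t with hg
  have hs : g (root s) = root s := sref_mul_sref_pow_root hst
  have ht : g (root t) = root t := by
    have h := sref_mul_sref_pow_root (M := M) (Ne.symm hst)
    rw [M.symmetric t s] at h
    have hc : g * (sref M t * sref M s) ^ M s t = 1 := by
      have hcomm : ∀ n : ℕ, (sref M s * sref M t) ^ n * (sref M t * sref M s) ^ n = 1 := by
        intro n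
        induction n with
        | zero => simp
        | succ n ih =>
          rw [pow_succ, pow_succ', mul_assoc, ← mul_assoc (sref M s * sref M t),
            show sref M s * sref M t * (sref M t * sref M s) = 1 from
              LinearMap.ext fun l => by simp, one_mul, ih]
      exact hcomm _
    calc g (root t) = g (((sref M t * sref M s) ^ M s t) (root t)) := by rw [h]
      _ = (g * (sref M t * sref M s) ^ M s t) (root t) := rfl
      _ = root t := by rw [hc]; rfl
  have hfix : ∀ l, coroot M s l = 0 → coroot M t l = 0 → g l = l := by
    intro l h1 h2
    have : ∀ n : ℕ, ((sref M s * sref M t) ^ n) l = l := by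
      intro n
      induction n with
      | zero => simp
      | succ n ih =>
        rw [pow_succ, Module.End.mul_apply, Module.End.mul_apply, sref_apply t, h2, zero_smul,
          sub_zero, sref_apply s, h1, zero_smul, sub_zero, ih]
    exact this _
  refine LinearMap.ext fun l => ?_
  set c := coroot M s (root t) with hc
  have hc4 : 4 - c ^ 2 ≠ 0 := by
    have : 0 < Real.sin (Real.pi / M s t) := by
      apply Real.sin_pos_of_pos_of_lt_pi (by positivity)
      exact div_lt_self Real.pi_pos (by linarith)
    have h2 := Real.sin_sq_add_cos_sq (Real.pi / M s t)
    rw [hc, coroot_root]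
    nlinarith
  set a := coroot M s l
  set b := coroot M t l
  set p := (2 * a - c * b) / (4 - c ^ 2) with hp
  set q := (2 * b - c * a) / (4 - c ^ 2) with hq
  have hl : l = (l - p • root s - q • root t) + p • root s + q • root t := by abel
  have h1 : coroot M s (l - p • root s - q • root t) = 0 := by
    simp only [map_sub, map_smul, coroot_root_self, smul_eq_mul, ← hc]
    change a - p * 2 - q * c = 0
    rw [hp, hq]; field_simp; ring
  have h2 : coroot M t (l - p • root s - q • root t) = 0 := by
    simp only [map_sub, map_smul, coroot_root_self, smul_eq_mul, coroot_root_comm t s, ← hc]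
    change b - p * c - q * 2 = 0
    rw [hp, hq]; field_simp; ring
  change g l = l
  conv_lhs => rw [hl]
  rw [map_add, map_add, hfix _ h1 h2, map_smul, map_smul, hs, ht, ← hl]

/-- The geometric representation of `W` on weights. -/
def geo : W →* End ℝ (Wt B) := cs.lift ⟨sref M, sref_liftable⟩

@[simp] lemma geo_simple (s : B) : geo cs (cs.simple s) = sref M s :=
  cs.lift_apply_simple sref_liftable s

lemma geo_wordProd (ω : List B) : geo cs (cs.wordProd ω) = (ω.map (sref M)).prod := by
  induction ω with
  | nil => simp
  | cons s ω ih => rw [cs.wordProd_cons, map_mul, ih]; simp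

@[simp] lemma geo_inv_geo (w : W) (l : Wt B) : geo cs w⁻¹ (geo cs w l) = l := by
  rw [← Module.End.mul_apply, ← map_mul]; simp

@[simp] lemma geo_geo_inv (w : W) (l : Wt B) : geo cs w (geo cs w⁻¹ l) = l := by
  rw [← Module.End.mul_apply, ← map_mul]; simp

lemma geo_mul_apply (w w' : W) (l : Wt B) : geo cs (w * w') l = geo cs w (geo cs w' l) := by
  simp

/-- Nonnegative combinations of simple roots. -/
def Pos (g : Wt B) : Prop := g none = 0 ∧ ∀ t, 0 ≤ g (some t)

lemma Pos.add {g g' : Wt B} (h : Pos g) (h' : Pos g') : Pos (g + g') :=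
  ⟨by simp [h.1, h'.1], fun t => by simpa using add_nonneg (h.2 t) (h'.2 t)⟩

lemma Pos.smul {g : Wt B} {c : ℝ} (hc : 0 ≤ c) (h : Pos g) : Pos (c • g) :=
  ⟨by simp [h.1], fun t => by simpa using mul_nonneg hc (h.2 t)⟩

lemma Pos.eq_zero {g : Wt B} (h : Pos g) (h' : Pos (-g)) : g = 0 := by
  ext o
  cases o with
  | none => simpa using h.1
  | some t =>
    have h1 := h.2 t
    have h2 := h'.2 t
    simp at h2
    exact le_antisymm h2 h1

lemma root_some [DecidableEq B] (s t : B) : (root s : Wt B) (some t) = if s = t then 1 else 0 := by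
  simp [root, Finsupp.single_apply]

@[simp] lemma root_none (s : B) : (root s : Wt B) none = 0 := by simp [root]

lemma pos_root (s : B) : Pos (root s : Wt B) := by
  classical
  refine ⟨by simp, fun t => ?_⟩
  rw [root_some]; split_ifs <;> simp

@[simp] lemma root_ne_zero (s : B) : (root s : Wt B) ≠ 0 := by simp [root]

lemma sref_some_ne {s t : B} (h : s ≠ t) (l : Wt B) : sref M s l (some t) = l (some t) := by
  classical
  simp [sref_apply, root_some, h]

lemma sref_none (s : B) (l : Wt B) : sref M s l none = l none := by
  simp [sref_apply]

lemma geo_none (w : W) (l : Wt B) : geo cs w l none = l none := by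
  induction w using cs.simple_induction_left with
  | one => simp
  | mul_simple_left w s ih => simp [sref_none, ih]

/-- An element not having `s` as right descent maps `α s` to a positive root. -/
theorem pos_geo_root {w : W} {s : B} (h : cs.length w < cs.length (w * cs.simple s)) :
    Pos (geo cs w (root s)) := by
  classical
  induction hn : cs.length w using Nat.strong_induction_on generalizing w s with
  | _ n ih =>
  by_cases hw1 : w = 1
  · subst hw1; simpa using pos_root s
  obtain ⟨t, ht⟩ := cs.exists_rightDescent_of_ne_one hw1
  rw [cs.isRightDescent_iff] at ht
  have hst : s ≠ t := by rintro rfl; lia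
  let P : ℕ → Prop := fun k => ∃ v, w = v * cs.wordProd (CoxeterSystem.alternatingWord s t k) ∧
    cs.length v + k = cs.length w
  have hP1 : P 1 := ⟨w * cs.simple t, by simp [CoxeterSystem.alternatingWord], ht⟩
  have hbd : ∀ k, P k → k ≤ cs.length w := fun k ⟨v, _, hv⟩ => by lia
  have hl1 : 1 ≤ cs.length w := hbd 1 hP1
  set k := Nat.findGreatest P (cs.length w) with hk
  obtain ⟨v, hv, hvl⟩ : P k := Nat.findGreatest_spec (P := P) hl1 hP1
  have hk1 : 1 ≤ k := Nat.le_findGreatest hl1 hP1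
  have hmax : ¬ P (k + 1) := by
    intro hP
    have := Nat.le_findGreatest (hbd _ hP) hP
    lia
  have key : ∀ r : B, r = s ∨ r = t → cs.length v < cs.length (v * cs.simple r) := by
    intro r hr
    by_contra hcon
    have hlt : cs.length (v * cs.simple r) + 1 = cs.length v := by
      rcases cs.length_mul_simple v r with h1 | h1 <;> lia
    by_cases hrn : r = if Even k then t else s
    · refine hmax ⟨v * cs.simple r, ?_, by lia⟩
      rw [CoxeterSystem.alternatingWord_succ', cs.wordProd_cons, ← hrn, mul_assoc,
        cs.simple_mul_simple_cancel_left]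
      exact hv
    · obtain ⟨k', hk'⟩ : ∃ k', k = k' + 1 := ⟨k - 1, by lia⟩
      have hr' : r = if Even k' then t else s := by
        rw [hk'] at hrn
        by_cases he : Even k'
        · simp [Nat.even_add_one, he] at hrn ⊢; tauto
        · simp [Nat.even_add_one, he] at hrn ⊢; tauto
      have hw' : w = (v * cs.simple r) *
          cs.wordProd (CoxeterSystem.alternatingWord s t k') := by
        rw [hv, hk', CoxeterSystem.alternatingWord_succ', cs.wordProd_cons, ← hr', mul_assoc]
      have h1 := cs.length_mul_le (v * cs.simple r)
        (cs.wordProd (CoxeterSystem.alternatingWord s t k'))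
      have h2 := cs.length_wordProd_le (CoxeterSystem.alternatingWord s t k')
      rw [CoxeterSystem.length_alternatingWord] at h2
      rw [← hw'] at h1
      lia
  have hvs := ih (cs.length v) (by lia) (key s (Or.inl rfl)) rfl
  have hvt := ih (cs.length v) (by lia) (key t (Or.inr rfl)) rfl
  have hkm : M s t = 0 ∨ k + 1 ≤ M s t := by
    by_contra hcon
    push Not at hcon
    have h1 : w * cs.simple s =
        v * cs.wordProd (CoxeterSystem.alternatingWord t s (k + 1)) := by
      rw [CoxeterSystem.alternatingWord_succ, cs.wordProd_concat, ← mul_assoc, ← hv]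
    have h2 := cs.length_mul_le v (cs.wordProd (CoxeterSystem.alternatingWord t s (k + 1)))
    rw [← h1] at h2
    have h3 := cs.length_wordProd_le (CoxeterSystem.alternatingWord t s (k + 1))
    rw [CoxeterSystem.length_alternatingWord] at h3
    refine cs.not_isReduced_alternatingWord t s (m := k + 1) (by rw [M.symmetric]; exact hcon.1)
      (by rw [M.symmetric]; lia) ?_
    rw [CoxeterSystem.IsReduced, CoxeterSystem.length_alternatingWord]
    lia
  have hm1 : M s t ≠ 1 := M.off_diagonal s t hst
  rw [hv, map_mul, Module.End.mul_apply, geo_wordProd, alternating_root, map_add, map_smul,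
    map_smul]
  refine Pos.add (Pos.smul (cheb_nonneg hm1 hkm) ?_)
    (Pos.smul (cheb_nonneg hm1 (hkm.imp_right (by lia))) ?_)
  · split_ifs <;> assumption
  · split_ifs <;> assumption

theorem neg_geo_root {w : W} {s : B} (h : cs.length (w * cs.simple s) < cs.length w) :
    Pos (-geo cs w (root s)) := by
  have := pos_geo_root cs (w := w * cs.simple s) (s := s) (by simpa using h)
  simpa using this

lemma geo_root_ne_zero (w : W) (s : B) : geo cs w (root s) ≠ 0 := by
  intro h
  have := congrArg (geo cs w⁻¹) h
  simp at this

/-- Positive or negative. -/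
lemma pos_or_neg (w : W) (s : B) : Pos (geo cs w (root s)) ∨ Pos (-geo cs w (root s)) := by
  rcases cs.length_mul_simple w s with h | h
  · exact Or.inl (pos_geo_root cs (by lia))
  · exact Or.inr (neg_geo_root cs (by lia))

variable (M) in
/-- The pairing of a combination of simple (co)roots with a weight. -/
def pair : Wt B →ₗ[ℝ] Wt B →ₗ[ℝ] ℝ :=
  Finsupp.linearCombination ℝ (fun o : Option B => o.elim 0 (fun t => coroot M t))

@[simp] lemma pair_root (s : B) (l : Wt B) : pair M (root s) l = coroot M s l := by
  simp [pair, root]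

lemma eq_sum_root {g : Wt B} (hg : g none = 0) :
    g ∈ Submodule.span ℝ (Set.range (root : B → Wt B)) := by
  have : g = g.sum (fun o a => a • Finsupp.single o 1) := by
    conv_lhs => rw [← Finsupp.sum_single g]
    simp
  rw [this]
  refine Submodule.sum_mem _ fun o ho => ?_
  cases o with
  | none => simp [hg] at ho
  | some t => exact Submodule.smul_mem _ _ (Submodule.subset_span ⟨t, rfl⟩)

lemma root_induction {p : Wt B → Prop} (h0 : p 0) (hr : ∀ s, p (root s))
    (ha : ∀ x y, p x → p y → p (x + y)) (hs : ∀ (c : ℝ) x, p x → p (c • x))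
    {g : Wt B} (hg : g none = 0) : p g :=
  Submodule.span_induction (p := fun x _ => p x) (by rintro x ⟨s, rfl⟩; exact hr s) h0
    (fun x y _ _ => ha x y) (fun c x _ => hs c x) (eq_sum_root hg)

lemma pair_sref {g : Wt B} (hg : g none = 0) (s : B) (l : Wt B) :
    pair M (sref M s g) (sref M s l) = pair M g l := by
  refine root_induction (p := fun g => pair M (sref M s g) (sref M s l) = pair M g l)
    (by simp) (fun t => ?_) (fun x y hx hy => ?_) (fun c x hx => ?_) hg
  · rw [sref_apply, sref_apply]
    simp only [map_sub, map_smul, pair_root, LinearMap.sub_apply, LinearMap.smul_apply,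
      smul_eq_mul, coroot_root_self, coroot_root_comm t s]
    ring
  · simp only [map_add, LinearMap.add_apply, hx, hy]
  · simp only [map_smul, LinearMap.smul_apply, hx]

lemma pair_geo {g : Wt B} (hg : g none = 0) (w : W) (l : Wt B) :
    pair M (geo cs w g) (geo cs w l) = pair M g l := by
  induction w using cs.simple_induction_left with
  | one => simp
  | mul_simple_left w s ih =>
    rw [geo_mul_apply, geo_mul_apply, geo_simple, pair_sref (by rw [geo_none, hg]), ih]

lemma pair_rho_pos {g : Wt B} (hg : Pos g) (h0 : g ≠ 0) : 0 < pair M g rho := by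
  have e : pair M g rho = ∑ o ∈ g.support, g o := by
    rw [pair, Finsupp.linearCombination_apply, Finsupp.sum, LinearMap.sum_apply]
    refine Finset.sum_congr rfl fun o ho => ?_
    cases o with
    | none => simp [hg.1]
    | some t => simp
  rw [e]
  have hn : ∀ o, 0 ≤ g o := fun o => by
    cases o with
    | none => exact hg.1.ge
    | some t => exact hg.2 t
  refine Finset.sum_pos (fun o ho => lt_of_le_of_ne (hn o) ?_) ?_
  · exact (Finsupp.mem_support_iff.mp ho).symm
  · simpa using h0

lemma coroot_geo (s : B) (w : W) (l : Wt B) :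
    coroot M s (geo cs w l) = pair M (geo cs w⁻¹ (root s)) l := by
  rw [← pair_root, ← pair_geo cs (by simp) w⁻¹, geo_inv_geo]

lemma length_inv_mul_simple (x : W) (s : B) :
    cs.length (x⁻¹ * cs.simple s) = cs.length (cs.simple s * x) := by
  rw [← cs.length_inv, mul_inv_rev, inv_inv, cs.inv_simple]

lemma coroot_rho_pos {x : W} {s : B} (h : cs.length x < cs.length (cs.simple s * x)) :
    0 < coroot M s (geo cs x rho) := by
  rw [coroot_geo]
  refine pair_rho_pos (pos_geo_root cs ?_) (geo_root_ne_zero cs _ _)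
  rwa [length_inv_mul_simple, cs.length_inv]

lemma coroot_rho_neg {x : W} {s : B} (h : cs.length (cs.simple s * x) < cs.length x) :
    coroot M s (geo cs x rho) < 0 := by
  rw [coroot_geo]
  have := pair_rho_pos (M := M) (neg_geo_root cs (w := x⁻¹) (s := s)
    (by rwa [length_inv_mul_simple, cs.length_inv])) (by simpa using geo_root_ne_zero cs _ _)
  simpa using this

lemma geo_rho_inj {x : W} (h : geo cs x rho = rho) : x = 1 := by
  by_contra hx
  obtain ⟨s, hs⟩ := cs.exists_leftDescent_of_ne_one hx
  have := coroot_rho_neg cs hs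
  rw [h, coroot_rho] at this
  linarith

lemma geo_rho_injective : Function.Injective (fun x : W => geo cs x (rho : Wt B)) := by
  intro x y (h : geo cs x rho = geo cs y rho)
  have : geo cs (y⁻¹ * x) rho = rho := by rw [geo_mul_apply, h, geo_inv_geo]
  exact (inv_mul_eq_one.mp (geo_rho_inj cs this)).symm

lemma geo_injective {x y : W} (h : geo cs x = geo cs y) : x = y :=
  geo_rho_injective cs (by simp [h])

lemma pos_rho_sub (x : W) : Pos (rho - geo cs x rho) := by
  induction hn : cs.length x using Nat.strong_induction_on generalizing x with
  | _ n ih =>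
  by_cases hx : x = 1
  · subst hx; simp [Pos]
  obtain ⟨s, hs⟩ := cs.exists_leftDescent_of_ne_one hx
  have h1 := ih _ (hn ▸ hs) (cs.simple s * x) rfl
  have h2 : 0 < coroot M s (geo cs (cs.simple s * x) rho) :=
    coroot_rho_pos cs (by rw [cs.simple_mul_simple_cancel_left]; exact hs)
  have e : rho - geo cs x rho = (rho - geo cs (cs.simple s * x) rho) +
      coroot M s (geo cs (cs.simple s * x) rho) • root s := by
    have : geo cs x rho = sref M s (geo cs (cs.simple s * x) rho) := by
      simp
    rw [this, sref_apply (s := s) (l := geo cs (cs.simple s * x) rho)]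
    abel
  rw [e]
  exact h1.add ((pos_root s).smul h2.le)

lemma geo_conj_apply (x : W) (s : B) (l : Wt B) :
    geo cs (x * cs.simple s * x⁻¹) l =
      l - pair M (geo cs x (root s)) l • geo cs x (root s) := by
  have := coroot_geo cs s x⁻¹ l
  rw [inv_inv] at this
  rw [geo_mul_apply, geo_mul_apply, geo_simple, sref_apply, map_sub, map_smul, geo_geo_inv, this]

lemma pos_sref_or_eq {x : W} {s t : B} (h : Pos (geo cs x (root s))) :
    Pos (sref M t (geo cs x (root s))) ∨ geo cs x (root s) = root t := by
  classical
  have hd := pos_or_neg cs (cs.simple t * x) s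
  rw [geo_mul_apply, geo_simple] at hd
  rcases hd with hd | hd
  · exact Or.inl hd
  right
  set β := geo cs x (root s) with hβ
  have h0 : ∀ u, t ≠ u → β (some u) = 0 := by
    intro u hu
    have h1 := hd.2 u
    have h2 := h.2 u
    simp only [Finsupp.neg_apply, sref_some_ne hu] at h1
    linarith
  have hc : β = β (some t) • root t := by
    ext o
    cases o with
    | none => simp [h.1]
    | some u =>
      by_cases hu : t = u
      · subst hu; simp [root_some]
      · simp [root_some, hu, h0 u hu]
  have hn : pair M β β = 2 := by
    rw [hβ, pair_geo cs (by simp)]; simp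
  rw [hc] at hn
  simp at hn
  have hc1 : β (some t) = 1 := by nlinarith [h.2 t]
  rw [hc, hc1, one_smul]

/-- A reflection whose positive root is made negative by `w⁻¹` shortens `w`. -/
lemma length_reflection_mul_lt {x w : W} {s : B} (h : Pos (geo cs x (root s)))
    (hw : Pos (-geo cs w⁻¹ (geo cs x (root s)))) :
    cs.length (x * cs.simple s * x⁻¹ * w) < cs.length w := by
  induction hn : cs.length w using Nat.strong_induction_on generalizing x w with
  | _ n ih =>
  by_cases hw1 : w = 1
  · subst hw1
    simp only [inv_one, map_one, Module.End.one_apply] at hw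
    exact absurd (h.eq_zero hw) (geo_root_ne_zero cs _ _)
  obtain ⟨t, ht⟩ := cs.exists_leftDescent_of_ne_one hw1
  have ht' := (cs.isLeftDescent_iff).mp ht
  rcases pos_sref_or_eq cs (t := t) h with hp | he
  · have h1 := ih (cs.length (cs.simple t * w)) (by lia) (x := cs.simple t * x)
      (w := cs.simple t * w) (by simpa using hp)
      (by simpa [mul_inv_rev] using hw) rfl
    have e : x * cs.simple s * x⁻¹ * w =
      cs.simple t * (cs.simple t * x * cs.simple s * (cs.simple t * x)⁻¹ * (cs.simple t * w)) := by
      simp [mul_assoc]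
    rw [e]
    rcases cs.length_simple_mul
      (cs.simple t * x * cs.simple s * (cs.simple t * x)⁻¹ * (cs.simple t * w)) t with h2 | h2 <;>
      lia
  · have e : x * cs.simple s * x⁻¹ = cs.simple t := by
      refine geo_injective cs (LinearMap.ext fun l => ?_)
      rw [geo_conj_apply, he, geo_simple, sref_apply, pair_root]
    rw [e, ← hn]; exact ht

lemma length_reflection_mul_gt {x w : W} {s : B} (h : Pos (geo cs x (root s)))
    (hw : Pos (geo cs w⁻¹ (geo cs x (root s)))) :
    cs.length w < cs.length (x * cs.simple s * x⁻¹ * w) := by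
  have := length_reflection_mul_lt cs (x := x) (s := s) (w := x * cs.simple s * x⁻¹ * w) h (by
    have e : (x * cs.simple s * x⁻¹ * w)⁻¹ * x = w⁻¹ * x * cs.simple s := by
      simp [mul_assoc]
    rw [← geo_mul_apply, e, geo_mul_apply, geo_simple, sref_root, map_neg, neg_neg, geo_mul_apply]
    exact hw)
  have e : x * cs.simple s * x⁻¹ * (x * cs.simple s * x⁻¹ * w) = w := by simp [mul_assoc]
  rwa [e] at this

/-- The exchange property in the form needed: if `w` covers `y`, `s` is a left descent of `w` and
not of `y`, then `w = s y`. -/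
theorem eq_simple_mul_of_cover {y t : W} {s : B} (ht : cs.IsReflection t)
    (hl : cs.length (y * t) = cs.length y + 1)
    (hs : cs.length (cs.simple s * (y * t)) < cs.length (y * t))
    (hy : cs.length y < cs.length (cs.simple s * y)) : y * t = cs.simple s * y := by
  obtain ⟨x₀, r, hr⟩ := ht
  obtain ⟨x, hx, hp⟩ : ∃ x, y * t = x * cs.simple r * x⁻¹ * y ∧ Pos (geo cs x (root r)) := by
    have e : y * t = (y * x₀) * cs.simple r * (y * x₀)⁻¹ * y := by rw [hr]; simp [mul_assoc]
    rcases pos_or_neg cs (y * x₀) r with h | h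
    · exact ⟨_, e, h⟩
    · refine ⟨y * x₀ * cs.simple r, ?_, ?_⟩
      · rw [e]; simp [mul_assoc]
      · simpa using h
  rcases pos_sref_or_eq cs (t := s) hp with h | h
  · exfalso
    have hneg : Pos (-geo cs (y * t)⁻¹ (geo cs x (root r))) := by
      rcases pos_or_neg cs ((y * t)⁻¹ * x) r with h1 | h1
      · rw [geo_mul_apply] at h1
        have h2 := length_reflection_mul_gt cs hp h1
        have e : x * cs.simple r * x⁻¹ * (y * t) = y := by rw [hx]; simp [mul_assoc]
        rw [e] at h2
        lia
      · rwa [geo_mul_apply] at h1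
    have h3 := length_reflection_mul_lt cs (x := cs.simple s * x) (s := r)
      (w := cs.simple s * (y * t)) (by simpa using h) (by
        rw [mul_inv_rev, geo_mul_apply, geo_mul_apply, cs.inv_simple, geo_simple, sref_sref]
        exact hneg)
    have e : cs.simple s * x * cs.simple r * (cs.simple s * x)⁻¹ * (cs.simple s * (y * t)) =
        cs.simple s * y := by rw [hx]; simp [mul_assoc]
    rw [e] at h3
    lia
  · have e : x * cs.simple r * x⁻¹ = cs.simple s := by
      refine geo_injective cs (LinearMap.ext fun l => ?_)
      rw [geo_conj_apply, h, geo_simple, sref_apply, pair_root]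
    rw [hx, e]

/-- An element moving weights only along a line is a reflection. -/
theorem isReflection_of_rank_one {g : W} (hg : g ≠ 1) (v : Wt B) (c : Wt B → ℝ)
    (hc : ∀ l, geo cs g l = l - c l • v) : cs.IsReflection g := by
  classical
  induction hn : cs.length g using Nat.strong_induction_on generalizing g v c with
  | _ n ih =>
  wlog hv : v = rho - geo cs g rho generalizing v c
  · have hne : c rho ≠ 0 := by
      intro h0
      exact hg (geo_rho_inj cs (by rw [hc, h0]; simp))
    refine this (rho - geo cs g rho) (fun l => (c rho)⁻¹ * c l) (fun l => ?_) rfl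
    rw [hc rho, sub_sub_cancel, smul_smul, hc]
    congr 2
    field_simp
  have hv0 : v ≠ 0 := by
    intro h0
    exact hg (geo_rho_inj cs (by rw [hv] at h0; exact (sub_eq_zero.mp h0).symm))
  have hvp : Pos v := hv ▸ pos_rho_sub cs g
  have hadd : ∀ l l', c (l + l') = c l + c l' := by
    intro l l'
    have h1 := hc (l + l')
    rw [map_add, hc, hc] at h1
    have h2 : (c (l + l') - (c l + c l')) • v = 0 := by
      have h3 : c (l + l') • v = c l • v + c l' • v := by
        have := sub_eq_zero.mpr h1
        rw [← sub_eq_zero, ← this]; abel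
      rw [sub_smul, add_smul, h3, sub_self]
    have := (smul_eq_zero.mp h2).resolve_right hv0
    linarith
  have hsmul : ∀ (a : ℝ) l, c (a • l) = a * c l := by
    intro a l
    have h1 := hc (a • l)
    rw [map_smul, hc] at h1
    have h2 : (c (a • l) - a * c l) • v = 0 := by
      rw [smul_sub, sub_right_inj] at h1
      rw [sub_smul, ← h1, mul_smul, sub_self]
    have := (smul_eq_zero.mp h2).resolve_right hv0
    linarith
  have hcr : c rho = 1 := by
    have h1 := hc rho
    have h2 : (c rho - 1) • v = 0 := by
      rw [sub_smul, one_smul]; nth_rewrite 2 [hv]; rw [h1]; abel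
    have := (smul_eq_zero.mp h2).resolve_right hv0
    linarith
  set μ := 1 - c v with hμ
  have hgv : geo cs g v = μ • v := by rw [hc, hμ]; module
  have hμ0 : μ ≠ 0 := by
    intro h0
    rw [h0, zero_smul] at hgv
    exact hv0 (by simpa using congrArg (geo cs g⁻¹) hgv)
  have hinv : geo cs g⁻¹ rho = rho + μ⁻¹ • v := by
    have h1 : geo cs g (rho + μ⁻¹ • v) = rho := by
      rw [map_add, map_smul, hgv, smul_smul, inv_mul_cancel₀ hμ0, hc, hcr]; simp
    rw [← h1, geo_inv_geo, h1]
  have hμneg : μ < 0 := by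
    have h1 := pos_rho_sub cs g⁻¹
    rw [hinv, sub_add_cancel_left] at h1
    by_contra hcon
    have hpos : 0 < μ := lt_of_le_of_ne (not_lt.mp hcon) hμ0.symm
    have h2 := Pos.eq_zero (hvp.smul (inv_nonneg.mpr hpos.le)) h1
    exact hv0 ((smul_eq_zero.mp h2).resolve_left (by positivity))
  have hpr : 0 < pair M v rho := pair_rho_pos hvp hv0
  have hpl : ∀ l, (μ - 1) * pair M v l = μ * c l * pair M v v := by
    intro l
    have h1 := pair_geo cs hvp.1 g l
    rw [hgv, hc l] at h1
    simp only [map_smul, map_sub, LinearMap.smul_apply, smul_eq_mul] at h1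
    linarith
  have hvv : pair M v v ≠ 0 := by
    intro h0
    have h1 := hpl rho
    rw [h0, mul_zero] at h1
    rcases mul_eq_zero.mp h1 with h2 | h2 <;> linarith
  have hμ1 : μ = -1 := by
    have h1 := pair_geo cs hvp.1 g v
    rw [hgv] at h1
    simp only [map_smul, LinearMap.smul_apply, smul_eq_mul] at h1
    have h2 : (μ ^ 2 - 1) * pair M v v = 0 := by linarith
    have h3 := (mul_eq_zero.mp h2).resolve_right hvv
    nlinarith
  have hcl : ∀ l, c l * pair M v v = 2 * pair M v l := by
    intro l
    have := hpl l
    rw [hμ1] at this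
    linarith
  have hgg : g⁻¹ = g := by
    refine geo_injective cs (LinearMap.ext fun l => ?_)
    have : geo cs g (geo cs g l) = l := by
      rw [hc l, map_sub, map_smul, hgv, hμ1, hc l]; module
    conv_lhs => rw [← this]
    rw [geo_inv_geo]
  obtain ⟨s, hs⟩ := cs.exists_rightDescent_of_ne_one hg
  have hsn := neg_geo_root cs hs
  by_cases hvs : ∀ u, s ≠ u → v (some u) = 0
  · have he : v = v (some s) • root s := by
      ext o
      cases o with
      | none => simp [hvp.1]
      | some u =>
        by_cases hu : s = u
        · subst hu; simp [root_some]
        · simp [root_some, hu, hvs u hu]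
    set κ := v (some s)
    have hκ : κ ≠ 0 := by
      intro h0; rw [h0, zero_smul] at he; exact hv0 he
    have : g = cs.simple s := by
      refine geo_injective cs (LinearMap.ext fun l => ?_)
      have h1 := hcl l
      rw [he] at h1
      simp at h1
      have h2 : c l * κ = coroot M s l := by
        have : κ * (c l * κ - coroot M s l) = 0 := by linarith
        have := (mul_eq_zero.mp this).resolve_left hκ
        linarith
      rw [geo_simple, sref_apply, hc, he, smul_smul, h2]
    rw [this]; exact cs.isReflection_simple s
  push Not at hvs
  obtain ⟨u, hu, hvu⟩ := hvs
  have hvu' : 0 < v (some u) := lt_of_le_of_ne (hvp.2 u) hvu.symm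
  have hcpos : 0 < c (root s) := by
    have h1 := hsn.2 s
    rw [hc] at h1
    simp [root_some] at h1
    by_contra hcon
    nlinarith [hvp.2 s]
  have h1 : cs.length (cs.simple s * g * cs.simple s) < cs.length (cs.simple s * g) := by
    rcases cs.length_mul_simple (cs.simple s * g) s with h | h
    · exfalso
      have h2 := (pos_geo_root cs (w := cs.simple s * g) (s := s) (by lia)).2 u
      rw [geo_mul_apply, geo_simple, sref_some_ne hu, hc] at h2
      simp [root_some, hu] at h2
      nlinarith
    · lia
  have h2 : cs.length (cs.simple s * g) < cs.length g := by
    rw [← cs.length_inv, mul_inv_rev, hgg, cs.inv_simple]; exact hs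
  have hconj := ih _ (by lia) (g := cs.simple s * g * cs.simple s)
    (by
      intro h
      apply hg
      have : g = cs.simple s * (cs.simple s * g * cs.simple s) * cs.simple s := by
        simp [mul_assoc]
      rw [this, h]; simp)
    (sref M s v) (fun l => c (sref M s l))
    (fun l => by
      rw [geo_mul_apply, geo_mul_apply, geo_simple, hc, map_sub, map_smul, sref_sref]) rfl
  have := hconj.conj (cs.simple s)
  simpa [mul_assoc] using this

/-- An element which is neither trivial nor a reflection moves weights in two independent
directions. -/
theorem exists_independent {g : W} (hg : g ≠ 1) (hr : ¬ cs.IsReflection g) :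
    ∃ l₁ l₂ : Wt B, LinearIndependent ℝ ![l₁ - geo cs g l₁, l₂ - geo cs g l₂] := by
  by_contra hcon
  push Not at hcon
  apply hr
  have hv0 : rho - geo cs g rho ≠ 0 := fun h0 => hg (geo_rho_inj cs (sub_eq_zero.mp h0).symm)
  have key : ∀ l, ∃ a : ℝ, a • (rho - geo cs g rho) = l - geo cs g l := by
    intro l
    have := hcon rho l
    rw [LinearIndependent.pair_iff' hv0] at this
    push Not at this
    exact this
  choose c hc using key
  refine isReflection_of_rank_one cs hg (rho - geo cs g rho) c fun l => ?_
  rw [hc]; abel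

end

section

variable {B W : Type} [Group W] {M : CoxeterMatrix B} (cs : CoxeterSystem M W)

/-! ### Polynomial functions and Demazure operators -/

/-- The polynomial ring on weights. -/
abbrev Pol (B : Type) := MvPolynomial (Option B) ℝ

/-- Weights as linear polynomials. -/
def lin : Wt B →ₗ[ℝ] Pol B := Finsupp.linearCombination ℝ MvPolynomial.X

@[simp] lemma lin_single (o : Option B) : lin (Finsupp.single o 1) = MvPolynomial.X o := by
  simp [lin]

lemma coeff_lin (l : Wt B) (o : Option B) :
    MvPolynomial.coeff (Finsupp.single o 1) (lin l) = l o := by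
  classical
  rw [lin, Finsupp.linearCombination_apply, Finsupp.sum, MvPolynomial.coeff_sum]
  simp only [MvPolynomial.coeff_smul, MvPolynomial.coeff_X, smul_eq_mul]
  rw [Finset.sum_eq_single o]
  · simp
  · intro b _ hb
    have : Finsupp.single b 1 ≠ (Finsupp.single o 1 : Option B →₀ ℕ) := by
      intro h
      exact hb (Finsupp.single_left_injective one_ne_zero h)
    simp [this]
  · intro h
    simp only [Finsupp.mem_support_iff, not_not] at h
    simp [h]

lemma lin_injective : Function.Injective (lin : Wt B → Pol B) := by
  intro l l' h
  ext o
  rw [← coeff_lin, h, coeff_lin]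

@[simp] lemma lin_eq_zero {l : Wt B} : lin l = 0 ↔ l = 0 := by
  rw [← map_zero lin, lin_injective.eq_iff]

lemma constantCoeff_lin (l : Wt B) : MvPolynomial.constantCoeff (lin l) = 0 := by
  rw [lin, Finsupp.linearCombination_apply, Finsupp.sum, map_sum]
  refine Finset.sum_eq_zero fun o _ => ?_
  rw [MvPolynomial.smul_eq_C_mul]; simp

/-- The action of `W` on polynomials. -/
def wact (w : W) : Pol B →ₐ[ℝ] Pol B :=
  MvPolynomial.aeval fun o => lin (geo cs w (Finsupp.single o 1))

@[simp] lemma wact_lin (w : W) (l : Wt B) : wact cs w (lin l) = lin (geo cs w l) := by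
  have : (wact cs w).toLinearMap ∘ₗ lin = lin ∘ₗ geo cs w := by
    ext o; simp [wact]
  exact LinearMap.congr_fun this l

lemma polHom_ext {A : Type*} [Semiring A] [Algebra ℝ A] {f g : Pol B →ₐ[ℝ] A}
    (h : ∀ l, f (lin l) = g (lin l)) : f = g :=
  MvPolynomial.algHom_ext fun o => by simpa using h (Finsupp.single o 1)

lemma wact_mul (w w' : W) (r : Pol B) : wact cs (w * w') r = wact cs w (wact cs w' r) := by
  have : wact cs (w * w') = (wact cs w).comp (wact cs w') := polHom_ext fun l => by simp
  rw [this]; rfl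

@[simp] lemma wact_one (r : Pol B) : wact cs 1 r = r := by
  have : wact cs 1 = AlgHom.id ℝ _ := polHom_ext fun l => by simp
  rw [this]; rfl

@[simp] lemma wact_inv_wact (w : W) (r : Pol B) : wact cs w⁻¹ (wact cs w r) = r := by
  rw [← wact_mul]; simp

@[simp] lemma wact_wact_inv (w : W) (r : Pol B) : wact cs w (wact cs w⁻¹ r) = r := by
  rw [← wact_mul]; simp

lemma wact_injective (w : W) : Function.Injective (wact cs w : Pol B → Pol B) :=
  Function.LeftInverse.injective (g := wact cs w⁻¹) (wact_inv_wact cs w)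

variable (M) in
/-- A simple reflection acting on polynomials. -/
def sact (s : B) : Pol B →ₐ[ℝ] Pol B :=
  MvPolynomial.aeval fun o => lin (sref M s (Finsupp.single o 1))

lemma wact_simple (s : B) : wact cs (cs.simple s) = sact M s := by
  simp [wact, sact]

@[simp] lemma sact_lin (s : B) (l : Wt B) : sact M s (lin l) = lin (sref M s l) := by
  have : (sact M s).toLinearMap ∘ₗ lin = lin ∘ₗ sref M s := by
    ext o; simp [sact]
  exact LinearMap.congr_fun this l

@[simp] lemma sact_sact (s : B) (r : Pol B) : sact M s (sact M s r) = r := by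
  have : (sact M s).comp (sact M s) = AlgHom.id ℝ _ := polHom_ext fun l => by simp
  exact DFunLike.congr_fun this r

/-- The simple root as a polynomial. -/
def al (s : B) : Pol B := lin (root s)

lemma al_ne_zero (s : B) : (al s : Pol B) ≠ 0 := by simp [al]

@[simp] lemma sact_al (s : B) : sact M s (al s) = -al s := by simp [al]

lemma al_dvd (s : B) (r : Pol B) : al s ∣ r - sact M s r := by
  induction r using MvPolynomial.induction_on with
  | C a => simp [sact]
  | add p q hp hq =>
    have : p + q - sact M s (p + q) = (p - sact M s p) + (q - sact M s q) := by
      rw [map_add]; ring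
    rw [this]; exact dvd_add hp hq
  | mul_X p o hp =>
    have h1 : sact M s (MvPolynomial.X o) =
        MvPolynomial.X o - coroot M s (Finsupp.single o 1) • al s := by
      rw [← lin_single, sact_lin, sref_apply, map_sub, map_smul]; rfl
    have : p * MvPolynomial.X o - sact M s (p * MvPolynomial.X o) =
        (p - sact M s p) * MvPolynomial.X o +
          al s * (coroot M s (Finsupp.single o 1) • sact M s p) := by
      rw [map_mul, h1]; simp only [MvPolynomial.smul_eq_C_mul]; ring
    rw [this]
    exact dvd_add (hp.mul_right _) (dvd_mul_right _ _)

variable (M) in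
/-- The Demazure operator, as a function. -/
def demFun (s : B) (r : Pol B) : Pol B := (al_dvd (M := M) s r).choose

lemma al_mul_demFun (s : B) (r : Pol B) : al s * demFun M s r = r - sact M s r :=
  (al_dvd (M := M) s r).choose_spec.symm

variable (M) in
/-- The Demazure operator. -/
def dem (s : B) : Pol B →ₗ[ℝ] Pol B where
  toFun := demFun M s
  map_add' p q := by
    apply mul_left_cancel₀ (al_ne_zero s)
    rw [mul_add, al_mul_demFun, al_mul_demFun, al_mul_demFun, map_add]; ring
  map_smul' c p := by
    apply mul_left_cancel₀ (al_ne_zero s)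
    rw [RingHom.id_apply, mul_smul_comm, al_mul_demFun, al_mul_demFun, map_smul, smul_sub]

lemma al_mul_dem (s : B) (r : Pol B) : al s * dem M s r = r - sact M s r := al_mul_demFun s r

lemma dem_mul (s : B) (p q : Pol B) :
    dem M s (p * q) = dem M s p * q + sact M s p * dem M s q := by
  apply mul_left_cancel₀ (al_ne_zero s)
  rw [al_mul_dem, mul_add, ← mul_assoc, al_mul_dem, mul_left_comm, al_mul_dem, map_mul]; ring

@[simp] lemma dem_sact (s : B) (p : Pol B) : dem M s (sact M s p) = -dem M s p := by
  apply mul_left_cancel₀ (al_ne_zero s)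
  rw [al_mul_dem, mul_neg, al_mul_dem, sact_sact]; ring

@[simp] lemma sact_dem (s : B) (p : Pol B) : sact M s (dem M s p) = dem M s p := by
  apply mul_left_cancel₀ (al_ne_zero s)
  have := congrArg (sact M s) (al_mul_dem (M := M) s p)
  rw [map_mul, sact_al, map_sub, sact_sact] at this
  rw [al_mul_dem]
  linear_combination -this

lemma dem_lin (s : B) (l : Wt B) : dem M s (lin l) = MvPolynomial.C (coroot M s l) := by
  apply mul_left_cancel₀ (al_ne_zero s)
  rw [al_mul_dem, sact_lin, sref_apply, map_sub, map_smul, MvPolynomial.smul_eq_C_mul, al]; ring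

@[simp] lemma dem_one (s : B) : dem M s 1 = 0 := by
  apply mul_left_cancel₀ (al_ne_zero s)
  rw [al_mul_dem]; simp

lemma dem_al_mul (s : B) (p : Pol B) : dem M s (al s * p) = p + sact M s p := by
  apply mul_left_cancel₀ (al_ne_zero s)
  rw [al_mul_dem, map_mul, sact_al]; ring

/-! ### Homogeneous components -/

lemma homogeneousComponent_lin_mul (n : ℕ) (l : Wt B) (p : Pol B) :
    MvPolynomial.homogeneousComponent (n + 1) (lin l * p) =
      lin l * MvPolynomial.homogeneousComponent n p := by
  classical
  induction l using Finsupp.induction_linear with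
  | zero => simp
  | add f g hf hg => simp only [map_add, add_mul, hf, hg]
  | single o a =>
    have : (Finsupp.single o a : Wt B) = a • Finsupp.single o 1 := by simp
    rw [this, map_smul, lin_single, smul_mul_assoc, smul_mul_assoc, map_smul]
    congr 1
    ext d
    rw [MvPolynomial.coeff_homogeneousComponent, MvPolynomial.coeff_X_mul',
      MvPolynomial.coeff_X_mul', MvPolynomial.coeff_homogeneousComponent]
    by_cases ho : o ∈ d.support
    · have hd : d = (d - Finsupp.single o 1) + Finsupp.single o 1 := by
        ext a
        have : 1 ≤ d o := Nat.one_le_iff_ne_zero.mpr (Finsupp.mem_support_iff.mp ho)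
        by_cases ha : o = a
        · subst ha; simp; lia
        · simp [ha]
      have hdeg : d.degree = (d - Finsupp.single o 1).degree + 1 := by
        conv_lhs => rw [hd]
        simp
      simp [ho, hdeg]
    · simp [ho]

lemma homogeneousComponent_zero_lin_mul (l : Wt B) (p : Pol B) :
    MvPolynomial.homogeneousComponent 0 (lin l * p) = 0 := by
  rw [MvPolynomial.homogeneousComponent_zero, ← MvPolynomial.constantCoeff_eq, map_mul,
    constantCoeff_lin]
  simp

/-- Homogeneous components, with generators in degree two. -/
def hcomp (k : ℤ) : Pol B →ₗ[ℝ] Pol B :=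
  if 0 ≤ k ∧ Even k then MvPolynomial.homogeneousComponent (k / 2).toNat else 0

lemma hcomp_two_mul (n : ℕ) :
    (hcomp (2 * n) : Pol B →ₗ[ℝ] Pol B) = MvPolynomial.homogeneousComponent n := by
  rw [hcomp, if_pos ⟨by positivity, by simp⟩]
  congr 1
  lia

lemma hcomp_of_ne {k : ℤ} (h : ∀ n : ℕ, k ≠ 2 * n) : (hcomp k : Pol B →ₗ[ℝ] Pol B) = 0 := by
  rw [hcomp, if_neg]
  rintro ⟨h0, j, hj⟩
  exact h (k / 2).toNat (by lia)

lemma hcomp_lin_mul (k : ℤ) (l : Wt B) (p : Pol B) :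
    hcomp (k + 2) (lin l * p) = lin l * hcomp k p := by
  by_cases h : ∃ n : ℕ, k = 2 * n
  · obtain ⟨n, rfl⟩ := h
    rw [show (2 * (n : ℤ) + 2) = 2 * ((n + 1 : ℕ) : ℤ) by push_cast; ring, hcomp_two_mul,
      hcomp_two_mul, homogeneousComponent_lin_mul]
  · push Not at h
    rw [hcomp_of_ne h]
    by_cases h2 : k + 2 = 2 * (0 : ℕ)
    · rw [h2, hcomp_two_mul, homogeneousComponent_zero_lin_mul]; simp
    · rw [hcomp_of_ne]
      · simp
      · intro n hn
        cases n with
        | zero => exact h2 hn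
        | succ n => exact h n (by push_cast at hn; lia)

lemma hcomp_hcomp_self (k : ℤ) (p : Pol B) : hcomp k (hcomp k p) = hcomp k p := by
  by_cases h : ∃ n : ℕ, k = 2 * n
  · obtain ⟨n, rfl⟩ := h
    rw [hcomp_two_mul, MvPolynomial.homogeneousComponent_of_mem
      (MvPolynomial.homogeneousComponent_mem n p)]
    simp
  · push Not at h
    rw [hcomp_of_ne h]; simp

lemma hcomp_hcomp_ne (j k : ℤ) (p : Pol B) (hjk : j ≠ k) : hcomp j (hcomp k p) = 0 := by
  by_cases h : ∃ n : ℕ, k = 2 * n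
  · obtain ⟨n, rfl⟩ := h
    by_cases h' : ∃ n : ℕ, j = 2 * n
    · obtain ⟨n', rfl⟩ := h'
      rw [hcomp_two_mul, hcomp_two_mul, MvPolynomial.homogeneousComponent_of_mem
        (MvPolynomial.homogeneousComponent_mem n p)]
      rw [if_neg]
      rintro rfl
      exact hjk rfl
    · push Not at h'
      rw [hcomp_of_ne h']; simp
  · push Not at h
    rw [hcomp_of_ne h]; simp

lemma hcomp_sep (p : Pol B) (h : ∀ k, hcomp k p = 0) : p = 0 := by
  rw [← MvPolynomial.sum_homogeneousComponent p]
  refine Finset.sum_eq_zero fun n _ => ?_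
  rw [← hcomp_two_mul, h]

lemma hcomp_C (j : ℤ) (a : ℝ) :
    hcomp j (MvPolynomial.C a : Pol B) = if j = 0 then MvPolynomial.C a else 0 := by
  have h0 : hcomp 0 (MvPolynomial.C a : Pol B) = MvPolynomial.C a := by
    have := hcomp_two_mul (B := B) 0
    simp only [Nat.cast_zero, mul_zero] at this
    rw [this, MvPolynomial.homogeneousComponent_zero]
    simp
  split_ifs with h
  · rw [h, h0]
  · rw [← h0, hcomp_hcomp_ne _ _ _ h]

lemma hcomp_hcomp_mul (j k : ℤ) (p q : Pol B) :
    hcomp (j + k) (hcomp j p * q) = hcomp j p * hcomp k q := by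
  induction q using MvPolynomial.induction_on generalizing k with
  | C a =>
    rw [hcomp_C, mul_comm, ← MvPolynomial.smul_eq_C_mul, map_smul]
    split_ifs with h
    · rw [h, add_zero, hcomp_hcomp_self, mul_comm, MvPolynomial.smul_eq_C_mul]
    · rw [hcomp_hcomp_ne _ _ _ (by lia), smul_zero, mul_zero]
  | add q r hq hr => rw [mul_add, map_add, hq, hr, map_add, mul_add]
  | mul_X q o hq =>
    have h1 := hcomp_lin_mul (j + (k - 2)) (Finsupp.single o 1) (hcomp j p * q)
    have h2 := hcomp_lin_mul (k - 2) (Finsupp.single o 1) q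
    rw [lin_single, sub_add_cancel] at h2
    rw [lin_single, hq, show j + (k - 2) + 2 = j + k by ring] at h1
    rw [mul_comm q, mul_left_comm, h1, h2, mul_left_comm]

lemma hcomp_sact (s : B) (k : ℤ) (p : Pol B) : hcomp k (sact M s p) = sact M s (hcomp k p) := by
  induction p using MvPolynomial.induction_on generalizing k with
  | C a =>
    rw [hcomp_C]
    split_ifs with h <;> simp [sact, hcomp_C, h]
  | add p q hp hq => rw [map_add, map_add, hp, hq, map_add, map_add]
  | mul_X p o hp =>
    rw [mul_comm, map_mul, ← lin_single, sact_lin]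
    have h1 := hcomp_lin_mul (k - 2) (sref M s (Finsupp.single o 1)) (sact M s p)
    have h2 := hcomp_lin_mul (k - 2) (Finsupp.single o 1) p
    rw [sub_add_cancel] at h1 h2
    rw [h1, h2, map_mul, sact_lin, hp]

lemma hcomp_dem (s : B) (k : ℤ) (p : Pol B) : hcomp k (dem M s p) = dem M s (hcomp (k + 2) p) := by
  apply mul_left_cancel₀ (al_ne_zero s)
  rw [al_mul_dem, ← hcomp_sact, ← map_sub, ← al_mul_dem]
  exact (hcomp_lin_mul k _ _).symm

/-! ### Graded bimodules with an invariant form and a localization -/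

/-- A graded module with commuting left (`act`) and right (scalar) actions of the polynomial ring,
an invariant form and an embedding into a sum of standard bimodules. -/
structure Obj where
  carrier : Type
  [acg : AddCommGroup carrier]
  [mod : Module (Pol B) carrier]
  [modR : Module ℝ carrier]
  [tower : IsScalarTower ℝ (Pol B) carrier]
  act : Pol B →ₐ[ℝ] Module.End (Pol B) carrier
  pr : ℤ → carrier →ₗ[ℝ] carrier
  pr_pr_self : ∀ k m, pr k (pr k m) = pr k m
  pr_pr_ne : ∀ j k m, j ≠ k → pr j (pr k m) = 0
  pr_smul : ∀ (k : ℤ) (l : Wt B) (m : carrier), pr (k + 2) (lin l • m) = lin l • pr k m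
  pr_act : ∀ (k : ℤ) (l : Wt B) (m : carrier), pr (k + 2) (act (lin l) m) = act (lin l) (pr k m)
  sep : ∀ m, (∀ k, pr k m = 0) → m = 0
  bdd : ∃ n : ℤ, ∀ k < n, ∀ m, pr k m = 0
  form : carrier →ₗ[ℝ] carrier →ₗ[ℝ] Pol B
  form_comm : ∀ m n, form m n = form n m
  form_act : ∀ r m n, form (act r m) n = r * form m n
  form_smul : ∀ (r : Pol B) (m n : carrier), form (r • m) n = form m (r • n)
  form_pr : ∀ (j k : ℤ) (m n : carrier),
    form (pr j m) (pr k n) = hcomp (j + k) (form (pr j m) n)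
  ι : Type
  [fin : Fintype ι]
  lab : ι → W
  emb : carrier →ₗ[Pol B] ι → Pol B
  emb_inj : Function.Injective emb
  emb_act : ∀ r m j, emb (act r m) j = wact cs (lab j)⁻¹ r * emb m j

namespace Obj

attribute [instance] acg mod modR tower fin

instance : CoeSort (Obj cs) Type := ⟨Obj.carrier⟩

variable {cs}
variable (X Y Z : Obj cs)

lemma emb_act_lin (l : Wt B) (m : X) (j : X.ι) :
    X.emb (X.act (lin l) m) j = lin (geo cs (X.lab j)⁻¹ l) * X.emb m j := by
  rw [X.emb_act, wact_lin]

lemma act_smul (r r' : Pol B) (m : X) : X.act r (r' • m) = r' • X.act r m := map_smul _ _ _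

lemma act_mul (r r' : Pol B) (m : X) : X.act (r * r') m = X.act r (X.act r' m) := by
  rw [map_mul]; rfl

lemma act_C (a : ℝ) (m : X) : X.act (MvPolynomial.C a) m = a • m := by
  rw [← MvPolynomial.algebraMap_eq, AlgHom.commutes]
  rw [Module.algebraMap_end_apply]

lemma C_smul (a : ℝ) (m : X) : (MvPolynomial.C a : Pol B) • m = a • m := by
  rw [← MvPolynomial.algebraMap_eq, algebraMap_smul]

lemma act_comm (r r' : Pol B) (m : X) : X.act r (X.act r' m) = X.act r' (X.act r m) := by
  rw [← act_mul, mul_comm, act_mul]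

lemma act_add (r r' : Pol B) (m : X) : X.act (r + r') m = X.act r m + X.act r' m := by
  rw [map_add]; rfl

lemma act_sub (r r' : Pol B) (m : X) : X.act (r - r') m = X.act r m - X.act r' m := by
  rw [map_sub]; rfl

lemma act_neg (r : Pol B) (m : X) : X.act (-r) m = -X.act r m := by
  rw [map_neg]; rfl

lemma form_act_right (r : Pol B) (m n : X) : X.form m (X.act r n) = r * X.form m n := by
  rw [X.form_comm, X.form_act, X.form_comm]

/-- The degree `k` part. -/
def gr (k : ℤ) : Submodule ℝ X := LinearMap.range (X.pr k)

variable {X} in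
lemma mem_gr {k : ℤ} {m : X} : m ∈ X.gr k ↔ X.pr k m = m := by
  constructor
  · rintro ⟨n, rfl⟩; exact X.pr_pr_self k n
  · intro h; exact ⟨m, h⟩

lemma pr_mem (k : ℤ) (m : X) : X.pr k m ∈ X.gr k := ⟨m, rfl⟩

variable {X} in
lemma pr_of_mem_ne {j k : ℤ} {m : X} (h : m ∈ X.gr k) (hjk : j ≠ k) : X.pr j m = 0 := by
  rw [← mem_gr.mp h, X.pr_pr_ne j k m hjk]

lemma act_torsion_free {r : Pol B} {m : X} (hr : r ≠ 0) (h : X.act r m = 0) : m = 0 := by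
  apply X.emb_inj
  rw [map_zero]
  funext j
  have := congrFun (congrArg X.emb h) j
  rw [emb_act, map_zero] at this
  have h0 : wact cs (X.lab j)⁻¹ r ≠ 0 := by
    intro h0
    exact hr (wact_injective cs _ (by rw [h0, map_zero]))
  simpa [h0] using this

end Obj

/-! #### The unit object -/

/-- The unit object. -/
def unit : Obj cs where
  carrier := Pol B
  act := (Algebra.lmul (Pol B) (Pol B)).restrictScalars ℝ
  pr := hcomp
  pr_pr_self := hcomp_hcomp_self
  pr_pr_ne := hcomp_hcomp_ne
  pr_smul k l m := hcomp_lin_mul k l m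
  pr_act k l m := hcomp_lin_mul k l m
  sep := hcomp_sep
  bdd := ⟨0, fun k hk m => by rw [hcomp, if_neg (by lia)]; simp⟩
  form := LinearMap.mul ℝ (Pol B)
  form_comm m n := by simp [mul_comm]
  form_act r m n := by simp [mul_assoc]
  form_smul r m n := by simp [mul_assoc, mul_left_comm]
  form_pr j k m n := (hcomp_hcomp_mul j k m n).symm
  ι := Unit
  lab _ := 1
  emb := LinearMap.pi fun _ => LinearMap.id
  emb_inj p q h := congrFun h ()
  emb_act r m j := by simp

/-! #### Tensoring with a simple Bott–Samelson bimodule -/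

/-- The left action on `B_s X`. -/
def bsAct (s : B) (X : Obj cs) : Pol B →ₐ[ℝ] Module.End (Pol B) (X × X) where
  toFun r :=
    { toFun := fun m => (X.act r m.1 + X.act (dem M s r) m.2, X.act (sact M s r) m.2)
      map_add' := fun m n => by (ext <;> simp); abel
      map_smul' := fun a m => by ext <;> simp }
  map_one' := by ext m <;> simp
  map_mul' p q := by
    ext m
    · simp
    · simp
    · have : dem M s (p * q) = p * dem M s q + dem M s p * sact M s q := by
        rw [mul_comm p q, dem_mul]; ring
      simp [this]
    · simp
  map_zero' := by ext m <;> simp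
  map_add' p q := by
    ext m
    · simp
    · simp
    · simp
    · simp
  commutes' a := by
    ext m
    · simp
    · simp
    · have : dem M s (MvPolynomial.C a) = 0 := by
        rw [← mul_one (MvPolynomial.C a), ← MvPolynomial.smul_eq_C_mul, map_smul]; simp
      simp [this, MvPolynomial.algebraMap_eq]
    · simp

lemma bsAct_apply (s : B) (X : Obj cs) (r : Pol B) (m : X × X) :
    bsAct cs s X r m = (X.act r m.1 + X.act (dem M s r) m.2, X.act (sact M s r) m.2) := rfl

/-- The form on `B_s X`. -/
def bsForm (s : B) (X : Obj cs) : (X × X) →ₗ[ℝ] (X × X) →ₗ[ℝ] Pol B :=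
  LinearMap.mk₂ ℝ
    (fun m n => al s * X.form m.1 n.1 + X.form m.1 n.2 + X.form m.2 n.1 +
      dem M s (X.form m.2 n.2))
    (fun m m' n => by simp [mul_add]; ring)
    (fun a m n => by simp [smul_add])
    (fun m n n' => by simp [mul_add]; ring)
    (fun a m n => by simp [smul_add])

lemma bsForm_apply (s : B) (X : Obj cs) (m n : X × X) : bsForm cs s X m n =
    al s * X.form m.1 n.1 + X.form m.1 n.2 + X.form m.2 n.1 + dem M s (X.form m.2 n.2) := rfl

/-- The object `B_s X`. -/
def bs (s : B) (X : Obj cs) : Obj cs where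
  carrier := X × X
  act := bsAct cs s X
  pr k := (X.pr (k - 1)).prodMap (X.pr (k + 1))
  pr_pr_self k m := by ext <;> simp [X.pr_pr_self]
  pr_pr_ne j k m h := by
    ext
    · simpa using X.pr_pr_ne _ _ _ (by lia)
    · simpa using X.pr_pr_ne _ _ _ (by lia)
  pr_smul k l m := by
    ext
    · simp [← X.pr_smul, show k + 2 - 1 = k - 1 + 2 by ring]
    · simp [← X.pr_smul, show k + 2 + 1 = k + 1 + 2 by ring]
  pr_act k l m := by
    ext
    · simp only [bsAct_apply, dem_lin, LinearMap.prodMap_apply, map_add, Obj.act_C, map_smul,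
        ← X.pr_act, show k + 2 - 1 = k - 1 + 2 by ring]
      rw [show k - 1 + 2 = k + 1 by ring]
    · simp only [bsAct_apply, LinearMap.prodMap_apply, sact_lin, ← X.pr_act,
        show k + 2 + 1 = k + 1 + 2 by ring]
  sep m h := by
    ext
    · exact X.sep _ fun k => by simpa using congrArg Prod.fst (h (k + 1))
    · exact X.sep _ fun k => by simpa using congrArg Prod.snd (h (k - 1))
  bdd := by
    obtain ⟨n, hn⟩ := X.bdd
    exact ⟨n - 1, fun k hk m => by ext <;> simpa using hn _ (by lia) _⟩
  form := bsForm cs s X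
  form_comm m n := by
    rw [bsForm_apply, bsForm_apply, X.form_comm m.1 n.1, X.form_comm m.1 n.2,
      X.form_comm m.2 n.1, X.form_comm m.2 n.2]; ring
  form_act r m n := by
    rw [bsForm_apply, bsForm_apply, bsAct_apply]
    simp only [map_add, LinearMap.add_apply, X.form_act, dem_mul, dem_sact, sact_sact]
    linear_combination (X.form m.2 n.1) * al_mul_dem (M := M) s r
  form_smul r m n := by
    rw [bsForm_apply, bsForm_apply]
    simp only [Prod.smul_fst, Prod.smul_snd, X.form_smul]
  form_pr j k m n := by
    have h := hcomp_lin_mul (j + k - 2) (root s)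
      (X.form (X.pr (j - 1) m.1) n.1)
    rw [sub_add_cancel] at h
    rw [bsForm_apply, bsForm_apply]
    simp only [LinearMap.prodMap_apply, map_add, X.form_pr, hcomp_dem]
    rw [al, h]
    ring_nf
  ι := X.ι ⊕ X.ι
  lab := Sum.elim X.lab (fun j => cs.simple s * X.lab j)
  emb := LinearMap.pi (Sum.elim
    (fun j => LinearMap.proj j ∘ₗ X.emb ∘ₗ (X.act (al s)).coprod LinearMap.id)
    (fun j => LinearMap.proj j ∘ₗ X.emb ∘ₗ LinearMap.snd _ _ _))
  emb_inj := by
    rw [injective_iff_map_eq_zero]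
    rintro ⟨m1, m0⟩ h
    have h0 : m0 = 0 := X.emb_inj (by
      rw [map_zero]; funext j; simpa using congrFun h (Sum.inr j))
    subst h0
    have h1 : X.act (al s) m1 = 0 := X.emb_inj (by
      rw [map_zero]; funext j; simpa using congrFun h (Sum.inl j))
    rw [X.act_torsion_free (al_ne_zero s) h1]; rfl
  emb_act r m j := by
    cases j with
    | inl j =>
      have : X.act (al s) (X.act r m.1 + X.act (dem M s r) m.2) + X.act (sact M s r) m.2 =
          X.act r (X.act (al s) m.1 + m.2) := by
        rw [map_add, map_add, ← X.act_mul (al s) (dem M s r), al_mul_dem, X.act_sub, X.act_comm]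
        abel
      simp only [LinearMap.pi_apply, Sum.elim_inl, LinearMap.comp_apply, bsAct_apply,
        LinearMap.coprod_apply, LinearMap.id_apply, this, LinearMap.proj_apply, X.emb_act]
    | inr j =>
      simp only [LinearMap.pi_apply, Sum.elim_inr, LinearMap.comp_apply, bsAct_apply,
        LinearMap.snd_apply, LinearMap.proj_apply, X.emb_act, mul_inv_rev, wact_mul,
        cs.inv_simple, wact_simple]

section bsLemmas

variable {cs} (s : B) (X : Obj cs)

@[simp] lemma bs_fst_add (m n : bs cs s X) : (m + n).1 = m.1 + n.1 := rfl
@[simp] lemma bs_snd_add (m n : bs cs s X) : (m + n).2 = m.2 + n.2 := rfl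

lemma bs_ext {m n : bs cs s X} (h1 : m.1 = n.1) (h2 : m.2 = n.2) : m = n := Prod.ext h1 h2

lemma bs_act (r : Pol B) (m : bs cs s X) :
    (bs cs s X).act r m = ((X.act r m.1 + X.act (dem M s r) m.2, X.act (sact M s r) m.2) : X × X) :=
  rfl

lemma bs_pr (k : ℤ) (m : bs cs s X) :
    (bs cs s X).pr k m = ((X.pr (k - 1) m.1, X.pr (k + 1) m.2) : X × X) := rfl

lemma bs_form (m n : bs cs s X) : (bs cs s X).form m n =
    al s * X.form m.1 n.1 + X.form m.1 n.2 + X.form m.2 n.1 + dem M s (X.form m.2 n.2) := rfl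

lemma bs_act_lin (l : Wt B) (m : bs cs s X) : (bs cs s X).act (lin l) m =
    ((X.act (lin l) m.1 + coroot M s l • m.2, X.act (lin (sref M s l)) m.2) : X × X) := by
  rw [bs_act, dem_lin, X.act_C, sact_lin]

end bsLemmas

/-- A sub-bimodule, with the induced structure. -/
def Obj.sub {cs : CoxeterSystem M W} (X : Obj cs) (K : Submodule (Pol B) X)
    (hact : ∀ r, ∀ m ∈ K, X.act r m ∈ K) (hpr : ∀ k, ∀ m ∈ K, X.pr k m ∈ K) : Obj cs where
  carrier := K
  act :=
    { toFun := fun r => (X.act r).restrict (hact r)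
      map_one' := by ext; simp
      map_mul' := fun p q => by ext; simp
      map_zero' := by ext; simp
      map_add' := fun p q => by ext; simp
      commutes' := fun a => by ext; simp }
  pr k := (X.pr k).restrict (p := K.restrictScalars ℝ) (q := K.restrictScalars ℝ) (hpr k)
  pr_pr_self k m := Subtype.ext (X.pr_pr_self k m)
  pr_pr_ne j k m h := Subtype.ext (X.pr_pr_ne j k m h)
  pr_smul k l m := Subtype.ext (X.pr_smul k l m)
  pr_act k l m := Subtype.ext (X.pr_act k l m)
  sep m h := Subtype.ext (X.sep m fun k => congrArg Subtype.val (h k))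
  bdd := by
    obtain ⟨n, hn⟩ := X.bdd
    exact ⟨n, fun k hk m => Subtype.ext (hn k hk m)⟩
  form := X.form.domRestrict₁₂ (K.restrictScalars ℝ) (K.restrictScalars ℝ)
  form_comm m n := X.form_comm m n
  form_act r m n := X.form_act r m n
  form_smul r m n := X.form_smul r m n
  form_pr j k m n := X.form_pr j k m n
  ι := X.ι
  lab := X.lab
  emb := X.emb ∘ₗ K.subtype
  emb_inj m n h := Subtype.ext (X.emb_inj h)
  emb_act r m j := X.emb_act r m j

end

section

variable {B W : Type} [Group W] {M : CoxeterMatrix B} {cs : CoxeterSystem M W}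

/-! ### Divisibility by linear forms and saturation of projective submodules -/

lemma dvd_of_dvd_mul {l₁ l₂ : Wt B} (h : LinearIndependent ℝ ![l₁, l₂]) {p : Pol B}
    (hp : lin l₁ ∣ lin l₂ * p) : lin l₁ ∣ p := by
  have h1 : l₁ ≠ 0 := by simpa using h.ne_zero 0
  obtain ⟨i, hi⟩ : ∃ i, l₁ i ≠ 0 := by
    by_contra! hc
    exact h1 (Finsupp.ext hc)
  classical
  set π : Wt B →ₗ[ℝ] Wt B := LinearMap.id - ((l₁ i)⁻¹ • Finsupp.lapply i).smulRight l₁ with hπ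
  have hπa (l : Wt B) : π l = l - ((l₁ i)⁻¹ * l i) • l₁ := by simp [hπ]
  set ψ : Pol B →ₐ[ℝ] Pol B := MvPolynomial.aeval fun o => lin (π (Finsupp.single o 1)) with hψ
  have hψl (l : Wt B) : ψ (lin l) = lin (π l) := by
    have : ψ.toLinearMap ∘ₗ lin = lin ∘ₗ π := by
      ext o; simp [ψ]
    exact LinearMap.congr_fun this l
  have hd (q : Pol B) : lin l₁ ∣ q - ψ q := by
    induction q using MvPolynomial.induction_on with
    | C a => simp [ψ]
    | add p q hp hq =>
      have : p + q - ψ (p + q) = (p - ψ p) + (q - ψ q) := by rw [map_add]; ring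
      rw [this]; exact dvd_add hp hq
    | mul_X p o hp =>
      have h1 : ψ (MvPolynomial.X o) = MvPolynomial.X o -
          MvPolynomial.C ((l₁ i)⁻¹ * (Finsupp.single o (1 : ℝ) : Wt B) i) * lin l₁ := by
        rw [← lin_single, hψl, hπa, map_sub, map_smul, MvPolynomial.smul_eq_C_mul]
      have : p * MvPolynomial.X o - ψ (p * MvPolynomial.X o) = (p - ψ p) * MvPolynomial.X o +
          lin l₁ * (MvPolynomial.C ((l₁ i)⁻¹ * (Finsupp.single o (1 : ℝ) : Wt B) i) * ψ p) := by
        rw [map_mul, h1]; ring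
      rw [this]
      exact dvd_add (hp.mul_right _) (dvd_mul_right _ _)
  have hz : ψ (lin l₁) = 0 := by
    rw [hψl, hπa, inv_mul_cancel₀ hi]; simp
  have hmul : ψ (lin l₂) * ψ p = 0 := by
    obtain ⟨q, hq⟩ := hp
    rw [← map_mul, hq, map_mul, hz, zero_mul]
  rcases mul_eq_zero.mp hmul with h0 | h0
  · exfalso
    rw [hψl, lin_eq_zero, hπa] at h0
    have := LinearIndependent.pair_iff.mp h (-((l₁ i)⁻¹ * l₂ i)) 1 (by
      rw [← h0]; module)
    exact one_ne_zero this.2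
  · simpa [h0] using hd p

lemma mem_of_smul_mem {Q : Type} [AddCommGroup Q] [Module (Pol B) Q]
    (htf : ∀ (r : Pol B) (x : Q), r ≠ 0 → r • x = 0 → x = 0)
    (P : Submodule (Pol B) Q) [Projective (Pol B) P] {l₁ l₂ : Wt B}
    (h : LinearIndependent ℝ ![l₁, l₂]) {x : Q} (h1 : lin l₁ • x ∈ P) (h2 : lin l₂ • x ∈ P) :
    x ∈ P := by
  have hne : l₁ ≠ 0 := by simpa using h.ne_zero 0
  obtain ⟨s, hs⟩ := Module.projective_def'.mp (inferInstance : Projective (Pol B) P)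
  set p₁ : P := ⟨_, h1⟩
  set p₂ : P := ⟨_, h2⟩
  have hp : lin l₂ • p₁ = lin l₁ • p₂ := Subtype.ext (by
    simp only [p₁, p₂, Submodule.coe_smul, smul_smul, mul_comm])
  have hd (e : P) : lin l₁ ∣ s p₁ e := by
    apply dvd_of_dvd_mul h
    have := congrArg (fun p => s p e) hp
    simp only [map_smul, Finsupp.smul_apply, smul_eq_mul] at this
    exact ⟨_, this⟩
  choose c hc using hd
  have hsum : p₁ = lin l₁ • ∑ e ∈ (s p₁).support, c e • e := by
    conv_lhs => rw [← LinearMap.id_apply (R := Pol B) p₁, ← hs]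
    rw [LinearMap.comp_apply, Finsupp.linearCombination_apply, Finsupp.sum, Finset.smul_sum]
    refine Finset.sum_congr rfl fun e _ => ?_
    rw [hc e, mul_smul]; rfl
  have : x = ((∑ e ∈ (s p₁).support, c e • e : P) : Q) := by
    rw [← sub_eq_zero]
    apply htf (lin l₁) _ (by simpa using hne)
    rw [smul_sub, sub_eq_zero, ← Submodule.coe_smul, ← hsum]
  rw [this]
  exact Submodule.coe_mem _

/-! ### Supports -/

namespace Obj

variable (X Y : Obj cs)

/-- Sections supported on a set of labels. -/
def sup (J : Set W) : Submodule (Pol B) X where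
  carrier := {m | ∀ j, X.lab j ∉ J → X.emb m j = 0}
  zero_mem' j _ := by simp
  add_mem' hm hn j hj := by simp [hm j hj, hn j hj]
  smul_mem' r m hm j hj := by simp [hm j hj]

variable {X} in
lemma mem_sup {J : Set W} {m : X} : m ∈ X.sup J ↔ ∀ j, X.lab j ∉ J → X.emb m j = 0 := Iff.rfl

variable {X} in
lemma sup_mono {J J' : Set W} (h : J ⊆ J') : X.sup J ≤ X.sup J' :=
  fun _ hm j hj => hm j fun hj' => hj (h hj')

variable {X} in
lemma mem_sup_inter {J J' : Set W} {m : X} (h : m ∈ X.sup J) (h' : m ∈ X.sup J') :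
    m ∈ X.sup (J ∩ J') := fun j hj => by
  by_cases hJ : X.lab j ∈ J
  · exact h' j fun hJ' => hj ⟨hJ, hJ'⟩
  · exact h j hJ

/-- The finite set of labels. -/
def labels : Set W := Set.range X.lab

lemma labels_finite : X.labels.Finite := Set.finite_range _

variable {X} in
lemma sup_le_of_inter {J J' : Set W} (h : J ∩ X.labels ⊆ J') : X.sup J ≤ X.sup J' :=
  fun _ hm j hj => hm j fun hj' => hj (h ⟨hj', j, rfl⟩)

variable {X} in
lemma act_mem_sup {J : Set W} {m : X} (h : m ∈ X.sup J) (r : Pol B) : X.act r m ∈ X.sup J :=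
  fun j hj => by rw [X.emb_act, h j hj, mul_zero]

variable {X} in
lemma sup_smul_mem {J : Set W} {m : X} {r : Pol B} (hr : r ≠ 0) (h : r • m ∈ X.sup J) :
    m ∈ X.sup J := fun j hj => by
  have := h j hj
  rw [map_smul, Pi.smul_apply, smul_eq_mul] at this
  exact (mul_eq_zero.mp this).resolve_left hr

variable {X} in
lemma sup_act_mem {J : Set W} {m : X} {r : Pol B} (hr : r ≠ 0) (h : X.act r m ∈ X.sup J) :
    m ∈ X.sup J := fun j hj => by
  have := h j hj
  rw [emb_act] at this
  refine (mul_eq_zero.mp this).resolve_left fun h0 => hr (wact_injective cs (X.lab j)⁻¹ ?_)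
  rw [h0, map_zero]

/-- The difference of the two actions of a weight, twisted by `f`. -/
def dif (f : W) (l : Wt B) : X →ₗ[Pol B] X :=
  lin l • LinearMap.id - X.act (lin (geo cs f l))

lemma dif_apply (f : W) (l : Wt B) (m : X) :
    X.dif f l m = lin l • m - X.act (lin (geo cs f l)) m := rfl

lemma emb_dif (f : W) (l : Wt B) (m : X) (j : X.ι) :
    X.emb (X.dif f l m) j = lin (l - geo cs ((X.lab j)⁻¹ * f) l) * X.emb m j := by
  rw [dif_apply, map_sub, map_smul, Pi.sub_apply, Pi.smul_apply, emb_act_lin, ← geo_mul_apply,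
    map_sub, smul_eq_mul]
  ring

lemma pr_dif (f : W) (l : Wt B) (k : ℤ) (m : X) :
    X.pr (k + 2) (X.dif f l m) = X.dif f l (X.pr k m) := by
  rw [dif_apply, map_sub, X.pr_smul, X.pr_act]; rfl

/-- A product of differences with kernel the sections supported on a list of labels. -/
def op : List W → X →ₗ[Pol B] X
  | [] => LinearMap.id
  | f :: F => X.dif f rho ∘ₗ op F

lemma pr_op (F : List W) (k : ℤ) (m : X) :
    X.pr (k + 2 * F.length) (X.op F m) = X.op F (X.pr k m) := by
  induction F with
  | nil => simp [op]
  | cons f F ih =>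
    rw [op, LinearMap.comp_apply, LinearMap.comp_apply, ← ih, ← pr_dif]
    congr 2
    simp; ring

lemma op_eq_zero_iff (F : List W) (m : X) : X.op F m = 0 ↔ m ∈ X.sup {f | f ∈ F} := by
  have key (j : X.ι) : X.emb (X.op F m) j = 0 ↔ X.lab j ∈ F ∨ X.emb m j = 0 := by
    induction F with
    | nil => simp [op]
    | cons f F ih =>
      rw [op, LinearMap.comp_apply, emb_dif, mul_eq_zero, ih, List.mem_cons, or_assoc]
      refine or_congr_left ?_
      rw [lin_eq_zero, sub_eq_zero]
      constructor
      · intro h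
        have := geo_rho_inj cs h.symm
        exact inv_mul_eq_one.mp this
      · intro h; simp [h]
  constructor
  · intro h j hj
    exact ((key j).mp (by rw [h]; simp)).resolve_left hj
  · intro h
    apply X.emb_inj
    rw [map_zero]
    funext j
    by_cases hj : X.lab j ∈ F
    · exact (key j).mpr (Or.inl hj)
    · exact (key j).mpr (Or.inr (h j hj))

/-- The labels in a given set, as a list. -/
def labelList (J : Set W) : List W := ((X.labels_finite.inter_of_right J).toFinset).toList

lemma mem_labelList {J : Set W} {f : W} : f ∈ X.labelList J ↔ f ∈ J ∧ f ∈ X.labels := by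
  simp [labelList]

lemma sup_eq_labelList (J : Set W) : X.sup J = X.sup {f | f ∈ X.labelList J} :=
  le_antisymm (sup_le_of_inter fun _ h => X.mem_labelList.mpr h)
    (sup_mono fun _ h => (X.mem_labelList.mp h).1)

variable {X} in
lemma pr_mem_sup {J : Set W} {m : X} (h : m ∈ X.sup J) (k : ℤ) : X.pr k m ∈ X.sup J := by
  rw [sup_eq_labelList, ← op_eq_zero_iff] at h ⊢
  rw [← pr_op, h, map_zero]

variable {X Y} in
lemma map_mem_sup {f : X →ₗ[Pol B] Y} (hf : ∀ r m, f (X.act r m) = Y.act r (f m))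
    {J : Set W} {m : X} (h : m ∈ X.sup J) : f m ∈ Y.sup J := by
  rw [sup_eq_labelList, ← op_eq_zero_iff] at h
  have hop (F : List W) (m : X) : f (X.op F m) = Y.op F (f m) := by
    induction F generalizing m with
    | nil => rfl
    | cons g F ih =>
      rw [op, op, LinearMap.comp_apply, LinearMap.comp_apply, ← ih, dif_apply, dif_apply, map_sub,
        map_smul, hf]
  have : f m ∈ Y.sup {g | g ∈ X.labelList J} := by
    rw [← op_eq_zero_iff, ← hop, h, map_zero]
  exact sup_mono (fun g hg => (X.mem_labelList.mp hg).1) this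

/-- The quotient of sections seen by a set of labels. -/
abbrev loc (J : Set W) := X ⧸ X.sup Jᶜ

/-- The projection to the quotient of sections seen by a set of labels. -/
abbrev ev (J : Set W) : X →ₗ[Pol B] X.loc J := (X.sup Jᶜ).mkQ

variable {X} in
lemma ev_eq_zero {J : Set W} {m : X} : X.ev J m = 0 ↔ m ∈ X.sup Jᶜ := by
  rw [Submodule.mkQ_apply, Submodule.Quotient.mk_eq_zero]

variable {X} in
lemma ev_eq {J : Set W} {m n : X} : X.ev J m = X.ev J n ↔ m - n ∈ X.sup Jᶜ := by
  rw [← ev_eq_zero, map_sub, sub_eq_zero]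

lemma loc_torsion_free (J : Set W) (r : Pol B) (x : X.loc J) (hr : r ≠ 0) (h : r • x = 0) :
    x = 0 := by
  obtain ⟨m, rfl⟩ := Submodule.mkQ_surjective _ x
  rw [← map_smul, ev_eq_zero] at h
  exact ev_eq_zero.mpr (sup_smul_mem hr h)

/-- The sections supported on `A`, seen at `J`. -/
def img (J A : Set W) : Submodule (Pol B) (X.loc J) := (X.sup A).map (X.ev J)

variable {X} in
lemma mem_img {J A : Set W} {x : X.loc J} : x ∈ X.img J A ↔ ∃ m ∈ X.sup A, X.ev J m = x := Iff.rfl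

variable {X} in
lemma ev_act_single {w : W} (l : Pol B) (m : X) :
    X.ev {w} (X.act l m) = wact cs w⁻¹ l • X.ev {w} m := by
  rw [← map_smul, ev_eq]
  intro j hj
  simp only [Set.mem_compl_iff, Set.mem_singleton_iff, not_not] at hj
  rw [map_sub, Pi.sub_apply, emb_act, map_smul, hj]; simp

end Obj

/-- An injective height function compatible with the Bruhat order. -/
structure IsHeight (cs : CoxeterSystem M W) {P : Type} [LinearOrder P] (h : W → P) : Prop where
  inj : Function.Injective h
  lt : ∀ w t, cs.IsReflection t → cs.length w < cs.length (w * t) → h w < h (w * t)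

/-- Sets of labels closed under going down. -/
def Closed (cs : CoxeterSystem M W) (J : Set W) : Prop :=
  ∀ f ∈ J, ∀ t, cs.IsReflection t → cs.length (f * t) < cs.length f → f * t ∈ J

/-- There is nothing above `w` in `J`. -/
def Top (cs : CoxeterSystem M W) (J : Set W) (w : W) : Prop :=
  ∀ t, cs.IsReflection t → cs.length w < cs.length (w * t) → w * t ∉ J

lemma length_mul_reflection_ne {w t : W} (ht : cs.IsReflection t) :
    cs.length (w * t) ≠ cs.length w := by
  intro h
  have h1 := ht.odd_length
  have h2 : (cs.length (w * t)) % 2 = (cs.length w + cs.length t) % 2 := cs.length_mul_mod_two w t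
  rw [h] at h2
  obtain ⟨k, hk⟩ := h1
  lia

lemma reflection_mul_self {w t : W} (ht : cs.IsReflection t) : w * t * t = w := by
  rw [mul_assoc, ht.mul_self, mul_one]

section Height

variable {P : Type} [LinearOrder P] {h : W → P}

lemma IsHeight.closed (hh : IsHeight cs h) (p : P) : Closed cs {f | h f ≤ p} := by
  intro f hf t ht hl
  have := hh.lt (f * t) t ht (by rwa [reflection_mul_self ht])
  rw [reflection_mul_self ht] at this
  exact this.le.trans hf

lemma IsHeight.top (hh : IsHeight cs h) (w : W) : Top cs {f | h f ≤ h w} w :=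
  fun t ht hl hle => absurd (hh.lt w t ht hl) (not_lt.mpr hle)

namespace Obj

variable {X : Obj cs}

lemma ev_mem_img_of_top (hh : IsHeight cs h) {J : Set W} {w : W}
    [hp : Projective (Pol B) (X.img {w} {f | h f ≤ h w})] (hw : Top cs J w) {u : X}
    (hu : u ∈ X.sup J) : X.ev {w} u ∈ X.img {w} {f | h f ≤ h w} := by
  classical
  have key (F : Finset W) : (∀ f ∈ F, f ≠ w ∧ ¬ cs.IsReflection (w⁻¹ * f)) →
      ∀ u ∈ X.sup ({f | h f ≤ h w} ∪ F), X.ev {w} u ∈ X.img {w} {f | h f ≤ h w} := by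
    induction F using Finset.induction_on with
    | empty => intro _ u hu; exact ⟨u, by simpa using hu, rfl⟩
    | insert f F hf ih =>
      intro hF u hu
      have ih := ih fun f hf => hF f (Finset.mem_insert_of_mem hf)
      obtain ⟨hfw, hr⟩ := hF f (Finset.mem_insert_self _ _)
      obtain ⟨l₁, l₂, hl⟩ := exists_independent cs (g := w⁻¹ * f)
        (fun h => hfw (inv_mul_eq_one.mp h).symm) hr
      have hmem (l : Wt B) : lin (l - geo cs (w⁻¹ * f) l) • X.ev {w} u ∈
          X.img {w} {f | h f ≤ h w} := by
        have := ih (X.dif f l u) (by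
          intro j hj
          rw [emb_dif]
          by_cases hjf : X.lab j = f
          · simp [hjf]
          · rw [hu j (by simpa [hjf] using hj), mul_zero])
        rwa [dif_apply, map_sub, ev_act_single, wact_lin, map_smul, ← sub_smul, ← map_sub,
          ← geo_mul_apply] at this
      exact mem_of_smul_mem (X.loc_torsion_free {w}) _ hl (hmem l₁) (hmem l₂)
  refine key ((X.labels_finite.inter_of_right (J ∩ {f | h w < h f})).toFinset) ?_ u ?_
  · intro f hf
    simp only [Set.Finite.mem_toFinset, Set.mem_inter_iff, Set.mem_ofPred_eq] at hf
    obtain ⟨⟨hfJ, hlt⟩, -⟩ := hf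
    refine ⟨fun e => by simp [e] at hlt, fun ht => ?_⟩
    have hft : w * (w⁻¹ * f) = f := by group
    rcases lt_or_gt_of_ne (length_mul_reflection_ne (cs := cs) (w := w) ht) with hl | hl
    · have := hh.lt (w * (w⁻¹ * f)) _ ht (by rwa [reflection_mul_self ht])
      rw [reflection_mul_self ht, hft] at this
      exact absurd this hlt.not_gt
    · exact hw _ ht hl (by rwa [hft])
  · refine sup_le_of_inter ?_ hu
    rintro f ⟨hf, hl⟩
    rcases le_or_gt (h f) (h w) with hle | hlt
    · exact Or.inl hle
    · right; simp [hf, hl, hlt]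

lemma exists_lift (hh : IsHeight cs h)
    (hp : ∀ w, Projective (Pol B) (X.img {w} {f | h f ≤ h w})) {J : Set W}
    (hJ : Closed cs J) (w : W) {u : X} (hu : u ∈ X.sup ({f | h f < h w} ∪ J)) :
    ∃ u' ∈ X.sup J, u - u' ∈ X.sup {f | h f < h w} := by
  classical
  have hfin : (X.labels ∩ {f | f ∉ J ∧ h f < h w}).Finite := X.labels_finite.inter_of_left _
  have key (F : Finset W) : (∀ f ∈ F, f ∉ J ∧ h f < h w) →
      (∀ g ∈ X.labels, g ∉ J → ∀ f ∈ F, h g ≤ h f → g ∈ F) → ∀ u ∈ X.sup (J ∪ F),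
      ∃ u' ∈ X.sup J, u - u' ∈ X.sup {f | h f < h w} := by
    induction F using Finset.induction_on_max_value h with
    | empty => intro _ _ u hu; exact ⟨u, by simpa using hu, by simp⟩
    | insert a s has hmax ih =>
      intro hF hlow u hu
      obtain ⟨haJ, haw⟩ := hF a (Finset.mem_insert_self _ _)
      have ih := ih (fun f hf => hF f (Finset.mem_insert_of_mem hf)) (by
        intro g hg hgJ f hf hgf
        have := hlow g hg hgJ f (Finset.mem_insert_of_mem hf) hgf
        rcases Finset.mem_insert.mp this with rfl | h'
        · rw [hh.inj (le_antisymm hgf (hmax f hf))]; exact hf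
        · exact h')
      have := hp a
      obtain ⟨v, hv, hvu⟩ := ev_mem_img_of_top (w := a) hh (J := J ∪ (insert a s : Finset W)) (by
        intro t ht hl hmem
        rcases hmem with hmem | hmem
        · have := hJ _ hmem t ht (by rwa [reflection_mul_self ht])
          rw [reflection_mul_self ht] at this
          exact haJ this
        · have h1 := hh.lt a t ht hl
          rcases Finset.mem_insert.mp hmem with h' | h'
          · rw [h'] at h1; exact lt_irrefl _ h1
          · exact absurd h1 (not_lt.mpr (hmax _ h'))) hu
      have hva : v - u ∈ X.sup {a}ᶜ := ev_eq.mp hvu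
      obtain ⟨u', hu', huu⟩ := ih (u - v) (by
        have h1 : u - v ∈ X.sup (J ∪ (insert a s : Finset W) ∪ {f | h f ≤ h a}) :=
          Submodule.sub_mem _ (sup_mono (by intro f hf; exact Or.inl hf) hu)
            (sup_mono (by intro f hf; exact Or.inr hf) hv)
        have h2 : u - v ∈ X.sup {a}ᶜ := by
          rw [← neg_sub]; exact Submodule.neg_mem _ hva
        refine sup_le_of_inter ?_ (mem_sup_inter h1 h2)
        rintro f ⟨⟨hf, hfa⟩, hfl⟩
        have hfa : f ≠ a := hfa
        by_cases hfJ : f ∈ J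
        · exact Or.inl hfJ
        right
        rcases hf with (hf | hf) | hf
        · exact (hfJ hf).elim
        · exact (Finset.mem_insert.mp hf).resolve_left hfa
        · exact (Finset.mem_insert.mp (hlow f hfl hfJ a (Finset.mem_insert_self _ _) hf)).resolve_left
            hfa)
      refine ⟨u', hu', ?_⟩
      have : u - u' = (u - v - u') + v := by abel
      rw [this]
      exact Submodule.add_mem _ huu (sup_mono (fun f hf => lt_of_le_of_lt hf haw) hv)
  refine key hfin.toFinset (by simp) ?_ u ?_
  · intro g hg hgJ f hf hgf
    simp only [Set.Finite.mem_toFinset, Set.mem_inter_iff, Set.mem_ofPred_eq] at hf ⊢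
    exact ⟨hg, hgJ, lt_of_le_of_lt hgf hf.2.2⟩
  · refine sup_le_of_inter ?_ hu
    rintro f ⟨hf, hl⟩
    by_cases hfJ : f ∈ J
    · exact Or.inl hfJ
    · right
      simpa [hl, hfJ] using hf

theorem img_eq_of_top (hh : IsHeight cs h)
    (hp : ∀ w, Projective (Pol B) (X.img {w} {f | h f ≤ h w})) {J : Set W}
    (hJ : Closed cs J) {w : W} (hwJ : w ∈ J) (hw : Top cs J w) :
    X.img {w} J = X.img {w} {f | h f ≤ h w} := by
  apply le_antisymm
  · rintro x ⟨u, hu, rfl⟩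
    exact ev_mem_img_of_top hh hw hu
  · rintro x ⟨u, hu, rfl⟩
    obtain ⟨u', hu', huu⟩ := exists_lift hh hp hJ w (u := u) (sup_mono (by
      intro f hf
      rcases lt_or_eq_of_le (show h f ≤ h w from hf) with h' | h'
      · exact Or.inl h'
      · right; rwa [hh.inj h']) hu)
    refine ⟨u', hu', Eq.symm (ev_eq.mpr (sup_mono ?_ huu))⟩
    intro f hf e
    rw [Set.mem_singleton_iff.mp e] at hf
    exact lt_irrefl _ hf

end Obj

end Height

/-! ### Good objects -/

/-- Objects all of whose subquotients are projective. -/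
def Good (X : Obj cs) : Prop :=
  ∀ (J : Set W) (w : W), Closed cs J → w ∈ J → Top cs J w → Projective (Pol B) (X.img {w} J)

lemma good_of_height {P : Type} [LinearOrder P] {h : W → P} (hh : IsHeight cs h) {X : Obj cs}
    (hp : ∀ w, Projective (Pol B) (X.img {w} {f | h f ≤ h w})) : Good X := by
  intro J w hJ hwJ hw
  rw [Obj.img_eq_of_top hh hp hJ hwJ hw]
  exact hp w

lemma Good.height {P : Type} [LinearOrder P] {h : W → P} (hh : IsHeight cs h) {X : Obj cs}
    (hX : Good X) (w : W) : Projective (Pol B) (X.img {w} {f | h f ≤ h w}) :=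
  hX _ w (hh.closed _) (Set.mem_ofPred.mpr le_rfl) (hh.top w)

open Classical in
/-- The ambient linear order on the group. -/
@[reducible] def wOrder (W : Type) : LinearOrder W := linearOrderOfSTO (WellOrderingRel (α := W))

attribute [local instance] wOrder

/-- The height refining the length. -/
def lenHt (cs : CoxeterSystem M W) (w : W) : ℕ ×ₗ W := toLex (cs.length w, w)

lemma lenHt_isHeight (cs : CoxeterSystem M W) : IsHeight cs (lenHt cs) where
  inj w w' h := by
    have := congrArg (fun p => (ofLex p).2) h
    exact this
  lt w t _ hl := by
    rw [lenHt, lenHt, Prod.Lex.toLex_lt_toLex]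
    exact Or.inl hl

end

section

variable {B W : Type} [Group W] {M : CoxeterMatrix B} {cs : CoxeterSystem M W}

/-! ### Graded ranks -/

section GradedRank

variable {P P₁ P₂ : Type} [AddCommGroup P] [Module (Pol B) P] [Module ℝ P]
  [IsScalarTower ℝ (Pol B) P] [AddCommGroup P₁] [Module (Pol B) P₁] [Module ℝ P₁]
  [IsScalarTower ℝ (Pol B) P₁] [AddCommGroup P₂] [Module (Pol B) P₂] [Module ℝ P₂]
  [IsScalarTower ℝ (Pol B) P₂]

/-- The decomposable part in degree `k` of a family of subspaces. -/
def lam (𝓖 : ℤ → Submodule ℝ P) (k : ℤ) : Submodule ℝ P :=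
  Submodule.span ℝ {x | ∃ l : Wt B, ∃ g ∈ 𝓖 (k - 2), x = lin l • g}

/-- The indecomposable quotient in degree `k` has dimension `n`. -/
def HasQ (𝓖 : ℤ → Submodule ℝ P) (k n : ℤ) : Prop :=
  Module.Finite ℝ (𝓖 k ⧸ (lam (B := B) 𝓖 k).submoduleOf (𝓖 k)) ∧
    (finrank ℝ (𝓖 k ⧸ (lam (B := B) 𝓖 k).submoduleOf (𝓖 k)) : ℤ) = n

lemma map_lam_le {𝓖 : ℤ → Submodule ℝ P₁} {𝓗 : ℤ → Submodule ℝ P₂} {k d : ℤ}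
    (f : P₁ →ₗ[Pol B] P₂) (hf : ∀ x ∈ 𝓖 (k - 2), f x ∈ 𝓗 (k + d - 2)) {x : P₁}
    (hx : x ∈ lam (B := B) 𝓖 k) : f x ∈ lam (B := B) 𝓗 (k + d) := by
  induction hx using Submodule.span_induction with
  | mem x h =>
    obtain ⟨l, g, hg, rfl⟩ := h
    exact Submodule.subset_span ⟨l, f g, hf g hg, map_smul _ _ _⟩
  | zero => simp
  | add x y _ _ hx hy => rw [map_add]; exact Submodule.add_mem _ hx hy
  | smul a x _ hx =>
    rw [show f (a • x) = a • f x from (f.restrictScalars ℝ).map_smul a x]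
    exact Submodule.smul_mem _ _ hx

theorem hasQ_exact {𝓐 : ℤ → Submodule ℝ P} {𝓔 : ℤ → Submodule ℝ P₁} {𝓑 : ℤ → Submodule ℝ P₂}
    (f : P →ₗ[Pol B] P₁) (g : P₁ →ₗ[Pol B] P₂) {k : ℤ}
    (hf : ∀ k, ∀ x ∈ 𝓐 k, f x ∈ 𝓔 k) (hg : ∀ k, ∀ x ∈ 𝓔 k, g x ∈ 𝓑 k)
    (hgf : ∀ x ∈ 𝓐 k, g (f x) = 0)
    (hsurj : ∀ k, ∀ y ∈ 𝓑 k, ∃ x ∈ 𝓔 k, g x = y)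
    (hgr : ∀ x ∈ 𝓔 (k - 2), ∀ l : Wt B, lin l • x ∈ 𝓔 k)
    (hker : ∀ x ∈ 𝓔 k, g x = 0 → ∃ y ∈ 𝓐 k, f y = x)
    (hstrict : ∀ x ∈ 𝓐 k, f x ∈ lam (B := B) 𝓔 k → x ∈ lam (B := B) 𝓐 k) {a : ℤ}
    (ha : HasQ (B := B) 𝓐 k a) :
    (∀ b, HasQ (B := B) 𝓑 k b → HasQ (B := B) 𝓔 k (a + b)) ∧
      ∀ e, HasQ (B := B) 𝓔 k e → HasQ (B := B) 𝓑 k (e - a) := by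
  obtain ⟨ha1, ha2⟩ := ha
  have hlf (x : P) (hx : x ∈ lam (B := B) 𝓐 k) : f x ∈ lam (B := B) 𝓔 k := by
    have := map_lam_le (𝓗 := 𝓔) (d := 0) f (by simpa using hf (k - 2)) hx
    simpa using this
  have hlg (x : P₁) (hx : x ∈ lam (B := B) 𝓔 k) : g x ∈ lam (B := B) 𝓑 k := by
    have := map_lam_le (𝓗 := 𝓑) (d := 0) g (by simpa using hg (k - 2)) hx
    simpa using this
  have hle : lam (B := B) 𝓔 k ≤ 𝓔 k := Submodule.span_le.mpr (by
    rintro _ ⟨l, x, hx, rfl⟩; exact hgr x hx l)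
  have hlb (y : P₂) (hy : y ∈ lam (B := B) 𝓑 k) : ∃ x ∈ lam (B := B) 𝓔 k, g x = y := by
    induction hy using Submodule.span_induction with
    | mem y h =>
      obtain ⟨l, z, hz, rfl⟩ := h
      obtain ⟨x, hx, rfl⟩ := hsurj _ z hz
      exact ⟨lin l • x, Submodule.subset_span ⟨l, x, hx, rfl⟩, map_smul _ _ _⟩
    | zero => exact ⟨0, Submodule.zero_mem _, map_zero _⟩
    | add x y _ _ hx hy =>
      obtain ⟨x', h1, rfl⟩ := hx
      obtain ⟨y', h2, rfl⟩ := hy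
      exact ⟨x' + y', Submodule.add_mem _ h1 h2, map_add _ _ _⟩
    | smul a x _ hx =>
      obtain ⟨x', h1, rfl⟩ := hx
      exact ⟨a • x', Submodule.smul_mem _ _ h1, (g.restrictScalars ℝ).map_smul a x'⟩
  let f₀ : 𝓐 k →ₗ[ℝ] 𝓔 k := (f.restrictScalars ℝ).restrict (hf k)
  let g₀ : 𝓔 k →ₗ[ℝ] 𝓑 k := (g.restrictScalars ℝ).restrict (hg k)
  let f₁ := Submodule.mapQ ((lam (B := B) 𝓐 k).submoduleOf (𝓐 k))
    ((lam (B := B) 𝓔 k).submoduleOf (𝓔 k)) f₀ (fun x hx => hlf x hx)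
  let g₁ := Submodule.mapQ ((lam (B := B) 𝓔 k).submoduleOf (𝓔 k))
    ((lam (B := B) 𝓑 k).submoduleOf (𝓑 k)) g₀ (fun x hx => hlg x hx)
  have hf₁ : Function.Injective f₁ := by
    rw [injective_iff_map_eq_zero]
    intro x hx
    obtain ⟨x, rfl⟩ := Submodule.mkQ_surjective _ x
    have h1 : Submodule.Quotient.mk (p := (lam (B := B) 𝓔 k).submoduleOf (𝓔 k)) (f₀ x) = 0 := hx
    rw [Submodule.Quotient.mk_eq_zero] at h1
    exact (Submodule.Quotient.mk_eq_zero _).mpr (hstrict x x.2 h1)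
  have hg₁ : Function.Surjective g₁ := by
    intro y
    obtain ⟨y, rfl⟩ := Submodule.mkQ_surjective _ y
    obtain ⟨x, hx, hxy⟩ := hsurj k y y.2
    refine ⟨Submodule.mkQ _ ⟨x, hx⟩, ?_⟩
    change Submodule.mkQ _ (g₀ ⟨x, hx⟩) = _
    congr 1
    exact Subtype.ext hxy
  have hex : LinearMap.ker g₁ = LinearMap.range f₁ := by
    apply le_antisymm
    · intro x hx
      obtain ⟨x, rfl⟩ := Submodule.mkQ_surjective _ x
      have h1 : Submodule.Quotient.mk (p := (lam (B := B) 𝓑 k).submoduleOf (𝓑 k)) (g₀ x) = 0 := hx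
      rw [Submodule.Quotient.mk_eq_zero] at h1
      obtain ⟨z, hz, hzx⟩ := hlb _ h1
      obtain ⟨y, hy, hyx⟩ := hker (x - z) (Submodule.sub_mem _ x.2 (hle hz)) (by
        rw [map_sub, hzx]; exact sub_self _)
      refine ⟨Submodule.mkQ _ ⟨y, hy⟩, ?_⟩
      change Submodule.Quotient.mk (f₀ ⟨y, hy⟩) = Submodule.Quotient.mk x
      rw [Submodule.Quotient.eq]
      change f y - (x : P₁) ∈ lam (B := B) 𝓔 k
      rw [hyx]
      simpa using hz
    · rintro _ ⟨x, rfl⟩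
      obtain ⟨x, rfl⟩ := Submodule.mkQ_surjective _ x
      change Submodule.mkQ _ (g₀ (f₀ x)) = 0
      have : g₀ (f₀ x) = 0 := Subtype.ext (hgf x x.2)
      rw [this, map_zero]
  have := ha1
  have hfk : Module.Finite ℝ (LinearMap.ker g₁) := by rw [hex]; infer_instance
  have hrk : finrank ℝ (LinearMap.ker g₁) = finrank ℝ
      (𝓐 k ⧸ (lam (B := B) 𝓐 k).submoduleOf (𝓐 k)) := by
    rw [hex]; exact LinearMap.finrank_range_of_inj hf₁
  refine ⟨fun b ⟨hb1, hb2⟩ => ?_, fun e ⟨he1, he2⟩ => ?_⟩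
  · have := hb1
    have : Module.Finite ℝ (_ ⧸ LinearMap.ker g₁) :=
      Module.Finite.equiv (g₁.quotKerEquivOfSurjective hg₁).symm
    have hE := Module.Finite.of_submodule_quotient (LinearMap.ker g₁)
    refine ⟨hE, ?_⟩
    have h1 := g₁.finrank_range_add_finrank_ker
    rw [LinearMap.range_eq_top.mpr hg₁, finrank_top, hrk] at h1
    rw [← h1]; push_cast; lia
  · have := he1
    refine ⟨Module.Finite.of_surjective g₁ hg₁, ?_⟩
    have h1 := g₁.finrank_range_add_finrank_ker
    rw [LinearMap.range_eq_top.mpr hg₁, finrank_top, hrk] at h1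
    lia

omit [IsScalarTower ℝ (Pol B) P] in
lemma hasQ_bot (k : ℤ) : HasQ (B := B) (fun _ => (⊥ : Submodule ℝ P)) k 0 := by
  have : Subsingleton ((⊥ : Submodule ℝ P) ⧸
      (lam (B := B) (fun _ => (⊥ : Submodule ℝ P)) k).submoduleOf ⊥) :=
    (Submodule.mkQ_surjective _).subsingleton
  exact ⟨inferInstance, by simp [finrank_zero_of_subsingleton]⟩

theorem hasQ_map {𝓖 : ℤ → Submodule ℝ P} {𝓗 : ℤ → Submodule ℝ P₁} (f : P →ₗ[Pol B] P₁) {k d : ℤ}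
    (hf : ∀ k, (𝓖 k).map (f.restrictScalars ℝ) = 𝓗 (k + d))
    (hinj : ∀ x ∈ 𝓖 k, f x = 0 → x = 0)
    (hgr : ∀ x ∈ 𝓖 (k - 2), ∀ l : Wt B, lin l • x ∈ 𝓖 k) {n : ℤ} (h : HasQ (B := B) 𝓖 k n) :
    HasQ (B := B) 𝓗 (k + d) n := by
  have hmem (k : ℤ) (x : P) (hx : x ∈ 𝓖 k) : f x ∈ 𝓗 (k + d) := by
    rw [← hf]; exact ⟨x, hx, rfl⟩
  have h1 : k + d - 2 = k - 2 + d := by ring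
  have hlam : lam (B := B) (fun k => 𝓗 (k + d)) k = lam (B := B) 𝓗 (k + d) := by
    rw [lam, lam, h1]
  have hpre (y : P₁) (hy : y ∈ lam (B := B) 𝓗 (k + d)) : ∃ x ∈ lam (B := B) 𝓖 k, f x = y := by
    induction hy using Submodule.span_induction with
    | mem y h =>
      obtain ⟨l, z, hz, rfl⟩ := h
      rw [h1, ← hf] at hz
      obtain ⟨x, hx, rfl⟩ := hz
      exact ⟨lin l • x, Submodule.subset_span ⟨l, x, hx, rfl⟩, map_smul _ _ _⟩
    | zero => exact ⟨0, Submodule.zero_mem _, map_zero _⟩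
    | add x y _ _ hx hy =>
      obtain ⟨x', h1, rfl⟩ := hx
      obtain ⟨y', h2, rfl⟩ := hy
      exact ⟨x' + y', Submodule.add_mem _ h1 h2, map_add _ _ _⟩
    | smul a x _ hx =>
      obtain ⟨x', h1, rfl⟩ := hx
      exact ⟨a • x', Submodule.smul_mem _ _ h1, (f.restrictScalars ℝ).map_smul a x'⟩
  have hle : lam (B := B) 𝓖 k ≤ 𝓖 k := Submodule.span_le.mpr (by
    rintro _ ⟨l, x, hx, rfl⟩; exact hgr x hx l)
  have := (hasQ_exact (𝓐 := 𝓖) (𝓔 := fun k => 𝓗 (k + d)) (𝓑 := fun _ => (⊥ : Submodule ℝ P₁))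
    f 0 (k := k) hmem (by simp) (by simp)
    (fun k y hy => ⟨0, Submodule.zero_mem _, by simpa using ((Submodule.mem_bot ℝ).mp hy).symm⟩)
    ?_ ?_ ?_ h).1 0 (hasQ_bot k)
  · simp only [add_zero] at this
    rw [HasQ, hlam] at this
    exact this
  · intro x hx l
    simp only [← hf] at hx ⊢
    obtain ⟨y, hy, rfl⟩ := hx
    exact ⟨lin l • y, hgr y hy l, f.map_smul _ _⟩
  · intro x hx _
    simp only [← hf] at hx
    exact hx
  · intro x hx hfx
    rw [hlam] at hfx
    obtain ⟨x', hx', he⟩ := hpre _ hfx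
    have : x - x' = 0 := hinj _ (Submodule.sub_mem _ hx (hle hx')) (by rw [map_sub, he, sub_self])
    rwa [sub_eq_zero.mp this]

theorem hasQ_comap {𝓖 : ℤ → Submodule ℝ P} {𝓗 : ℤ → Submodule ℝ P₁} (f : P →ₗ[Pol B] P₁)
    {k : ℤ} (hf : ∀ k, (𝓖 k).map (f.restrictScalars ℝ) = 𝓗 k)
    (hinj : ∀ x ∈ 𝓖 k, f x = 0 → x = 0)
    (hgr : ∀ x ∈ 𝓖 (k - 2), ∀ l : Wt B, lin l • x ∈ 𝓖 k) {n : ℤ} (h : HasQ (B := B) 𝓗 k n) :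
    HasQ (B := B) 𝓖 k n := by
  have hmem (k : ℤ) (x : P) (hx : x ∈ 𝓖 k) : f x ∈ 𝓗 k := by
    rw [← hf]; exact ⟨x, hx, rfl⟩
  have := (hasQ_exact (P := P₁) (𝓐 := fun _ => (⊥ : Submodule ℝ P₁)) (𝓔 := 𝓖) (𝓑 := 𝓗)
    (0 : P₁ →ₗ[Pol B] P) f (k := k) (by simp) hmem (by simp) ?_ hgr ?_ (by
      rintro x hx -
      rw [(Submodule.mem_bot ℝ).mp hx]; exact Submodule.zero_mem _) (hasQ_bot k))
  · simpa using this.1 n h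
  · intro k y hy
    rw [← hf] at hy
    exact hy
  · intro x hx h0
    exact ⟨0, rfl, by rw [hinj x hx h0, map_zero]⟩

omit [IsScalarTower ℝ (Pol B) P] in
lemma HasQ.eq_lam {𝓖 : ℤ → Submodule ℝ P} {k : ℤ} (h : HasQ (B := B) 𝓖 k 0) :
    𝓖 k ≤ lam (B := B) 𝓖 k := by
  obtain ⟨h1, h2⟩ := h
  have : Subsingleton _ := finrank_zero_iff.mp (by exact_mod_cast h2)
  intro x hx
  have := Subsingleton.elim (Submodule.mkQ ((lam (B := B) 𝓖 k).submoduleOf (𝓖 k)) ⟨x, hx⟩) 0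
  rw [Submodule.mkQ_apply, Submodule.Quotient.mk_eq_zero] at this
  exact this

end GradedRank

end

section

variable {B W : Type} [Group W] {M : CoxeterMatrix B} {cs : CoxeterSystem M W}

attribute [local instance] wOrder

/-! ### Graded images -/

namespace Obj

variable (X : Obj cs)

variable {X} in
lemma gr_smul {k : ℤ} {m : X} (h : m ∈ X.gr k) (l : Wt B) : lin l • m ∈ X.gr (k + 2) := by
  rw [mem_gr, X.pr_smul, mem_gr.mp h]

variable {X} in
lemma gr_act {k : ℤ} {m : X} (h : m ∈ X.gr k) (l : Wt B) :
    X.act (lin l) m ∈ X.gr (k + 2) := by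
  rw [mem_gr, X.pr_act, mem_gr.mp h]

/-- The degree `k` sections supported on `A`, seen at `J`. -/
def gimg (J A : Set W) (k : ℤ) : Submodule ℝ (X.loc J) :=
  ((X.sup A).restrictScalars ℝ ⊓ X.gr k).map ((X.ev J).restrictScalars ℝ)

variable {X} in
lemma mem_gimg {J A : Set W} {k : ℤ} {x : X.loc J} :
    x ∈ X.gimg J A k ↔ ∃ m ∈ X.sup A, m ∈ X.gr k ∧ X.ev J m = x := by
  constructor
  · rintro ⟨m, ⟨h1, h2⟩, rfl⟩; exact ⟨m, h1, h2, rfl⟩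
  · rintro ⟨m, h1, h2, rfl⟩; exact ⟨m, ⟨h1, h2⟩, rfl⟩

variable {X} in
lemma gimg_smul {J A : Set W} {k : ℤ} (x : X.loc J) (h : x ∈ X.gimg J A (k - 2)) (l : Wt B) :
    lin l • x ∈ X.gimg J A k := by
  obtain ⟨m, h1, h2, rfl⟩ := mem_gimg.mp h
  refine mem_gimg.mpr ⟨lin l • m, Submodule.smul_mem _ _ h1, ?_, map_smul _ _ _⟩
  have := gr_smul h2 l
  rwa [sub_add_cancel] at this

variable {X} in
lemma ev_pr {J : Set W} {m n : X} (h : X.ev J m = X.ev J n) (k : ℤ) :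
    X.ev J (X.pr k m) = X.ev J (X.pr k n) := by
  rw [ev_eq] at h ⊢
  rw [← map_sub]
  exact pr_mem_sup h k

variable {X} in
lemma gimg_mono {J A A' : Set W} (h : X.img J A ≤ X.img J A') (k : ℤ) :
    X.gimg J A k ≤ X.gimg J A' k := by
  intro x hx
  obtain ⟨m, h1, h2, rfl⟩ := mem_gimg.mp hx
  obtain ⟨n, h3, h4⟩ := h ⟨m, h1, rfl⟩
  refine mem_gimg.mpr ⟨X.pr k n, pr_mem_sup h3 k, X.pr_mem k n, ?_⟩
  rw [ev_pr h4, mem_gr.mp h2]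

variable {X} in
lemma gimg_congr {J A A' : Set W} (h : X.img J A = X.img J A') : X.gimg J A = X.gimg J A' :=
  funext fun k => le_antisymm (gimg_mono h.le k) (gimg_mono h.ge k)

variable {X} in
lemma gimg_le {J A : Set W} {k : ℤ} {x : X.loc J} (h : x ∈ X.gimg J A k) : x ∈ X.img J A := by
  obtain ⟨m, h1, h2, rfl⟩ := mem_gimg.mp h
  exact ⟨m, h1, rfl⟩

/-- Restriction to a smaller set of labels. -/
def res {J J' : Set W} (h : J ⊆ J') : X.loc J' →ₗ[Pol B] X.loc J :=
  Submodule.factor (sup_mono (Set.compl_subset_compl.mpr h))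

end Obj

/-- The graded ranks of the subquotients of `X` are given by `c`. -/
def Char (X : Obj cs) (c : W →₀ ℤ[T;T⁻¹]) : Prop :=
  ∀ (J : Set W) (w : W), Closed cs J → w ∈ J → Top cs J w →
    ∀ k, HasQ (B := B) (X.gimg {w} J) k ((c w).coeff (k + cs.length w))

lemma char_of_height {P : Type} [LinearOrder P] {h : W → P} (hh : IsHeight cs h) {X : Obj cs}
    (hp : Good X) {c : W →₀ ℤ[T;T⁻¹]}
    (hc : ∀ w k, HasQ (B := B) (X.gimg {w} {f | h f ≤ h w}) k ((c w).coeff (k + cs.length w))) :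
    Char X c := by
  intro J w hJ hwJ hw
  rw [Obj.gimg_congr (Obj.img_eq_of_top hh (hp.height hh) hJ hwJ hw)]
  exact hc w

lemma Char.height {P : Type} [LinearOrder P] {h : W → P} (hh : IsHeight cs h) {X : Obj cs}
    {c : W →₀ ℤ[T;T⁻¹]} (hX : Char X c) (w : W) (k : ℤ) :
    HasQ (B := B) (X.gimg {w} {f | h f ≤ h w}) k ((c w).coeff (k + cs.length w)) :=
  hX _ w (hh.closed _) (Set.mem_ofPred.mpr le_rfl) (hh.top w) k

/-! ### The height adapted to a simple reflection -/

section PairHeight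

variable (cs) (s : B)

open Classical in
/-- The height compatible with left multiplication by a simple reflection. -/
def pht (w : W) : ℕ ×ₗ (W ×ₗ ℕ) :=
  if cs.length w < cs.length (cs.simple s * w) then toLex (cs.length w, toLex (w, 0))
  else toLex (cs.length (cs.simple s * w), toLex (cs.simple s * w, 1))

variable {cs s}

lemma pht_up {w : W} (h : cs.length w < cs.length (cs.simple s * w)) :
    pht cs s w = toLex (cs.length w, toLex (w, 0)) := if_pos h

lemma pht_down {w : W} (h : cs.length w < cs.length (cs.simple s * w)) :
    pht cs s (cs.simple s * w) = toLex (cs.length w, toLex (w, 1)) := by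
  rw [pht, if_neg] <;> simp [h.le]

lemma simple_cases (s : B) (w : W) : cs.length w < cs.length (cs.simple s * w) ∨
    ∃ y, w = cs.simple s * y ∧ cs.length y < cs.length (cs.simple s * y) := by
  by_cases h : cs.length w < cs.length (cs.simple s * w)
  · exact Or.inl h
  · refine Or.inr ⟨cs.simple s * w, by simp, ?_⟩
    have := cs.length_simple_mul_ne w s
    simp; lia

lemma length_up {y : W} (h : cs.length y < cs.length (cs.simple s * y)) :
    cs.length (cs.simple s * y) = cs.length y + 1 := by
  rcases cs.length_simple_mul y s with h' | h' <;> lia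

lemma pht_isHeight (cs : CoxeterSystem M W) (s : B) : IsHeight cs (pht cs s) where
  inj w w' h := by
    rcases simple_cases (cs := cs) s w with hw | ⟨y, rfl, hw⟩ <;>
    rcases simple_cases (cs := cs) s w' with hw' | ⟨y', rfl, hw'⟩
    · rw [pht_up hw, pht_up hw'] at h
      exact congrArg (fun p => (ofLex (ofLex p).2).1) h
    · rw [pht_up hw, pht_down hw'] at h
      exact absurd (congrArg (fun p => (ofLex (ofLex p).2).2) h) (by simp)
    · rw [pht_down hw, pht_up hw'] at h
      exact absurd (congrArg (fun p => (ofLex (ofLex p).2).2) h) (by simp)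
    · rw [pht_down hw, pht_down hw'] at h
      rw [show y = y' from congrArg (fun p => (ofLex (ofLex p).2).1) h]
  lt w t ht hl := by
    rcases simple_cases (cs := cs) s (w * t) with hw' | ⟨y', he, hw'⟩ <;>
    rcases simple_cases (cs := cs) s w with hw | ⟨y, rfl, hw⟩
    · rw [pht_up hw, pht_up hw', Prod.Lex.toLex_lt_toLex]
      exact Or.inl hl
    · have h1 := length_up hw
      rw [pht_down hw, pht_up hw', Prod.Lex.toLex_lt_toLex]
      exact Or.inl (by dsimp only; lia)
    · have h1 := length_up hw'
      rw [he, pht_up hw, pht_down hw', Prod.Lex.toLex_lt_toLex]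
      rw [he] at hl
      rcases Nat.lt_or_ge (cs.length w) (cs.length y') with h2 | h2
      · exact Or.inl h2
      · have h3 := eq_simple_mul_of_cover cs (s := s) (y := w) ht (by rw [he]; lia)
          (by rw [he]; simp; lia) hw
        have h4 : w = y' := mul_left_cancel (h3.symm.trans he)
        subst h4
        right
        simp [Prod.Lex.toLex_lt_toLex]
    · have h1 := length_up hw
      have h2 := length_up hw'
      rw [he, pht_down hw, pht_down hw', Prod.Lex.toLex_lt_toLex]
      rw [he] at hl
      exact Or.inl (by dsimp only; lia)

/-- The labels strictly below `y` for the adapted height. -/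
def low (cs : CoxeterSystem M W) (s : B) (y : W) : Set W := {f | pht cs s f < pht cs s y}

lemma simple_mul_mem_low {y : W} (hy : cs.length y < cs.length (cs.simple s * y)) {f : W}
    (h : f ∈ low cs s y) : cs.simple s * f ∈ low cs s y := by
  rw [low, Set.mem_ofPred, pht_up hy] at *
  rcases simple_cases (cs := cs) s f with hf | ⟨y, rfl, hf⟩
  · rw [pht_down hf]
    rw [pht_up hf] at h
    simpa [Prod.Lex.toLex_lt_toLex] using h
  · rw [cs.simple_mul_simple_cancel_left, pht_up hf]
    rw [pht_down hf] at h
    simpa [Prod.Lex.toLex_lt_toLex] using h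

lemma notMem_low (y : W) : y ∉ low cs s y := fun h => absurd h (lt_irrefl (pht cs s y))

lemma pht_le_eq (y : W) : {f | pht cs s f ≤ pht cs s y} = low cs s y ∪ {y} := by
  ext f
  simp only [Set.mem_ofPred, le_iff_lt_or_eq, low, Set.mem_union, Set.mem_singleton_iff]
  rw [(pht_isHeight cs s).inj.eq_iff]

lemma pht_simple_le_eq {y : W} (hy : cs.length y < cs.length (cs.simple s * y)) :
    {f | pht cs s f ≤ pht cs s (cs.simple s * y)} = low cs s y ∪ {y, cs.simple s * y} := by
  ext f
  simp only [Set.mem_ofPred, le_iff_lt_or_eq, low, Set.mem_union, Set.mem_singleton_iff,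
    Set.mem_insert_iff]
  rw [(pht_isHeight cs s).inj.eq_iff, ← or_assoc]
  refine or_congr_left ?_
  rw [pht_down hy, pht_up hy]
  rcases simple_cases (cs := cs) s f with hf | ⟨y', rfl, hf⟩
  · rw [pht_up hf, Prod.Lex.toLex_lt_toLex, Prod.Lex.toLex_lt_toLex]
    simp only [Prod.Lex.toLex_lt_toLex]
    constructor
    · rintro (h | ⟨h, h' | h'⟩)
      · exact Or.inl (Or.inl h)
      · exact Or.inl (Or.inr ⟨h, Or.inl h'⟩)
      · exact Or.inr h'.1
    · rintro ((h | ⟨h, h' | h'⟩) | h)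
      · exact Or.inl h
      · exact Or.inr ⟨h, Or.inl h'⟩
      · simp at h'
      · subst h; simp
  · have hne : cs.simple s * y' ≠ y := by
      rintro rfl
      simp at hy; lia
    rw [pht_down hf, Prod.Lex.toLex_lt_toLex, Prod.Lex.toLex_lt_toLex]
    simp only [Prod.Lex.toLex_lt_toLex, hne, or_false]
    simp

lemma simple_mul_notMem_low {y : W} (hy : cs.length y < cs.length (cs.simple s * y)) :
    cs.simple s * y ∉ low cs s y := fun h => notMem_low (cs := cs) (s := s) y (by
  have := simple_mul_mem_low hy h
  rwa [cs.simple_mul_simple_cancel_left] at this)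

end PairHeight

end

section

variable {B W : Type} [Group W] {M : CoxeterMatrix B} {cs : CoxeterSystem M W}

attribute [local instance] wOrder

/-! ### Supports on `B_s X` -/

section BsSupport

variable {s : B} {X : Obj cs}

open Obj

lemma mem_sup_bs {J : Set W} {m : bs cs s X} : m ∈ (bs cs s X).sup J ↔
    X.act (al s) m.1 + m.2 ∈ X.sup J ∧ m.2 ∈ X.sup {f | cs.simple s * f ∈ J} := by
  constructor
  · intro h
    exact ⟨fun j hj => h (Sum.inl j) hj, fun j hj => h (Sum.inr j) hj⟩
  · rintro ⟨h1, h2⟩ (j | j) hj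
    · exact h1 j hj
    · exact h2 j hj

lemma mem_gr_bs {k : ℤ} {m : bs cs s X} :
    m ∈ (bs cs s X).gr k ↔ m.1 ∈ X.gr (k - 1) ∧ m.2 ∈ X.gr (k + 1) := by
  rw [mem_gr, mem_gr, mem_gr, bs_pr]
  exact Prod.ext_iff

lemma mem_sup_bs_stable {J : Set W} (hJ : ∀ f ∈ J, cs.simple s * f ∈ J) {m : bs cs s X} :
    m ∈ (bs cs s X).sup J ↔ m.1 ∈ X.sup J ∧ m.2 ∈ X.sup J := by
  have he : {f | cs.simple s * f ∈ J} = J := by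
    ext f
    refine ⟨fun h => ?_, fun h => hJ f h⟩
    have := hJ _ h
    rwa [cs.simple_mul_simple_cancel_left] at this
  rw [mem_sup_bs, he]
  constructor
  · rintro ⟨h1, h2⟩
    refine ⟨sup_act_mem (al_ne_zero s) ?_, h2⟩
    simpa using Submodule.sub_mem _ h1 h2
  · rintro ⟨h1, h2⟩
    exact ⟨Submodule.add_mem _ (act_mem_sup h1 _) h2, h2⟩

variable (s X)

/-- The restriction of a simple root at `y`. -/
def rt (cs : CoxeterSystem M W) (s : B) (y : W) : Wt B := geo cs y⁻¹ (root s)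

lemma rt_ne_zero (y : W) : lin (rt cs s y) ≠ 0 := by
  intro h
  rw [lin_eq_zero, rt] at h
  have : root (B := B) s = 0 := by
    rw [← geo_geo_inv cs y (root s), h, map_zero]
  exact al_ne_zero s (by rw [al, this, map_zero])

/-- Sections of `B_s X` near `y` built from sections of `X`. -/
def extY (y : W) : X →ₗ[Pol B] bs cs s X :=
  LinearMap.prod LinearMap.id
    ((MvPolynomial.C (1 / 2 : ℝ) : Pol B) • (lin (rt cs s y) • LinearMap.id - X.act (al s)))

/-- The second inclusion in `B_s X`. -/
def sndY : X →ₗ[Pol B] bs cs s X := LinearMap.inr (Pol B) X X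

variable {s X}

@[simp] lemma extY_fst (y : W) (m : X) : (extY s X y m).1 = m := rfl

@[simp] lemma extY_snd (y : W) (m : X) : (extY s X y m).2 =
    (1 / 2 : ℝ) • (lin (rt cs s y) • m - X.act (al s) m) := by
  rw [← X.C_smul]; rfl

@[simp] lemma sndY_fst (m : X) : (sndY s X m).1 = 0 := rfl

@[simp] lemma sndY_snd (m : X) : (sndY s X m).2 = m := rfl

lemma extY_act_add (y : W) (m : X) : X.act (al s) (extY s X y m).1 + (extY s X y m).2 =
    (1 / 2 : ℝ) • (lin (rt cs s y) • m + X.act (al s) m) := by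
  rw [extY_fst, extY_snd]
  generalize lin (rt cs s y) • m = a
  module

lemma real_smul_mem_sup {J : Set W} {m : X} (h : m ∈ X.sup J) (a : ℝ) : a • m ∈ X.sup J := by
  rw [← X.C_smul]; exact Submodule.smul_mem _ _ h

lemma rt_sub_mem (y : W) (m : X) : lin (rt cs s y) • m - X.act (al s) m ∈ X.sup {y}ᶜ := by
  intro j hj
  have hj : X.lab j = y := by simpa using hj
  rw [map_sub, map_smul, Pi.sub_apply, Pi.smul_apply, al, emb_act_lin, hj, rt]
  simp

lemma rt_add_mem (y : W) (m : X) :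
    lin (rt cs s y) • m + X.act (al s) m ∈ X.sup {cs.simple s * y}ᶜ := by
  intro j hj
  have hj : X.lab j = cs.simple s * y := by simpa using hj
  rw [map_add, map_smul, Pi.add_apply, Pi.smul_apply, al, emb_act_lin, hj, rt, mul_inv_rev,
    cs.inv_simple, geo_mul_apply, geo_simple, sref_root]
  simp

lemma compl_preimage (y : W) : {f | cs.simple s * f ∈ ({y}ᶜ : Set W)} = {cs.simple s * y}ᶜ := by
  ext f
  simp only [Set.mem_ofPred, Set.mem_compl_iff, Set.mem_singleton_iff, not_iff_not]
  constructor
  · rintro rfl; simp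
  · rintro rfl; simp

lemma compl_preimage' (y : W) : {f | cs.simple s * f ∈ ({cs.simple s * y}ᶜ : Set W)} = {y}ᶜ := by
  rw [compl_preimage, cs.simple_mul_simple_cancel_left]

omit [Group W] in
lemma compl_pair (y z : W) : ({y, z}ᶜ : Set W) = {y}ᶜ ∩ {z}ᶜ := by
  ext f; simp

lemma half_add_half_sub {V : Type} [AddCommGroup V] [Module ℝ V] (a b : V) :
    (1 / 2 : ℝ) • (a + b) + (1 / 2 : ℝ) • (a - b) = a := by
  module

lemma extY_mem_compl {y : W} {m : X} :
    extY s X y m ∈ (bs cs s X).sup {y}ᶜ ↔ m ∈ X.sup {y, cs.simple s * y}ᶜ := by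
  rw [mem_sup_bs, extY_act_add, extY_snd, compl_preimage, compl_pair]
  constructor
  · rintro ⟨h1, h2⟩
    refine mem_sup_inter ?_ ?_
    · apply sup_smul_mem (rt_ne_zero s y)
      have := Submodule.add_mem _ h1 (real_smul_mem_sup (rt_sub_mem (s := s) y m) (1 / 2))
      rwa [half_add_half_sub] at this
    · apply sup_smul_mem (rt_ne_zero s y)
      have := Submodule.add_mem _ h2 (real_smul_mem_sup (rt_add_mem (s := s) y m) (1 / 2))
      rwa [add_comm, half_add_half_sub] at this
  · intro h
    have h1 := sup_mono Set.inter_subset_left h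
    have h2 := sup_mono Set.inter_subset_right h
    exact ⟨real_smul_mem_sup (Submodule.add_mem _ (Submodule.smul_mem _ _ h1) (act_mem_sup h1 _)) _,
      real_smul_mem_sup (Submodule.sub_mem _ (Submodule.smul_mem _ _ h2) (act_mem_sup h2 _)) _⟩

lemma sndY_mem_compl {y : W} {m : X} :
    sndY s X m ∈ (bs cs s X).sup {cs.simple s * y}ᶜ ↔ m ∈ X.sup {y, cs.simple s * y}ᶜ := by
  rw [mem_sup_bs, compl_preimage', compl_pair, sndY_fst, sndY_snd, map_zero, zero_add]
  exact ⟨fun h => mem_sup_inter h.2 h.1, fun h =>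
    ⟨sup_mono Set.inter_subset_right h, sup_mono Set.inter_subset_left h⟩⟩

lemma extY_mem_compl_simple (y : W) (m : X) :
    extY s X y m ∈ (bs cs s X).sup {cs.simple s * y}ᶜ := by
  rw [mem_sup_bs, extY_act_add, extY_snd, compl_preimage']
  exact ⟨real_smul_mem_sup (rt_add_mem y m) _, real_smul_mem_sup (rt_sub_mem y m) _⟩

section Pair

variable {J : Set W} {y : W}

lemma preimage_union (hJ : ∀ f ∈ J, cs.simple s * f ∈ J) : {f | cs.simple s * f ∈ J ∪ {y}} = J ∪ {cs.simple s * y} := by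
  ext f
  simp only [Set.mem_ofPred, Set.mem_union, Set.mem_singleton_iff]
  refine or_congr ⟨fun h => ?_, hJ f⟩ ⟨?_, ?_⟩
  · have := hJ _ h
    rwa [cs.simple_mul_simple_cancel_left] at this
  · rintro rfl; simp
  · rintro rfl; simp

lemma pair_stable (hJ : ∀ f ∈ J, cs.simple s * f ∈ J) :
    ∀ f ∈ J ∪ {y, cs.simple s * y}, cs.simple s * f ∈ J ∪ {y, cs.simple s * y} := by
  rintro f (hf | rfl | rfl)
  · exact Or.inl (hJ f hf)
  · simp
  · simp

lemma extY_mem (hJ : ∀ f ∈ J, cs.simple s * f ∈ J) {m : X}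
    (hm : m ∈ X.sup (J ∪ {y, cs.simple s * y})) :
    extY s X y m ∈ (bs cs s X).sup (J ∪ {y}) := by
  rw [mem_sup_bs, extY_act_add, extY_snd, preimage_union hJ]
  constructor
  · refine real_smul_mem_sup (sup_mono ?_ (mem_sup_inter (Submodule.add_mem _
      (Submodule.smul_mem _ _ hm) (act_mem_sup hm _)) (rt_add_mem (s := s) y m))) _
    rintro f ⟨hf | rfl | rfl, hf'⟩ <;> simp_all
  · refine real_smul_mem_sup (sup_mono ?_ (mem_sup_inter (Submodule.sub_mem _
      (Submodule.smul_mem _ _ hm) (act_mem_sup hm _)) (rt_sub_mem (s := s) y m))) _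
    rintro f ⟨hf | rfl | rfl, hf'⟩ <;> simp_all

lemma fst_mem (hJ : ∀ f ∈ J, cs.simple s * f ∈ J) {m : bs cs s X} (hm : m ∈ (bs cs s X).sup (J ∪ {y})) :
    m.1 ∈ X.sup (J ∪ {y, cs.simple s * y}) :=
  ((mem_sup_bs_stable (pair_stable hJ)).mp (sup_mono (by
    rintro f (hf | rfl)
    · exact Or.inl hf
    · simp) hm)).1

lemma ev_extY (hJ : ∀ f ∈ J, cs.simple s * f ∈ J) (hy : y ∉ J)
    (hy' : cs.simple s * y ∉ J) (hne : cs.simple s * y ≠ y) {m : bs cs s X} (hm : m ∈ (bs cs s X).sup (J ∪ {y})) :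
    (bs cs s X).ev {y} m = (bs cs s X).ev {y} (extY s X y m.1) := by
  rw [ev_eq, mem_sup_bs, compl_preimage]
  rw [mem_sup_bs, preimage_union hJ] at hm
  have e1 : (m - extY s X y m.1).1 = 0 := sub_self m.1
  have e2 : (m - extY s X y m.1).2 = m.2 - (extY s X y m.1).2 := rfl
  rw [e1, e2, map_zero, zero_add, extY_snd]
  constructor
  · refine Submodule.sub_mem _ (sup_mono ?_ hm.2) (real_smul_mem_sup (rt_sub_mem y m.1) _)
    rintro f (hf | rfl) h
    · rw [Set.mem_singleton_iff] at h; exact hy (h ▸ hf)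
    · exact hne h
  · have h1 := Submodule.sub_mem _ (sup_mono (J' := {cs.simple s * y}ᶜ) ?_ hm.1)
      (real_smul_mem_sup (rt_add_mem (s := s) y m.1) (1 / 2))
    · convert h1 using 1
      generalize lin (rt cs s y) • m.1 = a
      module
    · rintro f (hf | rfl) h
      · rw [Set.mem_singleton_iff] at h; exact hy' (h ▸ hf)
      · exact hne h.symm

end Pair

end BsSupport

end

section

variable {B W : Type} [Group W] {M : CoxeterMatrix B} {cs : CoxeterSystem M W}

attribute [local instance] wOrder

section BsGood

open Obj

variable {s : B} {X : Obj cs}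

theorem pair_exact {J : Set W} {y z : W} (hy : y ∉ J) (hz : z ∉ J) (hne : z ≠ y)
    (hA : Projective (Pol B) (X.img {y} (J ∪ {y})))
    (hB : Projective (Pol B) (X.img {z} (J ∪ {y, z}))) :
    Projective (Pol B) (X.img {y, z} (J ∪ {y, z})) ∧ ∀ k a b,
      HasQ (B := B) (X.gimg {y} (J ∪ {y})) k a → HasQ (B := B) (X.gimg {z} (J ∪ {y, z})) k b →
      HasQ (B := B) (X.gimg {y, z} (J ∪ {y, z})) k (a + b) := by
  have hyP : ({y} : Set W) ⊆ {y, z} := by simp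
  have hzP : ({z} : Set W) ⊆ {y, z} := by simp
  have hAJ : J ∪ {y} ⊆ J ∪ {y, z} := Set.union_subset_union_right _ hyP
  -- the kernel of restriction to `z`
  have hker (u : X) (hu : u ∈ X.sup (J ∪ {y, z})) (h0 : X.ev {z} u = 0) :
      u ∈ X.sup (J ∪ {y}) := by
    refine sup_mono ?_ (mem_sup_inter hu (ev_eq_zero.mp h0))
    rintro f ⟨hf | rfl | rfl, hf'⟩ <;> simp_all
  -- injectivity of restriction to `y`
  have hinj (u : X) (hu : u ∈ X.sup (J ∪ {y})) (h0 : X.ev {y} u = 0) : X.ev {y, z} u = 0 := by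
    rw [ev_eq_zero]
    refine sup_mono ?_ (mem_sup_inter hu (ev_eq_zero.mp h0))
    rintro f ⟨hf | rfl, hf'⟩
    · rintro (rfl | rfl)
      · exact hy hf
      · exact hz hf
    · simp at hf'
  have hzero (u : X) (hu : u ∈ X.sup (J ∪ {y})) : X.ev {z} u = 0 := by
    rw [ev_eq_zero]
    refine sup_mono ?_ hu
    rintro f (hf | rfl)
    · rintro rfl; exact hz hf
    · exact fun h => hne h.symm
  have hgE (x) (hx : x ∈ X.img {y, z} (J ∪ {y, z})) :
      X.res hzP x ∈ X.img {z} (J ∪ {y, z}) := by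
    obtain ⟨u, hu, rfl⟩ := hx; exact ⟨u, hu, rfl⟩
  let g := (X.res hzP).restrict hgE
  have hg : Function.Surjective g := by
    rintro ⟨_, u, hu, rfl⟩
    exact ⟨⟨_, u, hu, rfl⟩, rfl⟩
  obtain ⟨t, ht⟩ := Module.projective_lifting_property g LinearMap.id hg
  have ht' (b) : g (t b) = b := LinearMap.congr_fun ht b
  have hK (x : X.img {y, z} (J ∪ {y, z})) (h0 : g x = 0) : (x : X.loc {y, z}) ∈
      X.img {y, z} (J ∪ {y}) := by
    obtain ⟨_, u, hu, rfl⟩ := x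
    exact ⟨u, hker u hu (congrArg Subtype.val h0), rfl⟩
  let ret : X.img {y, z} (J ∪ {y, z}) →ₗ[Pol B] X.img {y, z} (J ∪ {y}) :=
    LinearMap.codRestrict _ ((X.img {y, z} (J ∪ {y, z})).subtype ∘ₗ (LinearMap.id - t ∘ₗ g))
      (fun x => hK _ (by simp [ht']))
  have hret (x) : (ret x : X.loc {y, z}) = x - t (g x) := rfl
  constructor
  · have hfK (x) (hx : x ∈ X.img {y, z} (J ∪ {y})) : X.res hyP x ∈ X.img {y} (J ∪ {y}) := by
      obtain ⟨u, hu, rfl⟩ := hx; exact ⟨u, hu, rfl⟩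
    let e : X.img {y, z} (J ∪ {y}) ≃ₗ[Pol B] X.img {y} (J ∪ {y}) :=
      LinearEquiv.ofBijective ((X.res hyP).restrict hfK) (by
        constructor
        · rw [injective_iff_map_eq_zero]
          rintro ⟨_, u, hu, rfl⟩ h
          exact Subtype.ext (hinj u hu (congrArg Subtype.val h))
        · rintro ⟨_, u, hu, rfl⟩
          exact ⟨⟨_, u, hu, rfl⟩, rfl⟩)
    have : Projective (Pol B) (X.img {y, z} (J ∪ {y})) := Projective.of_equiv e.symm
    have hle : X.img {y, z} (J ∪ {y}) ≤ X.img {y, z} (J ∪ {y, z}) :=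
      Submodule.map_mono (sup_mono hAJ)
    refine Projective.of_split (ret.prod g) ((Submodule.inclusion hle).coprod t) ?_
    ext x
    simp [hret]
  · intro k a b ha hb
    have ha' := hasQ_comap (𝓖 := X.gimg {y, z} (J ∪ {y})) (X.res hyP) (k := k) (fun k => by
        apply le_antisymm
        · rintro _ ⟨x, hx, rfl⟩
          obtain ⟨u, h1, h2, rfl⟩ := mem_gimg.mp hx
          exact mem_gimg.mpr ⟨u, h1, h2, rfl⟩
        · intro x hx
          obtain ⟨u, h1, h2, rfl⟩ := mem_gimg.mp hx
          exact ⟨X.ev _ u, mem_gimg.mpr ⟨u, h1, h2, rfl⟩, rfl⟩) (fun x hx h0 => by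
        obtain ⟨u, h1, h2, rfl⟩ := mem_gimg.mp hx
        exact hinj u h1 h0) (fun x hx l => gimg_smul x hx l) ha
    refine (hasQ_exact (𝓔 := X.gimg {y, z} (J ∪ {y, z})) LinearMap.id (X.res hzP)
      ?_ ?_ ?_ ?_ (fun x hx l => gimg_smul x hx l) ?_ ?_ ha').1 b hb
    · exact fun k x hx => gimg_mono (Submodule.map_mono (sup_mono hAJ)) k hx
    · intro k x hx
      obtain ⟨u, h1, h2, rfl⟩ := mem_gimg.mp hx
      exact mem_gimg.mpr ⟨u, h1, h2, rfl⟩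
    · intro x hx
      obtain ⟨u, h1, h2, rfl⟩ := mem_gimg.mp hx
      exact hzero u h1
    · intro k x hx
      obtain ⟨u, h1, h2, rfl⟩ := mem_gimg.mp hx
      exact ⟨X.ev _ u, mem_gimg.mpr ⟨u, h1, h2, rfl⟩, rfl⟩
    · intro x hx h0
      obtain ⟨u, h1, h2, rfl⟩ := mem_gimg.mp hx
      exact ⟨X.ev _ u, mem_gimg.mpr ⟨u, hker u h1 h0, h2, rfl⟩, rfl⟩
    · intro x hx hlam
      have key (x) (hx : x ∈ lam (B := B) (X.gimg {y, z} (J ∪ {y, z})) k) :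
          ∃ hE : x ∈ X.img {y, z} (J ∪ {y, z}), ∃ u ∈ X.sup (J ∪ {y}),
            X.ev {y, z} u = ret ⟨x, hE⟩ ∧
              X.ev {y, z} (X.pr k u) ∈ lam (B := B) (X.gimg {y, z} (J ∪ {y})) k := by
        induction hx using Submodule.span_induction with
        | mem x h =>
          obtain ⟨l, e, he, rfl⟩ := h
          have heE := gimg_le he
          obtain ⟨u, hu, huE⟩ := (ret ⟨e, heE⟩).2
          refine ⟨Submodule.smul_mem _ _ heE, lin l • u, Submodule.smul_mem _ _ hu, ?_, ?_⟩
          · rw [map_smul, huE]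
            have := ret.map_smul (lin l) ⟨e, heE⟩
            exact (congrArg Subtype.val this).symm
          · have : X.pr k (lin l • u) = lin l • X.pr (k - 2) u := by
              rw [← X.pr_smul, sub_add_cancel]
            rw [this, map_smul]
            exact Submodule.subset_span ⟨l, _, mem_gimg.mpr ⟨_, pr_mem_sup hu _, X.pr_mem _ _, rfl⟩,
              rfl⟩
        | zero => exact ⟨Submodule.zero_mem _, 0, Submodule.zero_mem _, by
            rw [map_zero]; exact (congrArg Subtype.val ret.map_zero).symm, by simp⟩
        | add x x' _ _ hx hx' =>
          obtain ⟨h1, u, h2, h3, h4⟩ := hx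
          obtain ⟨h1', u', h2', h3', h4'⟩ := hx'
          refine ⟨Submodule.add_mem _ h1 h1', u + u', Submodule.add_mem _ h2 h2', ?_, ?_⟩
          · rw [map_add, h3, h3']
            exact (congrArg Subtype.val (ret.map_add ⟨x, h1⟩ ⟨x', h1'⟩)).symm
          · rw [map_add, map_add]; exact Submodule.add_mem _ h4 h4'
        | smul a x _ hx =>
          obtain ⟨h1, u, h2, h3, h4⟩ := hx
          refine ⟨?_, a • u, real_smul_mem_sup h2 a, ?_, ?_⟩
          · exact Submodule.smul_of_tower_mem _ a h1
          · rw [show X.ev {y, z} (a • u) = a • X.ev {y, z} u from rfl, h3]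
            exact (congrArg Subtype.val ((ret.restrictScalars ℝ).map_smul a ⟨x, h1⟩)).symm
          · rw [map_smul, show X.ev {y, z} (a • X.pr k u) = a • X.ev {y, z} (X.pr k u) from rfl]
            exact Submodule.smul_mem _ _ h4
      obtain ⟨hE, u, hu, hux, hl⟩ := key x hlam
      obtain ⟨v, hv, hvk, rfl⟩ := mem_gimg.mp hx
      have hgv : g ⟨_, hE⟩ = 0 := Subtype.ext (hzero v hv)
      rw [hret, hgv, map_zero, Submodule.coe_zero, sub_zero] at hux
      have := ev_pr hux k
      rw [mem_gr.mp hvk] at this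
      rwa [this] at hl

lemma mapQ_injective {X Y : Obj cs} (f : X →ₗ[Pol B] Y) {J J' : Set W}
    (h : ∀ m, f m ∈ Y.sup J'ᶜ ↔ m ∈ X.sup Jᶜ) :
    ∃ F : X.loc J →ₗ[Pol B] Y.loc J', Function.Injective F ∧ ∀ m, F (X.ev J m) = Y.ev J' (f m) := by
  refine ⟨Submodule.mapQ _ _ f (fun m hm => (h m).mpr hm), ?_, fun m => rfl⟩
  rw [injective_iff_map_eq_zero]
  intro x hx
  obtain ⟨m, rfl⟩ := Submodule.mkQ_surjective _ x
  exact ev_eq_zero.mpr ((h m).mp (ev_eq_zero.mp hx))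

theorem transport {X Y : Obj cs} (f : X →ₗ[Pol B] Y) {J J' A A' : Set W} {d : ℤ}
    (h : ∀ m, f m ∈ Y.sup J'ᶜ ↔ m ∈ X.sup Jᶜ) (h1 : ∀ m ∈ X.sup A, f m ∈ Y.sup A')
    (h2 : ∀ n ∈ Y.sup A', ∃ m ∈ X.sup A, Y.ev J' (f m) = Y.ev J' n ∧
      ∀ k, n ∈ Y.gr (k + d) → m ∈ X.gr k)
    (h3 : ∀ k, ∀ m ∈ X.gr k, f m ∈ Y.gr (k + d)) :
    (Projective (Pol B) (X.img J A) → Projective (Pol B) (Y.img J' A')) ∧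
      ∀ k n, HasQ (B := B) (X.gimg J A) k n → HasQ (B := B) (Y.gimg J' A') (k + d) n := by
  obtain ⟨F, hF, hFe⟩ := mapQ_injective f h
  constructor
  · intro hp
    have : Y.img J' A' = (X.img J A).map F := by
      apply le_antisymm
      · rintro _ ⟨n, hn, rfl⟩
        obtain ⟨m, hm, he, -⟩ := h2 n hn
        exact ⟨_, ⟨m, hm, rfl⟩, by rw [hFe, he]⟩
      · rintro _ ⟨_, ⟨m, hm, rfl⟩, rfl⟩
        exact ⟨f m, h1 m hm, (hFe m).symm⟩
    rw [this]
    exact Projective.of_equiv (Submodule.equivMapOfInjective F hF _)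
  · intro k n hn
    refine hasQ_map F (fun k => ?_) (fun x _ h0 => hF (by rw [h0, map_zero]))
      (fun x hx l => gimg_smul x hx l) hn
    apply le_antisymm
    · rintro _ ⟨x, hx, rfl⟩
      obtain ⟨m, ha, hb, rfl⟩ := mem_gimg.mp hx
      exact mem_gimg.mpr ⟨f m, h1 m ha, h3 k m hb, (hFe m).symm⟩
    · intro x hx
      obtain ⟨n, ha, hb, rfl⟩ := mem_gimg.mp hx
      obtain ⟨m, hm, he, hgr⟩ := h2 n ha
      exact ⟨X.ev J m, mem_gimg.mpr ⟨m, hm, hgr k hb, rfl⟩, by rw [← he]; exact hFe m⟩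

lemma extY_gr {y : W} {k : ℤ} {m : X} (hm : m ∈ X.gr k) :
    extY s X y m ∈ (bs cs s X).gr (k + 1) := by
  rw [mem_gr_bs, extY_fst, extY_snd]
  refine ⟨by simpa using hm, Submodule.smul_mem _ _ (Submodule.sub_mem _ ?_ ?_)⟩
  · simpa [add_assoc] using gr_smul hm (rt cs s y)
  · simpa [add_assoc, al] using gr_act hm (root s)


lemma bs_img_up (hX : Good X) {y : W} (hy : cs.length y < cs.length (cs.simple s * y)) :
    Projective (Pol B) ((bs cs s X).img {y} (low cs s y ∪ {y})) ∧
    Projective (Pol B) ((bs cs s X).img {cs.simple s * y} (low cs s y ∪ {y, cs.simple s * y})) ∧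
    ∀ k a b, HasQ (B := B) (X.gimg {y} (low cs s y ∪ {y})) k a →
      HasQ (B := B) (X.gimg {cs.simple s * y} (low cs s y ∪ {y, cs.simple s * y})) k b →
      HasQ (B := B) ((bs cs s X).gimg {y} (low cs s y ∪ {y})) (k + 1) (a + b) ∧
      HasQ (B := B) ((bs cs s X).gimg {cs.simple s * y} (low cs s y ∪ {y, cs.simple s * y}))
        (k + -1) (a + b) := by
  have hne : cs.simple s * y ≠ y := fun h => by rw [h] at hy; exact lt_irrefl _ hy
  have hst : ∀ f ∈ low cs s y, cs.simple s * f ∈ low cs s y := fun f => simple_mul_mem_low hy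
  have hpA := hX.height (pht_isHeight cs s) y
  have hpB := hX.height (pht_isHeight cs s) (cs.simple s * y)
  rw [pht_le_eq] at hpA
  rw [pht_simple_le_eq hy] at hpB
  obtain ⟨hE, hEq⟩ := pair_exact (notMem_low y) (simple_mul_notMem_low hy) hne hpA hpB
  obtain ⟨h1, h1'⟩ := transport (extY s X y) (J' := {y}) (A' := low cs s y ∪ {y}) (d := 1)
    (fun m => extY_mem_compl) (A := low cs s y ∪ {y, cs.simple s * y})
    (fun m hm => extY_mem hst hm) (fun n hn => ⟨n.1, fst_mem hst hn,
      (ev_extY hst (notMem_low y) (simple_mul_notMem_low hy) hne hn).symm, fun k hk => by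
        simpa using (mem_gr_bs.mp hk).1⟩) (fun k m hm => extY_gr hm)
  have key : ∀ n ∈ (bs cs s X).sup (low cs s y ∪ {y, cs.simple s * y}),
      ∃ m ∈ X.sup (low cs s y ∪ {y, cs.simple s * y}),
        (bs cs s X).ev {cs.simple s * y} (sndY s X m) = (bs cs s X).ev {cs.simple s * y} n ∧
          ∀ k, n ∈ (bs cs s X).gr (k + -1) → m ∈ X.gr k := by
    intro n hn
    refine ⟨n.2 - (extY s X y n.1).2, ?_, ?_, ?_⟩
    · rw [mem_sup_bs_stable (pair_stable hst)] at hn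
      rw [extY_snd]
      exact Submodule.sub_mem _ hn.2 (real_smul_mem_sup (Submodule.sub_mem _
        (Submodule.smul_mem _ _ hn.1) (act_mem_sup hn.1 _)) _)
    · have : sndY s X (n.2 - (extY s X y n.1).2) = n - extY s X y n.1 := by
        apply bs_ext
        · exact (sub_self n.1).symm
        · rfl
      rw [this, map_sub, ev_eq_zero.mpr (extY_mem_compl_simple y n.1), sub_zero]
    · intro k hk
      rw [mem_gr_bs] at hk
      have h3 := extY_gr (s := s) (y := y) hk.1
      rw [mem_gr_bs] at h3
      have e1 : k + -1 - 1 + 1 + 1 = k := by ring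
      have e2 : k + -1 + 1 = k := by ring
      rw [e1] at h3
      rw [e2] at hk
      exact Submodule.sub_mem _ hk.2 h3.2
  obtain ⟨h2, h2'⟩ := transport (sndY s X) (J' := {cs.simple s * y})
    (A' := low cs s y ∪ {y, cs.simple s * y}) (d := -1)
    (fun m => sndY_mem_compl) (A := low cs s y ∪ {y, cs.simple s * y})
    (fun m hm => (mem_sup_bs_stable (pair_stable hst)).mpr ⟨Submodule.zero_mem _, hm⟩)
    key (fun k m hm => by
      rw [mem_gr_bs]; exact ⟨Submodule.zero_mem _, by simpa using hm⟩)
  exact ⟨h1 hE, h2 hE, fun k a b ha hb => ⟨h1' _ _ (hEq k a b ha hb), h2' _ _ (hEq k a b ha hb)⟩⟩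

theorem good_bs (hX : Good X) (s : B) : Good (bs cs s X) := by
  refine good_of_height (pht_isHeight cs s) fun w => ?_
  rcases simple_cases (cs := cs) s w with hw | ⟨y, rfl, hw⟩
  · rw [pht_le_eq]; exact (bs_img_up hX hw).1
  · rw [pht_simple_le_eq hw]; exact (bs_img_up hX hw).2.1

open Classical in
/-- Left multiplication by `h_s + v` on characters. -/
def bsC (cs : CoxeterSystem M W) (s : B) : (W →₀ ℤ[T;T⁻¹]) →ₗ[ℤ[T;T⁻¹]] (W →₀ ℤ[T;T⁻¹]) :=
  Finsupp.linearCombination ℤ[T;T⁻¹] fun y =>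
    Finsupp.single y (if cs.length y < cs.length (cs.simple s * y) then T 1 else T (-1)) +
      Finsupp.single (cs.simple s * y) 1

open Classical in
lemma bsC_apply (s : B) (c : W →₀ ℤ[T;T⁻¹]) (w : W) : bsC cs s c w =
    (if cs.length w < cs.length (cs.simple s * w) then T 1 else T (-1)) * c w +
      c (cs.simple s * w) := by
  induction c using Finsupp.induction_linear with
  | zero => simp
  | add f g hf hg => simp only [map_add, Finsupp.add_apply, hf, hg]; ring
  | single y a =>
    rw [bsC, Finsupp.linearCombination_single, Finsupp.smul_apply, Finsupp.add_apply,
      Finsupp.single_apply, Finsupp.single_apply, Finsupp.single_apply, Finsupp.single_apply]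
    have : cs.simple s * y = w ↔ y = cs.simple s * w := by
      constructor
      · rintro rfl; simp
      · rintro rfl; simp
    by_cases h : y = w
    · subst h
      by_cases h' : y = cs.simple s * y
      · have := congrArg cs.length h'
        have := cs.length_simple_mul_ne y s
        lia
      · simp [h', Ne.symm h', mul_comm]
    · simp [h, this]

lemma bsC_up (c : W →₀ ℤ[T;T⁻¹]) {y : W} (hy : cs.length y < cs.length (cs.simple s * y)) :
    bsC cs s c y = T 1 * c y + c (cs.simple s * y) := by
  rw [bsC_apply, if_pos hy]

lemma bsC_down (c : W →₀ ℤ[T;T⁻¹]) {y : W} (hy : cs.length y < cs.length (cs.simple s * y)) :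
    bsC cs s c (cs.simple s * y) = T (-1) * c (cs.simple s * y) + c y := by
  rw [bsC_apply, if_neg (by simp [hy.le])]
  simp

lemma coeff_T_mul (n : ℤ) (p : ℤ[T;T⁻¹]) (k : ℤ) : (T n * p).coeff k = p.coeff (k - n) := by
  rw [T, AddMonoidAlgebra.coeff_single_mul_apply, one_mul]
  congr 1; ring

theorem char_bs {c : W →₀ ℤ[T;T⁻¹]} (hX : Good X) (hc : Char X c) (s : B) :
    Char (bs cs s X) (bsC cs s c) := by
  refine char_of_height (pht_isHeight cs s) (good_bs hX s) fun w k => ?_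
  rcases simple_cases (cs := cs) s w with hw | ⟨y, rfl, hw⟩
  · rw [pht_le_eq, bsC_up c hw]
    have h1 := hc.height (pht_isHeight cs s) w (k - 1)
    have h2 := hc.height (pht_isHeight cs s) (cs.simple s * w) (k - 1)
    rw [pht_le_eq] at h1
    rw [pht_simple_le_eq hw] at h2
    have := ((bs_img_up hX hw).2.2 _ _ _ h1 h2).1
    rw [sub_add_cancel] at this
    convert this using 1
    rw [AddMonoidAlgebra.coeff_add, Finsupp.add_apply, coeff_T_mul, length_up hw]
    congr 2
    · ring
    · push_cast; ring
  · rw [pht_simple_le_eq hw, bsC_down c hw]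
    have h1 := hc.height (pht_isHeight cs s) y (k + 1)
    have h2 := hc.height (pht_isHeight cs s) (cs.simple s * y) (k + 1)
    rw [pht_le_eq] at h1
    rw [pht_simple_le_eq hw] at h2
    have := ((bs_img_up hX hw).2.2 _ _ _ h1 h2).2
    rw [add_neg_cancel_right] at this
    convert this using 1
    rw [AddMonoidAlgebra.coeff_add, Finsupp.add_apply, coeff_T_mul, length_up hw, add_comm]
    congr 2
    · push_cast; ring
    · ring

/-- The pairing of characters. -/
def cpair (p c : W →₀ ℤ[T;T⁻¹]) : ℤ[T;T⁻¹] := p.sum fun u a => a * c u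

omit [Group W] in
lemma cpair_add (p q c : W →₀ ℤ[T;T⁻¹]) : cpair (p + q) c = cpair p c + cpair q c :=
  Finsupp.sum_add_index' (by simp) (by intros; ring)

omit [Group W] in
lemma cpair_single (u : W) (a : ℤ[T;T⁻¹]) (c : W →₀ ℤ[T;T⁻¹]) :
    cpair (Finsupp.single u a) c = a * c u := Finsupp.sum_single_index (by simp)

omit [Group W] in
lemma cpair_zero (c : W →₀ ℤ[T;T⁻¹]) : cpair 0 c = 0 := Finsupp.sum_zero_index

lemma cpair_bsC (p c : W →₀ ℤ[T;T⁻¹]) : cpair (bsC cs s p) c = cpair p (bsC cs s c) := by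
  classical
  induction p using Finsupp.induction_linear with
  | zero => simp [cpair_zero]
  | add f g hf hg => rw [map_add, cpair_add, cpair_add, hf, hg]
  | single y a =>
    rw [cpair_single, bsC_apply, bsC, Finsupp.linearCombination_single, smul_add,
      Finsupp.smul_single, Finsupp.smul_single, cpair_add, cpair_single, cpair_single]
    simp only [smul_eq_mul]; ring

end BsGood

end

section

variable {B W : Type} [Group W] {M : CoxeterMatrix B} {cs : CoxeterSystem M W}

attribute [local instance] wOrder

open Obj

/-! ### Homomorphisms -/

/-- Bimodule homomorphisms of degree `d`. -/
def homs (X Y : Obj cs) (d : ℤ) : Submodule ℝ (X →ₗ[Pol B] Y) where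
  carrier := {f | (∀ r m, f (X.act r m) = Y.act r (f m)) ∧ ∀ k m, f (X.pr k m) = Y.pr (k + d) (f m)}
  add_mem' := by
    rintro f g ⟨h1, h2⟩ ⟨h3, h4⟩
    exact ⟨fun r m => by simp [h1, h3], fun k m => by simp [h2, h4]⟩
  zero_mem' := ⟨fun r m => by simp, fun k m => by simp⟩
  smul_mem' := by
    rintro a f ⟨h1, h2⟩
    exact ⟨fun r m => by simp [h1, ← C_smul], fun k m => by simp [h2]⟩

variable {X Y Z N : Obj cs} {d d' : ℤ}

lemma homs_act {f : X →ₗ[Pol B] Y} (hf : f ∈ homs X Y d) (r : Pol B) (m : X) :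
    f (X.act r m) = Y.act r (f m) := hf.1 r m

lemma homs_pr {f : X →ₗ[Pol B] Y} (hf : f ∈ homs X Y d) (k : ℤ) (m : X) :
    f (X.pr k m) = Y.pr (k + d) (f m) := hf.2 k m

lemma homs_gr {f : X →ₗ[Pol B] Y} (hf : f ∈ homs X Y d) {k : ℤ} {m : X} (hm : m ∈ X.gr k) :
    f m ∈ Y.gr (k + d) := by
  rw [mem_gr, ← homs_pr hf, mem_gr.mp hm]

lemma homs_sup {f : X →ₗ[Pol B] Y} (hf : f ∈ homs X Y d) {J : Set W} {m : X} (hm : m ∈ X.sup J) :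
    f m ∈ Y.sup J := map_mem_sup hf.1 hm

lemma homs_comp {f : X →ₗ[Pol B] Y} (hf : f ∈ homs X Y d) {g : Y →ₗ[Pol B] Z}
    (hg : g ∈ homs Y Z d') : g ∘ₗ f ∈ homs X Z (d + d') :=
  ⟨fun r m => by simp [homs_act hf, homs_act hg], fun k m => by
    simp [homs_pr hf, homs_pr hg, add_assoc]⟩

lemma homs_id : LinearMap.id ∈ homs X X 0 := ⟨fun _ _ => rfl, fun k m => by simp⟩

lemma homs_smul {f : X →ₗ[Pol B] Y} {k : ℤ} (hf : f ∈ homs X Y (k - 2)) (l : Wt B) :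
    lin l • f ∈ homs X Y k := by
  refine ⟨fun r m => by simp [homs_act hf], fun j m => ?_⟩
  rw [LinearMap.smul_apply, LinearMap.smul_apply, homs_pr hf, ← Y.pr_smul]
  congr 2; ring

/-- Adjoint pairs of homomorphisms of degree `d`. -/
structure IsAdj (d : ℤ) (f : X →ₗ[Pol B] Y) (g : Y →ₗ[Pol B] X) : Prop where
  left : f ∈ homs X Y d
  right : g ∈ homs Y X d
  form : ∀ m n, Y.form (f m) n = X.form m (g n)

namespace IsAdj

lemma symm {f : X →ₗ[Pol B] Y} {g : Y →ₗ[Pol B] X} (h : IsAdj d f g) : IsAdj d g f where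
  left := h.right
  right := h.left
  form m n := by rw [X.form_comm, ← h.form, Y.form_comm]

lemma comp {f : X →ₗ[Pol B] Y} {g : Y →ₗ[Pol B] X} {f' : Y →ₗ[Pol B] Z} {g' : Z →ₗ[Pol B] Y}
    (h' : IsAdj d' f' g') (h : IsAdj d f g) : IsAdj (d + d') (f' ∘ₗ f) (g ∘ₗ g') where
  left := homs_comp h.left h'.left
  right := by rw [add_comm]; exact homs_comp h'.right h.right
  form m n := by simp [h.form, h'.form]

lemma add {f f' : X →ₗ[Pol B] Y} {g g' : Y →ₗ[Pol B] X} (h : IsAdj d f g) (h' : IsAdj d f' g') :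
    IsAdj d (f + f') (g + g') where
  left := Submodule.add_mem _ h.left h'.left
  right := Submodule.add_mem _ h.right h'.right
  form m n := by simp [h.form, h'.form]

lemma smul {f : X →ₗ[Pol B] Y} {g : Y →ₗ[Pol B] X} (h : IsAdj d f g) (a : ℝ) :
    IsAdj d (a • f) (a • g) where
  left := Submodule.smul_mem _ _ h.left
  right := Submodule.smul_mem _ _ h.right
  form m n := by simp [h.form]

lemma id : IsAdj 0 (LinearMap.id : X →ₗ[Pol B] X) LinearMap.id :=
  ⟨homs_id, homs_id, fun _ _ => rfl⟩

end IsAdj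

section Bs

variable (s : B)

lemma bs_pr_fst (k : ℤ) (m : bs cs s X) : ((bs cs s X).pr k m).1 = X.pr (k - 1) m.1 := rfl
lemma bs_pr_snd (k : ℤ) (m : bs cs s X) : ((bs cs s X).pr k m).2 = X.pr (k + 1) m.2 := rfl
lemma bs_act_fst (r : Pol B) (m : bs cs s X) :
    ((bs cs s X).act r m).1 = X.act r m.1 + X.act (dem M s r) m.2 := rfl
lemma bs_act_snd (r : Pol B) (m : bs cs s X) :
    ((bs cs s X).act r m).2 = X.act (sact M s r) m.2 := rfl

/-- Functoriality of `B_s`. -/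
def bsMap (f : X →ₗ[Pol B] Y) : bs cs s X →ₗ[Pol B] bs cs s Y := f.prodMap f

@[simp] lemma bsMap_fst (f : X →ₗ[Pol B] Y) (m : bs cs s X) : (bsMap s f m).1 = f m.1 := rfl
@[simp] lemma bsMap_snd (f : X →ₗ[Pol B] Y) (m : bs cs s X) : (bsMap s f m).2 = f m.2 := rfl

variable {s} in
lemma bsMap_mem {f : X →ₗ[Pol B] Y} (hf : f ∈ homs X Y d) :
    bsMap s f ∈ homs (bs cs s X) (bs cs s Y) d := by
  refine ⟨fun r m => bs_ext _ _ ?_ ?_, fun k m => bs_ext _ _ ?_ ?_⟩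
  · simp [bs_act_fst, homs_act hf]
  · simp [bs_act_snd, homs_act hf]
  · simp only [bsMap_fst, bs_pr_fst, homs_pr hf]; congr 1; congr 1; ring
  · simp only [bsMap_snd, bs_pr_snd, homs_pr hf]; congr 1; congr 1; ring

variable {s} in
lemma IsAdj.bsMap {f : X →ₗ[Pol B] Y} {g : Y →ₗ[Pol B] X} (h : IsAdj d f g) :
    IsAdj d (bsMap s f) (bsMap s g) where
  left := bsMap_mem h.left
  right := bsMap_mem h.right
  form m n := by simp [bs_form, h.form]

/-- The inclusion of `X` in `B_s X`. -/
def jmap (X : Obj cs) : X →ₗ[Pol B] bs cs s X := LinearMap.inl (Pol B) X X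

@[simp] lemma jmap_fst (m : X) : (jmap s X m).1 = m := rfl
@[simp] lemma jmap_snd (m : X) : (jmap s X m).2 = 0 := rfl

/-- The multiplication from `B_s X` to `X`. -/
def mmap (X : Obj cs) : bs cs s X →ₗ[Pol B] X := (X.act (al s)).coprod LinearMap.id

lemma mmap_apply (m : bs cs s X) : mmap s X m = X.act (al s) m.1 + m.2 := rfl

lemma isAdj_jmap : IsAdj 1 (jmap s X) (mmap s X) where
  left := by
    refine ⟨fun r m => bs_ext _ _ ?_ ?_, fun k m => bs_ext _ _ ?_ ?_⟩
    · simp [bs_act_fst]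
    · simp [bs_act_snd]
    · simp [bs_pr_fst]
    · simp [bs_pr_snd]
  right := by
    refine ⟨fun r m => ?_, fun k m => ?_⟩
    · rw [mmap_apply, mmap_apply, bs_act_fst, bs_act_snd, map_add, map_add, ← X.act_mul _ (dem M s r),
        al_mul_dem, X.act_sub, X.act_comm]
      abel
    · have := X.pr_act (k - 1) (root s) m.1
      rw [show k - 1 + 2 = k + 1 by ring] at this
      rw [mmap_apply, mmap_apply, bs_pr_fst, bs_pr_snd, map_add, al, this]
  form m n := by
    rw [bs_form, mmap_apply, map_add, X.form_act_right]
    simp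

/-- The adjunct of a map to `B_s Y`. -/
def adjL (h : X →ₗ[Pol B] bs cs s Y) : bs cs s X →ₗ[Pol B] Y :=
  LinearMap.coprod (mmap s Y ∘ₗ h) (LinearMap.fst (Pol B) Y Y ∘ₗ h)

/-- The adjunct of a map from `B_s X`. -/
def adjR (g : bs cs s X →ₗ[Pol B] Y) : X →ₗ[Pol B] bs cs s Y :=
  LinearMap.prod (g ∘ₗ sndY s X) (g ∘ₗ jmap s X - Y.act (al s) ∘ₗ g ∘ₗ sndY s X)

variable {s}

lemma adjL_apply (h : X →ₗ[Pol B] bs cs s Y) (m : bs cs s X) :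
    adjL s h m = Y.act (al s) (h m.1).1 + (h m.1).2 + (h m.2).1 := rfl

@[simp] lemma adjR_fst (g : bs cs s X →ₗ[Pol B] Y) (m : X) : (adjR s g m).1 = g (sndY s X m) := rfl

@[simp] lemma adjR_snd (g : bs cs s X →ₗ[Pol B] Y) (m : X) :
    (adjR s g m).2 = g (jmap s X m) - Y.act (al s) (g (sndY s X m)) := rfl

lemma sum_eq (m : bs cs s X) : jmap s X m.1 + sndY s X m.2 = m :=
  bs_ext _ _ (by simp) (by simp)

lemma adjL_adjR (g : bs cs s X →ₗ[Pol B] Y) : adjL s (adjR s g) = g := by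
  ext m
  rw [adjL_apply, adjR_fst, adjR_snd, adjR_fst]
  conv_rhs => rw [← sum_eq m, map_add]
  abel

lemma adjL_injective (h : X →ₗ[Pol B] bs cs s Y) (h0 : adjL s h = 0) : h = 0 := by
  refine LinearMap.ext fun m => ?_
  have h1 := LinearMap.congr_fun h0 (sndY s X m)
  have h2 := LinearMap.congr_fun h0 (jmap s X m)
  have z : h 0 = 0 := map_zero h
  have z1 : (0 : bs cs s Y).1 = 0 := rfl
  have z2 : (0 : bs cs s Y).2 = 0 := rfl
  simp only [adjL_apply, sndY_fst, sndY_snd, jmap_fst, jmap_snd, z, z1, z2, map_zero, zero_add,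
    add_zero, LinearMap.zero_apply] at h1 h2
  refine bs_ext _ _ h1 ?_
  rwa [h1, map_zero, zero_add] at h2

lemma bs_fst_smul (r : Pol B) (m : bs cs s X) : (r • m).1 = r • m.1 := rfl
lemma bs_snd_smul (r : Pol B) (m : bs cs s X) : (r • m).2 = r • m.2 := rfl

variable (X Y) in
/-- The adjunction, as a linear map. -/
def adjLin : (X →ₗ[Pol B] bs cs s Y) →ₗ[Pol B] (bs cs s X →ₗ[Pol B] Y) where
  toFun h := adjL s h
  map_add' h h' := LinearMap.ext fun m => by
    rw [LinearMap.add_apply, adjL_apply, adjL_apply, adjL_apply]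
    simp only [LinearMap.add_apply, bs_fst_add, bs_snd_add, map_add]
    abel
  map_smul' r h := LinearMap.ext fun m => by
    rw [LinearMap.smul_apply, adjL_apply, adjL_apply]
    simp only [LinearMap.smul_apply, bs_fst_smul, bs_snd_smul, map_smul, smul_add, RingHom.id_apply]

lemma adjL_mem {h : X →ₗ[Pol B] bs cs s Y} (hh : h ∈ homs X (bs cs s Y) d) :
    adjL s h ∈ homs (bs cs s X) Y d := by
  refine ⟨fun r m => ?_, fun k m => ?_⟩
  · have h1 (r : Pol B) (m : X) : (h (X.act r m)).1 = Y.act r (h m).1 + Y.act (dem M s r) (h m).2 := by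
      rw [homs_act hh, bs_act_fst]
    have h0 (r : Pol B) (m : X) : (h (X.act r m)).2 = Y.act (sact M s r) (h m).2 := by
      rw [homs_act hh, bs_act_snd]
    have hd : dem M s (dem M s r) = 0 := by
      have := al_mul_dem (M := M) s (dem M s r)
      rw [sact_dem, sub_self] at this
      exact (mul_eq_zero.mp this).resolve_left (al_ne_zero s)
    simp only [adjL_apply, bs_act_fst, bs_act_snd, map_add, h1, h0, bs_fst_add, bs_snd_add, hd,
      dem_sact, sact_dem, map_zero, LinearMap.zero_apply, Y.act_neg, add_zero]
    rw [← Y.act_mul _ (dem M s r), ← Y.act_mul _ (dem M s r), al_mul_dem, Y.act_sub, Y.act_sub,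
      Y.act_comm]
    abel
  · have h1 (k) (m : X) : (h (X.pr k m)).1 = Y.pr (k + d - 1) (h m).1 := by
      rw [homs_pr hh, bs_pr_fst]
    have h0 (k) (m : X) : (h (X.pr k m)).2 = Y.pr (k + d + 1) (h m).2 := by
      rw [homs_pr hh, bs_pr_snd]
    have := Y.pr_act (k + d - 2) (root s) (h m.1).1
    rw [sub_add_cancel] at this
    simp only [adjL_apply, bs_pr_fst, bs_pr_snd, map_add, h1, h0, al, this]
    rw [show k - 1 + d - 1 = k + d - 2 by ring, show k - 1 + d + 1 = k + d by ring,
      show k + 1 + d - 1 = k + d by ring]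

lemma adjR_mem {g : bs cs s X →ₗ[Pol B] Y} (hg : g ∈ homs (bs cs s X) Y d) :
    adjR s g ∈ homs X (bs cs s Y) d := by
  have hj := isAdj_jmap (X := X) s
  refine ⟨fun r m => ?_, fun k m => ?_⟩
  · have h1 : g (jmap s X (X.act r m)) = Y.act r (g (jmap s X m)) := by
      rw [homs_act hj.left, homs_act hg]
    have h0 : g (sndY s X (X.act r m)) =
        Y.act (sact M s r) (g (sndY s X m)) + Y.act (dem M s r) (g (jmap s X m)) := by
      rw [← homs_act hg, ← homs_act hg, ← map_add]
      congr 1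
      apply bs_ext
      · simp [bs_act_fst, dem_sact]
      · simp [bs_act_snd, sact_sact]
    refine bs_ext _ _ ?_ ?_
    · rw [adjR_fst, h0, bs_act_fst, adjR_fst, adjR_snd, map_sub, ← Y.act_mul, mul_comm (dem M s r),
        al_mul_dem, Y.act_sub]
      abel
    · rw [adjR_snd, h0, h1, bs_act_snd, adjR_snd, map_add, map_sub, ← Y.act_mul _ (dem M s r),
        al_mul_dem, Y.act_sub, Y.act_comm (al s)]
      abel
  · have h1 (k) : g (jmap s X (X.pr k m)) = Y.pr (k + 1 + d) (g (jmap s X m)) := by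
      rw [homs_pr hj.left, homs_pr hg]
    have h0 (k) : g (sndY s X (X.pr k m)) = Y.pr (k - 1 + d) (g (sndY s X m)) := by
      rw [← homs_pr hg]
      congr 1
      refine bs_ext _ _ ?_ ?_
      · simp [bs_pr_fst]
      · simp [bs_pr_snd]
    refine bs_ext _ _ ?_ ?_
    · rw [adjR_fst, h0, bs_pr_fst, adjR_fst]; congr 1; congr 1; ring
    · have := Y.pr_act (k - 1 + d) (root s) (g (sndY s X m))
      rw [adjR_snd, h0, h1, bs_pr_snd, adjR_snd, map_sub, al, ← this]
      congr 2 <;> congr 1 <;> ring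

lemma IsAdj.adjL {h : X →ₗ[Pol B] bs cs s Y} {h' : bs cs s Y →ₗ[Pol B] X} (hh : IsAdj d h h') :
    IsAdj d (adjL s h) (adjR s h') where
  left := adjL_mem hh.left
  right := adjR_mem hh.right
  form m n := by
    have h1 (m : X) : al s * Y.form (h m).1 n + Y.form (h m).2 n = X.form m (h' (jmap s Y n)) := by
      rw [← hh.form, bs_form]; simp
    have h0 (m : X) : Y.form (h m).1 n + dem M s (Y.form (h m).2 n) =
        X.form m (h' (sndY s Y n)) := by
      rw [← hh.form, bs_form]; simp
    rw [adjL_apply, bs_form, adjR_fst, adjR_snd, map_sub, X.form_act_right, map_sub,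
      X.form_act_right, map_sub, ← h1, ← h1, ← h0, ← h0, map_add, map_add, LinearMap.add_apply,
      LinearMap.add_apply, Y.form_act, dem_al_mul]
    simp only [map_add, dem_al_mul, sact_dem]
    ring

end Bs

end

section

variable {B W : Type} [Group W] {M : CoxeterMatrix B} {cs : CoxeterSystem M W}

attribute [local instance] wOrder

open Obj

/-! ### Graded dimensions of spaces of homomorphisms -/

variable {X X' Y N : Obj cs} {d k : ℤ} {s : B}

/-- Graded ranks of spaces of homomorphisms out of `X` are computed by pairing with `p`. -/
structure HomChar (X : Obj cs) (p : W →₀ ℤ[T;T⁻¹]) : Prop where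
  hasQ : ∀ (N : Obj cs) (c : W →₀ ℤ[T;T⁻¹]), Good N → Char N c → ∀ k,
    HasQ (B := B) (homs X N) k ((cpair p c).coeff k)
  bdd : ∀ N : Obj cs, ∃ n : ℤ, ∀ k < n, homs X N k = ⊥

lemma pr_poly_smul {m : X} (hm : m ∈ X.gr k) (p : Pol B) (j : ℤ) :
    X.pr (j + k) (p • m) = hcomp j p • m := by
  induction p using MvPolynomial.induction_on generalizing j with
  | C a =>
    rw [hcomp_C, C_smul, map_smul]
    split_ifs with h
    · rw [h, zero_add, mem_gr.mp hm, C_smul]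
    · rw [pr_of_mem_ne hm (by lia), smul_zero, zero_smul]
  | add p q hp hq => rw [add_smul, map_add, hp, hq, map_add, add_smul]
  | mul_X p o hp =>
    have h1 := hcomp_lin_mul (j - 2) (Finsupp.single o 1) p
    have h2 := X.pr_smul (j - 2 + k) (Finsupp.single o 1) (p • m)
    rw [lin_single, sub_add_cancel] at h1
    rw [lin_single, show j - 2 + k + 2 = j + k by ring, hp] at h2
    rw [mul_comm, mul_smul, h2, h1, mul_smul]

lemma act_of_mem_sup_one {m : X} (hm : m ∈ X.sup {1}) (r : Pol B) : X.act r m = r • m := by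
  apply X.emb_inj
  funext j
  rw [X.emb_act, map_smul, Pi.smul_apply, smul_eq_mul]
  by_cases hj : X.lab j = 1
  · rw [hj, inv_one, wact_one]
  · rw [mem_sup.mp hm j hj, mul_zero, mul_zero]

variable (cs) in
/-- The generator of the unit object. -/
def u1 : unit cs := (1 : Pol B)

lemma exists_smul_u1 (p : unit cs) : ∃ r : Pol B, p = r • u1 cs :=
  ⟨p, (mul_one (M := Pol B) p).symm⟩

lemma u1_mem_sup : u1 cs ∈ (unit cs).sup {1} := fun _ hj => absurd rfl hj

lemma u1_mem_gr : u1 cs ∈ (unit cs).gr 0 := by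
  refine mem_gr.mpr ?_
  have := hcomp_C (B := B) 0 1
  rw [if_pos rfl, map_one] at this
  exact this

variable (cs) in
/-- The map from the unit object determined by an element. -/
def unitMap (m : N) : unit cs →ₗ[Pol B] N := (LinearMap.toSpanSingleton (Pol B) N m : Pol B →ₗ[Pol B] N)

lemma unitMap_u1 (m : N) : unitMap cs m (u1 cs) = m := one_smul (Pol B) m

lemma unitMap_mem {m : N} (hm : m ∈ N.sup {1}) (hg : m ∈ N.gr k) :
    unitMap cs m ∈ homs (unit cs) N k := by
  refine ⟨fun r p => ?_, fun j p => ?_⟩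
  · obtain ⟨p, rfl⟩ := exists_smul_u1 p
    rw [act_smul, act_of_mem_sup_one u1_mem_sup, map_smul, map_smul, map_smul, unitMap_u1,
      act_smul, act_of_mem_sup_one hm]
  · obtain ⟨p, rfl⟩ := exists_smul_u1 p
    have := pr_poly_smul (u1_mem_gr (cs := cs)) p j
    rw [add_zero] at this
    rw [this, map_smul, map_smul, unitMap_u1, pr_poly_smul hg]

lemma unit_hom_ext {f : unit cs →ₗ[Pol B] N} (h : f (u1 cs) = 0) : f = 0 := by
  refine LinearMap.ext fun p => ?_
  obtain ⟨p, rfl⟩ := exists_smul_u1 p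
  rw [map_smul, h, smul_zero, LinearMap.zero_apply]

lemma homChar_unit : HomChar (unit cs) (Finsupp.single 1 1) where
  hasQ N c hN hc k := by
    have h1 : Closed cs ({1} : Set W) := by
      rintro f rfl t ht h
      simp at h
    have h2 : Top cs ({1} : Set W) 1 := by
      rintro t ht h h'
      rw [Set.mem_singleton_iff.mp h'] at h
      simp at h
    have := hc {1} 1 h1 rfl h2 k
    rw [cpair_single, one_mul]
    rw [cs.length_one, Nat.cast_zero, add_zero] at this
    refine hasQ_comap (𝓖 := homs (unit cs) N)
      (N.ev {1} ∘ₗ LinearMap.applyₗ (R := Pol B) (u1 cs)) ?_ ?_ ?_ this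
    · intro k
      ext x
      constructor
      · rintro ⟨f, hf, rfl⟩
        refine mem_gimg.mpr ⟨f (u1 cs), homs_sup hf u1_mem_sup, ?_, rfl⟩
        have := homs_gr hf u1_mem_gr
        rwa [zero_add] at this
      · intro hx
        obtain ⟨m, hm, hg, rfl⟩ := mem_gimg.mp hx
        exact ⟨unitMap cs m, unitMap_mem hm hg, congrArg (N.ev {1}) (unitMap_u1 m)⟩
    · intro f hf h0
      have h3 : f (u1 cs) ∈ N.sup {1} := homs_sup hf u1_mem_sup
      have h4 : f (u1 cs) ∈ N.sup {1}ᶜ := ev_eq_zero.mp h0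
      refine unit_hom_ext ?_
      have := mem_sup_inter h3 h4
      apply N.emb_inj
      funext j
      rw [mem_sup] at this
      rw [this j (by simp), map_zero, Pi.zero_apply]
    · intro f hf l
      exact homs_smul hf l
  bdd N := by
    obtain ⟨n, hn⟩ := N.bdd
    refine ⟨n, fun k hk => ?_⟩
    rw [eq_bot_iff]
    intro f hf
    have := homs_gr hf u1_mem_gr
    rw [zero_add, mem_gr, hn k hk] at this
    exact (Submodule.mem_bot ℝ).mpr (unit_hom_ext this.symm)

lemma HomChar.bs {p : W →₀ ℤ[T;T⁻¹]} (h : HomChar X p) (s : B) :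
    HomChar (bs cs s X) (bsC cs s p) where
  hasQ N c hN hc k := by
    have := h.hasQ _ _ (good_bs hN s) (char_bs hN hc s) k
    rw [← cpair_bsC] at this
    have h2 := hasQ_map (𝓗 := homs (KL.bs cs s X) N) (d := 0) (adjLin (s := s) X N) (fun k => ?_) ?_ ?_ this
    · simpa using h2
    · rw [add_zero]
      ext f
      constructor
      · rintro ⟨g, hg, rfl⟩
        exact adjL_mem hg
      · intro hf
        exact ⟨adjR s f, adjR_mem hf, adjL_adjR f⟩
    · exact fun x _ h0 => adjL_injective x h0
    · exact fun f hf l => homs_smul hf l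
  bdd N := by
    obtain ⟨n, hn⟩ := h.bdd (KL.bs cs s N)
    refine ⟨n, fun k hk => ?_⟩
    rw [eq_bot_iff]
    intro f hf
    have := adjR_mem hf
    rw [hn k hk, Submodule.mem_bot] at this
    rw [Submodule.mem_bot, ← adjL_adjR f, this]
    exact map_zero (adjLin (s := s) X N)

/-- Vanishing of homomorphisms of small degree. -/
lemma HomChar.eq_zero {p c : W →₀ ℤ[T;T⁻¹]} (h : HomChar X p) (hN : Good N) (hc : Char N c)
    {n : ℤ} (hn : ∀ k < n, (cpair p c).coeff k = 0) {k : ℤ} (hk : k < n) : homs X N k = ⊥ := by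
  obtain ⟨b, hb⟩ := h.bdd N
  have key : ∀ j : ℕ, ∀ k < n, k < b + j → homs X N k = ⊥ := by
    intro j
    induction j with
    | zero => intro k _ hk; exact hb k (by simpa using hk)
    | succ j ih =>
      intro k hk hk'
      have h1 := h.hasQ N c hN hc k
      rw [hn k hk] at h1
      rw [eq_bot_iff]
      refine h1.eq_lam.trans (Submodule.span_le.mpr ?_)
      rintro _ ⟨l, g, hg, rfl⟩
      rw [ih (k - 2) (by lia) (by push_cast at hk'; lia)] at hg
      rw [(Submodule.mem_bot ℝ).mp hg, smul_zero]
      exact Submodule.zero_mem _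
  exact key (k + 1 - b).toNat k hk (by lia)

/-! ### Splittings -/

section Lin

variable {P P₁ P₂ : Type} [AddCommGroup P] [Module (Pol B) P] [Module ℝ P]
  [IsScalarTower ℝ (Pol B) P] [AddCommGroup P₁] [Module (Pol B) P₁] [Module ℝ P₁]
  [IsScalarTower ℝ (Pol B) P₁] [AddCommGroup P₂] [Module (Pol B) P₂] [Module ℝ P₂]
  [IsScalarTower ℝ (Pol B) P₂]

theorem hasQ_split {𝓐 : ℤ → Submodule ℝ P} {𝓔 : ℤ → Submodule ℝ P₁} {𝓑 : ℤ → Submodule ℝ P₂}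
    (f : P →ₗ[Pol B] P₁) (f' : P₁ →ₗ[Pol B] P) (i' : P₁ →ₗ[Pol B] P₂) (i : P₂ →ₗ[Pol B] P₁)
    {k : ℤ} {c : ℝ} (hc : c ≠ 0)
    (hf : ∀ k, ∀ x ∈ 𝓐 k, f x ∈ 𝓔 k) (hf' : ∀ k, ∀ x ∈ 𝓔 k, f' x ∈ 𝓐 k)
    (hi' : ∀ k, ∀ x ∈ 𝓔 k, i' x ∈ 𝓑 k) (hi : ∀ k, ∀ x ∈ 𝓑 k, i x ∈ 𝓔 k)
    (hgr : ∀ x ∈ 𝓔 (k - 2), ∀ l : Wt B, lin l • x ∈ 𝓔 k)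
    (hff : ∀ x, f' (f x) = c • x) (hii : ∀ x, i' (i x) = x)
    (hsum : ∀ x, c⁻¹ • f (f' x) + i (i' x) = x) {a : ℤ} (ha : HasQ (B := B) 𝓐 k a) (e : ℤ)
    (he : HasQ (B := B) 𝓔 k e) : HasQ (B := B) 𝓑 k (e - a) := by
  refine (hasQ_exact f i' hf hi' ?_ ?_ hgr ?_ ?_ ha).2 e he
  · intro x _
    have h := hsum (f x)
    rw [hff, LinearMap.map_smul_of_tower, smul_smul, inv_mul_cancel₀ hc, one_smul,
      add_eq_left] at h
    rw [← hii (i' (f x)), h, map_zero]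
  · exact fun k y hy => ⟨i y, hi k y hy, hii y⟩
  · intro x hx h0
    refine ⟨c⁻¹ • f' x, Submodule.smul_mem _ _ (hf' k x hx), ?_⟩
    have := hsum x
    rwa [h0, map_zero, add_zero, ← LinearMap.map_smul_of_tower] at this
  · intro x _ hl
    have := map_lam_le (d := 0) (𝓗 := 𝓐) f' (by simpa using hf' (k - 2)) hl
    rw [add_zero, hff] at this
    have := Submodule.smul_mem _ c⁻¹ this
    rwa [smul_smul, inv_mul_cancel₀ hc, one_smul] at this

end Lin

/-- The map on localizations induced by a homomorphism. -/
def locMap (J : Set W) {f : X →ₗ[Pol B] Y} (hf : f ∈ homs X Y d) : X.loc J →ₗ[Pol B] Y.loc J :=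
  Submodule.mapQ _ _ f fun _ hm => homs_sup hf hm

lemma locMap_img {J A : Set W} {f : X →ₗ[Pol B] Y} (hf : f ∈ homs X Y d) {x : X.loc J}
    (hx : x ∈ X.img J A) : locMap J hf x ∈ Y.img J A := by
  obtain ⟨m, hm, rfl⟩ := hx
  exact ⟨f m, homs_sup hf hm, rfl⟩

lemma locMap_gimg {J A : Set W} {f : X →ₗ[Pol B] Y} (hf : f ∈ homs X Y 0) {x : X.loc J}
    (hx : x ∈ X.gimg J A k) : locMap J hf x ∈ Y.gimg J A k := by
  obtain ⟨m, hm, hg, rfl⟩ := mem_gimg.mp hx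
  have := homs_gr hf hg
  rw [add_zero] at this
  exact mem_gimg.mpr ⟨f m, homs_sup hf hm, this, rfl⟩

/-- Orthogonal decompositions `X = Y ⊕ X'`. -/
structure Split (c : ℝ) (f : Y →ₗ[Pol B] X) (f' : X →ₗ[Pol B] Y) (i : X' →ₗ[Pol B] X)
    (i' : X →ₗ[Pol B] X') : Prop where
  ne : c ≠ 0
  adj : IsAdj 0 f f'
  adj' : IsAdj 0 i i'
  comp : ∀ y, f' (f y) = c • y
  comp' : ∀ x, i' (i x) = x
  sum : ∀ x, c⁻¹ • f (f' x) + i (i' x) = x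

namespace Split

variable {c : ℝ} {f : Y →ₗ[Pol B] X} {f' : X →ₗ[Pol B] Y} {i : X' →ₗ[Pol B] X}
  {i' : X →ₗ[Pol B] X'} (S : Split c f f' i i')

lemma homChar {p q : W →₀ ℤ[T;T⁻¹]} (S : Split c f f' i i') (hX : HomChar X p)
    (hY : HomChar Y q) : HomChar X' (p - q) where
  hasQ N e hN he k := by
    have h1 := hX.hasQ N e hN he k
    have h2 := hY.hasQ N e hN he k
    have := hasQ_split (𝓐 := homs Y N) (𝓔 := homs X N) (𝓑 := homs X' N) (c := c)
      (LinearMap.lcomp (Pol B) N f') (LinearMap.lcomp (Pol B) N f) (LinearMap.lcomp (Pol B) N i)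
      (LinearMap.lcomp (Pol B) N i') S.ne ?_ ?_ ?_ ?_ ?_ ?_ ?_ ?_ h2 _ h1
    · have hc : cpair p e = cpair (p - q) e + cpair q e := by rw [← cpair_add, sub_add_cancel]
      rw [hc, AddMonoidAlgebra.coeff_add, Finsupp.add_apply, add_sub_cancel_right] at this
      exact this
    · intro k x hx; have := homs_comp S.adj.right hx; rwa [zero_add] at this
    · intro k x hx; have := homs_comp S.adj.left hx; rwa [zero_add] at this
    · intro k x hx; have := homs_comp S.adj'.left hx; rwa [zero_add] at this
    · intro k x hx; have := homs_comp S.adj'.right hx; rwa [zero_add] at this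
    · intro x hx l; exact homs_smul hx l
    · intro g; ext y
      simp [LinearMap.lcomp_apply', S.comp, LinearMap.map_smul_of_tower]
    · intro g; ext y
      simp [LinearMap.lcomp_apply', S.comp']
    · intro g; ext y
      conv_rhs => rw [← S.sum y, map_add, LinearMap.map_smul_of_tower]
      simp [LinearMap.lcomp_apply']
  bdd N := by
    obtain ⟨n, hn⟩ := hX.bdd N
    refine ⟨n, fun k hk => ?_⟩
    rw [eq_bot_iff]
    intro g hg
    have := homs_comp S.adj'.right hg
    rw [zero_add, hn k hk, Submodule.mem_bot] at this
    rw [Submodule.mem_bot]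
    ext x
    rw [← S.comp' x]
    exact LinearMap.congr_fun this _

lemma good (S : Split c f f' i i') (hX : Good X) : Good X' := by
  intro J w hJ hw hT
  have := hX J w hJ hw hT
  refine Projective.of_split
    ((locMap {w} S.adj'.left).restrict (p := X'.img {w} J) (q := X.img {w} J)
      fun x hx => locMap_img _ hx)
    ((locMap {w} S.adj'.right).restrict (p := X.img {w} J) (q := X'.img {w} J)
      fun x hx => locMap_img _ hx) ?_
  ext x
  obtain ⟨_, m, hm, rfl⟩ := x
  change X'.ev {w} (i' (i m)) = X'.ev {w} m
  rw [S.comp']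

lemma char {p q : W →₀ ℤ[T;T⁻¹]} (S : Split c f f' i i') (hX : Char X p) (hY : Char Y q) :
    Char X' (p - q) := by
  intro J w hJ hw hT k
  have := hasQ_split (𝓐 := Y.gimg {w} J) (𝓔 := X.gimg {w} J) (𝓑 := X'.gimg {w} J) (c := c)
    (locMap {w} S.adj.left) (locMap {w} S.adj.right)
    (locMap {w} S.adj'.right) (locMap {w} S.adj'.left) S.ne
    (fun k x hx => locMap_gimg _ hx) (fun k x hx => locMap_gimg _ hx)
    (fun k x hx => locMap_gimg _ hx) (fun k x hx => locMap_gimg _ hx)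
    (fun x hx l => gimg_smul x hx l) ?_ ?_ ?_ (hY J w hJ hw hT k) _ (hX J w hJ hw hT k)
  · rw [Finsupp.sub_apply, AddMonoidAlgebra.coeff_sub, Finsupp.sub_apply]
    exact this
  · intro x
    obtain ⟨m, rfl⟩ := Submodule.mkQ_surjective _ x
    change Y.ev {w} (f' (f m)) = _
    rw [S.comp]
    exact LinearMap.map_smul_of_tower (Y.ev {w}) c m
  · intro x
    obtain ⟨m, rfl⟩ := Submodule.mkQ_surjective _ x
    change X'.ev {w} (i' (i m)) = X'.ev {w} m
    rw [S.comp']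
  · intro x
    obtain ⟨m, rfl⟩ := Submodule.mkQ_surjective _ x
    change X.ev {w} (c⁻¹ • f (f' m) + i (i' m)) = X.ev {w} m
    rw [S.sum]

end Split

end

section

variable {B W : Type} [Group W] {M : CoxeterMatrix B} {cs : CoxeterSystem M W}

attribute [local instance] wOrder

open Obj

/-! ### The unit object is good -/

lemma hasQ_hcomp (k : ℤ) : HasQ (B := B) (fun k => LinearMap.range (hcomp (B := B) k)) k
    (if k = 0 then 1 else 0) := by
  split_ifs with h
  · subst h
    have h1 : lam (B := B) (fun k => LinearMap.range (hcomp (B := B) k)) 0 = ⊥ := by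
      rw [eq_bot_iff]
      refine Submodule.span_le.mpr ?_
      rintro _ ⟨l, _, ⟨p, rfl⟩, rfl⟩
      rw [hcomp_of_ne (by lia)]
      simp
    have h2 : LinearMap.range (hcomp (B := B) 0) = Submodule.span ℝ {1} := by
      ext p
      rw [Submodule.mem_span_singleton]
      constructor
      · rintro ⟨p, rfl⟩
        have := hcomp_two_mul (B := B) 0
        simp only [Nat.cast_zero, mul_zero] at this
        rw [this, MvPolynomial.homogeneousComponent_zero]
        exact ⟨_, by rw [MvPolynomial.smul_eq_C_mul, mul_one]⟩
      · rintro ⟨a, rfl⟩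
        refine ⟨a • 1, ?_⟩
        have := hcomp_C (B := B) 0 a
        rwa [if_pos rfl, ← mul_one (MvPolynomial.C a), ← MvPolynomial.smul_eq_C_mul] at this
    have h3 : (lam (B := B) (fun k => LinearMap.range (hcomp (B := B) k)) 0).submoduleOf
        (LinearMap.range (hcomp (B := B) 0)) = ⊥ := by
      rw [h1, Submodule.submoduleOf, Submodule.comap_bot, Submodule.ker_subtype]
    let e := Submodule.quotEquivOfEqBot _ h3
    have : Module.Finite ℝ (LinearMap.range (hcomp (B := B) 0)) := by rw [h2]; infer_instance
    refine ⟨Module.Finite.equiv e.symm, ?_⟩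
    rw [LinearEquiv.finrank_eq e, h2, finrank_span_singleton one_ne_zero, Nat.cast_one]
  · have h1 : LinearMap.range (hcomp (B := B) k) ≤
        lam (B := B) (fun k => LinearMap.range (hcomp (B := B) k)) k := by
      rintro _ ⟨p, rfl⟩
      induction p using MvPolynomial.induction_on with
      | C a => rw [hcomp_C, if_neg h]; exact Submodule.zero_mem _
      | add p q hp hq => rw [map_add]; exact Submodule.add_mem _ hp hq
      | mul_X p o _ =>
        have := hcomp_lin_mul (k - 2) (Finsupp.single o 1) p
        rw [sub_add_cancel, lin_single, mul_comm] at this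
        rw [this]
        exact Submodule.subset_span ⟨Finsupp.single o 1, _, ⟨p, rfl⟩, by rw [lin_single]; rfl⟩
    have h3 : (lam (B := B) (fun k => LinearMap.range (hcomp (B := B) k)) k).submoduleOf
        (LinearMap.range (hcomp (B := B) k)) = ⊤ := Submodule.comap_subtype_eq_top.mpr h1
    have : Subsingleton (LinearMap.range (hcomp (B := B) k) ⧸
        (lam (B := B) (fun k => LinearMap.range (hcomp (B := B) k)) k).submoduleOf
        (LinearMap.range (hcomp (B := B) k))) := Submodule.Quotient.subsingleton_iff.mpr h3
    exact ⟨inferInstance, by simp [finrank_zero_of_subsingleton]⟩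

lemma unit_sup_of_mem {J : Set W} (h : 1 ∈ J) : (unit cs).sup J = ⊤ :=
  eq_top_iff.mpr fun _ _ _ hj => absurd h hj

lemma unit_sup_of_notMem {J : Set W} (h : 1 ∉ J) : (unit cs).sup J = ⊥ := by
  rw [eq_bot_iff]
  exact fun m hm => hm () h

lemma good_unit : Good (unit cs) := by
  intro J w _ hw _
  by_cases h : w = 1
  · subst h
    have h1 : (unit cs).img {1} J = ⊤ := by
      rw [img, unit_sup_of_mem hw, Submodule.map_top, Submodule.range_mkQ]
    have h2 : (unit cs).sup {1}ᶜ = ⊥ := unit_sup_of_notMem (by simp)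
    have : Projective (Pol B) (unit cs).carrier := (inferInstance : Projective (Pol B) (Pol B))
    rw [h1]
    exact Projective.of_equiv
      ((Submodule.quotEquivOfEqBot _ h2).symm.trans Submodule.topEquiv.symm)
  · have h2 : (unit cs).sup {w}ᶜ = ⊤ := unit_sup_of_mem (by simpa using Ne.symm h)
    have : Subsingleton ((unit cs).loc {w}) := Submodule.Quotient.subsingleton_iff.mpr h2
    infer_instance

lemma char_unit : Char (unit cs) (Finsupp.single 1 1) := by
  intro J w _ hw _ k
  by_cases h : w = 1
  · subst h
    have h2 : (unit cs).sup {1}ᶜ = ⊥ := unit_sup_of_notMem (by simp)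
    have := hasQ_map (d := 0) (𝓖 := (unit cs).gr) (𝓗 := (unit cs).gimg {1} J)
      ((unit cs).ev {1}) ?_ ?_ ?_ (hasQ_hcomp k)
    · rw [Finsupp.single_eq_same, cs.length_one, Nat.cast_zero, ← T_zero, T]
      rw [add_zero] at this ⊢
      have h3 : (AddMonoidAlgebra.single (0 : ℤ) (1 : ℤ)).coeff k = if k = 0 then 1 else 0 := by
        rw [AddMonoidAlgebra.coeff_single, Finsupp.single_apply]; simp only [eq_comm]
      rw [h3]
      exact this
    · intro k
      rw [add_zero, gimg, unit_sup_of_mem hw, Submodule.restrictScalars_top, top_inf_eq]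
    · intro x _ h0
      have : x ∈ (unit cs).sup {1}ᶜ := ev_eq_zero.mp h0
      rw [h2] at this
      exact this
    · intro x hx l
      have := gr_smul (X := unit cs) (k := k - 2) hx l
      rw [sub_add_cancel] at this
      exact this
  · have h2 : (unit cs).sup {w}ᶜ = ⊤ := unit_sup_of_mem (by simpa using Ne.symm h)
    have h3 : Subsingleton ((unit cs).loc {w}) := Submodule.Quotient.subsingleton_iff.mpr h2
    have h4 : (unit cs).gimg {w} J = fun _ => ⊥ := funext fun k =>
      eq_bot_iff.mpr fun x _ => Subsingleton.elim _ _
    rw [h4, Finsupp.single_eq_of_ne h]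
    exact hasQ_bot k

end

section

variable {B W : Type} [Group W] {M : CoxeterMatrix B} {cs : CoxeterSystem M W}

attribute [local instance] wOrder

open Obj

/-! ### Purity -/

variable {X Y N : Obj cs}

/-- The span of the products of weights, acting from the left, with sections supported on `A`. -/
def Obj.lspan (X : Obj cs) (A : Set W) : Submodule ℝ X :=
  Submodule.span ℝ {m | ∃ l : Wt B, ∃ n ∈ X.sup A, m = X.act (lin l) n}

lemma exists_section {w : W} {A : Set W} (hp : Projective (Pol B) (X.img {w} A)) :
    ∃ t : X.sup A →+ X, (∀ n, t n ∈ X.sup A) ∧ (∀ n : X.sup A, X.ev {w} (t n) = X.ev {w} (n : X)) ∧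
      (∀ n : X.sup A, X.ev {w} (n : X) = 0 → t n = 0) ∧
      ∀ r (n : X.sup A), t ⟨X.act r n, act_mem_sup n.2 r⟩ = X.act r (t n) := by
  obtain ⟨s, hs⟩ := Module.projective_def'.mp hp
  have hl (e : X.img {w} A) : ∃ m ∈ X.sup A, X.ev {w} m = e := mem_img.mp e.2
  choose g hg1 hg2 using hl
  let T : (X.img {w} A →₀ Pol B) →+ X := Finsupp.liftAddHom fun e =>
    { toFun := fun r => X.act (wact cs w r) (g e)
      map_zero' := by simp
      map_add' := fun p q => by rw [map_add, X.act_add] }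
  have hTs (e : X.img {w} A) (r : Pol B) : T (Finsupp.single e r) = X.act (wact cs w r) (g e) := by
    simp [T]
  have hT1 (a : X.img {w} A →₀ Pol B) : T a ∈ X.sup A := by
    induction a using Finsupp.induction_linear with
    | zero => rw [map_zero]; exact Submodule.zero_mem _
    | add a b ha hb => rw [map_add]; exact Submodule.add_mem _ ha hb
    | single e r => rw [hTs]; exact act_mem_sup (hg1 e) _
  have hT2 (a : X.img {w} A →₀ Pol B) :
      X.ev {w} (T a) = (Finsupp.linearCombination (Pol B) id a : X.img {w} A) := by
    induction a using Finsupp.induction_linear with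
    | zero => simp
    | add a b ha hb => rw [map_add, map_add, map_add, ha, hb]; rfl
    | single e r =>
      rw [hTs, ev_act_single, hg2, wact_inv_wact, Finsupp.linearCombination_single]; rfl
  have hT3 (a : X.img {w} A →₀ Pol B) (r : Pol B) : T (r • a) = X.act (wact cs w r) (T a) := by
    induction a using Finsupp.induction_linear with
    | zero => simp
    | add a b ha hb => rw [smul_add, map_add, map_add, ha, hb, map_add]
    | single e p => rw [Finsupp.smul_single, hTs, hTs, smul_eq_mul, map_mul, X.act_mul]
  let q : X.sup A →ₗ[Pol B] X.img {w} A :=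
    (X.ev {w}).restrict fun n hn => ⟨n, hn, rfl⟩
  have hq (n : X.sup A) : (q n : X.loc {w}) = X.ev {w} (n : X) := rfl
  refine ⟨T.comp (s.comp q).toAddMonoidHom, fun n => hT1 _, fun n => ?_, fun n h0 => ?_,
    fun r n => ?_⟩
  · change X.ev {w} (T (s (q n))) = _
    rw [hT2]
    have := LinearMap.congr_fun hs (q n)
    rw [LinearMap.comp_apply, LinearMap.id_apply] at this
    rw [this, hq]
  · change T (s (q n)) = 0
    rw [show q n = 0 from Subtype.ext (by rw [hq, h0]; rfl), map_zero, map_zero]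
  · change T (s (q _)) = X.act r (T (s (q n)))
    have : q ⟨X.act r n, act_mem_sup n.2 r⟩ = wact cs w⁻¹ r • q n :=
      Subtype.ext (by rw [hq, ev_act_single]; rfl)
    rw [this, map_smul, hT3, wact_wact_inv]

lemma lspan_le_sup (A : Set W) : X.lspan A ≤ (X.sup A).restrictScalars ℝ := by
  refine Submodule.span_le.mpr ?_
  rintro _ ⟨l, n, hn, rfl⟩
  exact act_mem_sup hn _

lemma lspan_mono {A A' : Set W} (h : X.sup A ≤ X.sup A') : X.lspan A ≤ X.lspan A' := by
  refine Submodule.span_mono ?_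
  rintro _ ⟨l, n, hn, rfl⟩
  exact ⟨l, n, h hn, rfl⟩

section Peel

variable {P : Type} [LinearOrder P] {h : W → P}

/-- Peeling off the top label. -/
lemma lspan_peel (hh : IsHeight cs h) {w : W}
    (hp : Projective (Pol B) (X.img {w} {f | h f ≤ h w})) {u : X}
    (hu : u ∈ X.lspan {f | h f ≤ h w}) (h0 : X.ev {w} u = 0) : u ∈ X.lspan {f | h f < h w} := by
  obtain ⟨t, ht1, ht2, ht3, ht4⟩ := exists_section hp
  have key (u) (hu : u ∈ X.lspan {f | h f ≤ h w}) :
      ∃ hu' : u ∈ X.sup {f | h f ≤ h w}, u - t ⟨u, hu'⟩ ∈ X.lspan {f | h f < h w} := by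
    refine ⟨lspan_le_sup _ hu, ?_⟩
    induction hu using Submodule.span_induction with
    | mem u hu =>
      obtain ⟨l, n, hn, rfl⟩ := hu
      refine Submodule.subset_span ⟨l, n - t ⟨n, hn⟩, ?_, ?_⟩
      · have h1 := Submodule.sub_mem _ hn (ht1 ⟨n, hn⟩)
        have h2 : n - t ⟨n, hn⟩ ∈ X.sup {w}ᶜ := ev_eq.mp (ht2 ⟨n, hn⟩).symm
        refine sup_mono ?_ (mem_sup_inter h1 h2)
        rintro f ⟨hf, hf'⟩
        exact lt_of_le_of_ne hf fun he => hf' (hh.inj he)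
      · rw [map_sub, ← ht4 (lin l) ⟨n, hn⟩]
    | zero =>
      have : (⟨0, lspan_le_sup _ (Submodule.zero_mem _)⟩ : X.sup {f | h f ≤ h w}) = 0 := rfl
      rw [this, map_zero, sub_zero]
      exact Submodule.zero_mem _
    | add x y hx hy ihx ihy =>
      have hx' := lspan_le_sup _ hx
      have hy' := lspan_le_sup _ hy
      have : (⟨x + y, lspan_le_sup _ (Submodule.add_mem _ hx hy)⟩ : X.sup {f | h f ≤ h w}) =
        ⟨x, hx'⟩ + ⟨y, hy'⟩ := rfl
      rw [this, map_add, add_sub_add_comm]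
      exact Submodule.add_mem _ ihx ihy
    | smul a x hx ih =>
      have hx' := lspan_le_sup _ hx
      have : (⟨a • x, lspan_le_sup _ (Submodule.smul_mem _ a hx)⟩ : X.sup {f | h f ≤ h w}) =
        ⟨X.act (MvPolynomial.C a) x, act_mem_sup hx' _⟩ := Subtype.ext (X.act_C a x).symm
      rw [this, ht4 (MvPolynomial.C a) ⟨x, hx'⟩, X.act_C, ← smul_sub]
      exact Submodule.smul_mem _ _ ih
  obtain ⟨hu', h1⟩ := key u hu
  rwa [ht3 ⟨u, hu'⟩ h0, sub_zero] at h1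

lemma lspan_le (hh : IsHeight cs h) (hX : Good X) {y : W} {u : X}
    (hu : u ∈ X.lspan Set.univ) (hu' : u ∈ X.sup {f | h f ≤ h y}) :
    u ∈ X.lspan {f | h f ≤ h y} := by
  classical
  let L : Finset W := (Finset.univ.image X.lab).filter fun f => h y < h f
  have hL (j) (hj : h y < h (X.lab j)) : X.lab j ∈ L :=
    Finset.mem_filter.mpr ⟨Finset.mem_image_of_mem _ (Finset.mem_univ _), hj⟩
  have key : ∀ n, ∀ S ⊆ L, S.card = n → (∀ f ∈ S, ∀ g ∈ L, h g ≤ h f → g ∈ S) →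
      u ∈ X.lspan ({f | h f ≤ h y} ∪ S) → u ∈ X.lspan {f | h f ≤ h y} := by
    intro n
    induction n with
    | zero =>
      intro S _ hS _ h1
      rw [Finset.card_eq_zero.mp hS] at h1
      simpa using h1
    | succ n ih =>
      intro S hSL hS hlow h1
      obtain ⟨w, hw, hmax⟩ := S.exists_max_image h (Finset.card_pos.mp (by lia))
      have hyw : h y < h w := (Finset.mem_filter.mp (hSL hw)).2
      refine ih (S.erase w) ((S.erase_subset w).trans hSL) (by rw [Finset.card_erase_of_mem hw, hS]; rfl)
        (fun f hf g hg hgf => Finset.mem_erase.mpr ⟨?_, hlow f (Finset.mem_of_mem_erase hf) g hg hgf⟩)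
        (lspan_mono ?_ (lspan_peel hh (hX.height hh w) (lspan_mono (sup_mono ?_) h1) ?_))
      · rintro rfl
        exact Finset.ne_of_mem_erase hf
          (hh.inj (le_antisymm (hmax f (Finset.mem_of_mem_erase hf)) hgf))
      · refine sup_le_of_inter ?_
        rintro _ ⟨hf, j, rfl⟩
        by_cases hj : h (X.lab j) ≤ h y
        · exact Or.inl hj
        · refine Or.inr (Finset.mem_erase.mpr ⟨?_, hlow w hw _ (hL j (not_le.mp hj)) (le_of_lt hf)⟩)
          intro he
          rw [Set.mem_ofPred, he] at hf
          exact lt_irrefl _ hf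
      · rintro f (hf | hf)
        · exact le_trans hf hyw.le
        · exact hmax f hf
      · rw [ev_eq_zero]
        refine sup_mono ?_ hu'
        rintro f hf rfl
        exact not_lt.mpr hf hyw
  refine key _ L subset_rfl rfl (fun _ _ g hg _ => hg) (lspan_mono (sup_le_of_inter ?_) hu)
  rintro _ ⟨_, j, rfl⟩
  rcases le_or_gt (h (X.lab j)) (h y) with hj | hj
  · exact Or.inl hj
  · exact Or.inr (hL j hj)

/-- Vanishing of the graded pieces in small degrees. -/
lemma Char.gimg_eq_bot (hh : IsHeight cs h) {c : W →₀ ℤ[T;T⁻¹]} (hc : Char X c) {w : W} {n : ℤ}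
    (hn : ∀ j < n, (c w).coeff j = 0) {k : ℤ} (hk : k < n - cs.length w) :
    X.gimg {w} {f | h f ≤ h w} k = ⊥ := by
  obtain ⟨b, hb⟩ := X.bdd
  have key : ∀ j : ℕ, ∀ k < n - cs.length w, k < b + j → X.gimg {w} {f | h f ≤ h w} k = ⊥ := by
    intro j
    induction j with
    | zero =>
      intro k _ hk
      rw [eq_bot_iff]
      intro x hx
      obtain ⟨m, _, hm, rfl⟩ := mem_gimg.mp hx
      rw [mem_gr, hb k (by simpa using hk)] at hm
      rw [← hm, map_zero]
      exact Submodule.zero_mem _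
    | succ j ih =>
      intro k hk hk'
      have h1 := hc.height hh w k
      rw [hn _ (by lia)] at h1
      rw [eq_bot_iff]
      refine h1.eq_lam.trans (Submodule.span_le.mpr ?_)
      rintro _ ⟨l, g, hg, rfl⟩
      rw [ih (k - 2) (by lia) (by push_cast at hk'; lia)] at hg
      rw [(Submodule.mem_bot ℝ).mp hg, smul_zero]
      exact Submodule.zero_mem _
  exact key (k + 1 - b).toNat k hk (by lia)

/-- Sections of minimal degree with nonzero top value are nonzero modulo weights. -/
theorem purity (hh : IsHeight cs h) (hX : Good X) {c : W →₀ ℤ[T;T⁻¹]} (hc : Char X c) {y : W}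
    (hn : ∀ j < 0, (c y).coeff j = 0) {u : X} (hu : u ∈ X.sup {f | h f ≤ h y})
    (hg : u ∈ X.gr (-cs.length y)) (h0 : u ∈ X.lspan Set.univ) : X.ev {y} u = 0 := by
  have h1 := lspan_le hh hX h0 hu
  have h2 (v : X) (hv : v ∈ X.lspan {f | h f ≤ h y}) :
      X.ev {y} (X.pr (-cs.length y) v) = 0 := by
    induction hv using Submodule.span_induction with
    | mem u hu =>
      obtain ⟨l, n, hn', rfl⟩ := hu
      have h3 := X.pr_act (-cs.length y - 2) l n
      rw [sub_add_cancel] at h3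
      rw [h3, ev_act_single]
      have h4 : X.ev {y} (X.pr (-cs.length y - 2) n) ∈ X.gimg {y} {f | h f ≤ h y}
        (-cs.length y - 2) := mem_gimg.mpr ⟨_, pr_mem_sup hn' _, X.pr_mem _ _, rfl⟩
      rw [hc.gimg_eq_bot hh hn (by lia)] at h4
      rw [(Submodule.mem_bot ℝ).mp h4, smul_zero]
    | zero => simp
    | add x y _ _ hx hy => rw [map_add, map_add, hx, hy, add_zero]
    | smul a x _ hx =>
      rw [map_smul, LinearMap.map_smul_of_tower, hx, smul_zero]
  rw [← mem_gr.mp hg]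
  exact h2 u h1

end Peel

end

section

/-! ### Signatures of real symmetric bilinear forms -/

section Definite

variable {V : Type} [AddCommGroup V] [Module ℝ V]

lemma inner_pos_of_injective {D : Type} [NormedAddCommGroup D] [InnerProductSpace ℝ D]
    [FiniteDimensional ℝ D] {T : D →ₗ[ℝ] D} (hT : T.IsSymmetric)
    (h : ∀ ζ : ℝ, 0 ≤ ζ → ∀ x, T x + ζ • x = 0 → x = 0) {x : D} (hx : x ≠ 0) :
    0 < inner ℝ (T x) x := by
  have hpos (i : Fin (finrank ℝ D)) : 0 < hT.eigenvalues rfl i := by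
    by_contra! h1
    have h2 := hT.apply_eigenvectorBasis rfl i
    have h3 := h (-hT.eigenvalues rfl i) (by linarith) (hT.eigenvectorBasis rfl i)
      (by rw [h2]; simp)
    exact (hT.eigenvectorBasis rfl).orthonormal.ne_zero i h3
  have h1 : inner ℝ (T x) x = ∑ i, hT.eigenvalues rfl i * (inner ℝ (hT.eigenvectorBasis rfl i) x) ^ 2 := by
    rw [← (hT.eigenvectorBasis rfl).sum_inner_mul_inner]
    refine Finset.sum_congr rfl fun i _ => ?_
    rw [hT x, hT.apply_eigenvectorBasis rfl i, inner_smul_right, real_inner_comm x]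
    simp only [RCLike.ofReal_real_eq_id, id_eq]
    ring
  rw [h1]
  refine Finset.sum_pos' (fun i _ => mul_nonneg (hpos i).le (sq_nonneg _)) ?_
  by_contra! h2
  refine hx ?_
  rw [← (hT.eigenvectorBasis rfl).sum_repr' x]
  refine Finset.sum_eq_zero fun i hi => ?_
  have h3 := h2 i hi
  have h4 : inner ℝ (hT.eigenvectorBasis rfl i) x = 0 := by
    by_contra h5
    have := mul_pos (hpos i) (sq_pos_of_ne_zero h5)
    linarith
  rw [h4, zero_smul]

/-- If all forms `A + ζ P` with `0 ≤ ζ` are nondegenerate and `P` is positive definite, then `A` is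
positive definite. -/
theorem posDef_of_nondegenerate [FiniteDimensional ℝ V] {A P : V →ₗ[ℝ] V →ₗ[ℝ] ℝ}
    (hA : ∀ x y, A x y = A y x) (hP : ∀ x y, P x y = P y x) (hpos : ∀ x, x ≠ 0 → 0 < P x x)
    (h : ∀ ζ : ℝ, 0 ≤ ζ → ∀ x, (∀ y, A x y + ζ * P x y = 0) → x = 0) {x : V} (hx : x ≠ 0) :
    0 < A x x := by
  have hnn (x : V) : 0 ≤ P x x := by
    by_cases h0 : x = 0
    · simp [h0]
    · exact (hpos x h0).le
  let c : InnerProductSpace.Core ℝ V :=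
    { inner := fun x y => P x y
      conj_inner_symm := fun x y => hP y x
      re_inner_nonneg := fun x => hnn x
      add_left := fun x y z => by simp
      smul_left := fun x y r => by simp
      definite := fun x h0 => by
        by_contra h1
        have := hpos x h1
        change P x x = 0 at h0
        linarith }
  let : NormedAddCommGroup V := c.toNormedAddCommGroup
  let : InnerProductSpace ℝ V := InnerProductSpace.ofCore c.toCore
  have hin (x y : V) : inner ℝ x y = P x y := rfl
  have hinj : Function.Injective P := by
    rw [← LinearMap.ker_eq_bot, LinearMap.ker_eq_bot']
    intro x h0
    by_contra h1
    have := hpos x h1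
    rw [h0] at this
    simp at this
  let e : V ≃ₗ[ℝ] (V →ₗ[ℝ] ℝ) := LinearEquiv.ofInjectiveOfFinrankEq P hinj
    (Subspace.dual_finrank_eq (K := ℝ) (V := V)).symm
  have he (f : V →ₗ[ℝ] ℝ) : P (e.symm f) = f := e.apply_symm_apply f
  let T : V →ₗ[ℝ] V := e.symm.toLinearMap ∘ₗ A
  have hT (x y : V) : inner ℝ (T x) y = A x y := by
    rw [hin]
    exact LinearMap.congr_fun (he (A x)) y
  have hs : T.IsSymmetric := fun x y => by
    rw [hT, ← real_inner_comm, hT, hA]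
  rw [← hT]
  refine inner_pos_of_injective hs (fun ζ hζ x h0 => h ζ hζ x fun y => ?_) hx
  rw [← hT, ← hin, ← real_inner_smul_left, ← inner_add_left, h0, inner_zero_left]

/-- Semidefinite subspaces bound the positive index of a nondegenerate form from below. -/
theorem exists_posDef [FiniteDimensional ℝ V] {Q : V →ₗ[ℝ] V →ₗ[ℝ] ℝ}
    (hQ : ∀ x y, Q x y = Q y x) (hnd : ∀ x, (∀ y, Q x y = 0) → x = 0) {S : Submodule ℝ V}
    (hS : ∀ x ∈ S, 0 ≤ Q x x) :
    ∃ P : Submodule ℝ V, finrank ℝ S ≤ finrank ℝ P ∧ ∀ x ∈ P, x ≠ 0 → 0 < Q x x := by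
  classical
  obtain ⟨b, hb⟩ := LinearMap.BilinForm.exists_orthogonal_basis (B := Q) ⟨fun x y => hQ x y⟩
  have hb' (i j) (hij : i ≠ j) : Q (b i) (b j) = 0 := hb hij
  have hsum (x : V) : Q x x = ∑ i, (b.repr x i) ^ 2 * Q (b i) (b i) := by
    conv_lhs => rw [← b.sum_repr x]
    simp only [map_sum, map_smul, LinearMap.sum_apply, LinearMap.smul_apply, smul_eq_mul]
    refine Finset.sum_congr rfl fun i _ => ?_
    rw [Finset.sum_eq_single i]
    · ring
    · intro j _ hj
      simp [hb' _ _ hj]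
    · simp
  have hne (i) : Q (b i) (b i) ≠ 0 := by
    intro h0
    refine b.ne_zero i (hnd _ fun y => ?_)
    rw [← b.sum_repr y]
    simp only [map_sum, map_smul, smul_eq_mul]
    refine Finset.sum_eq_zero fun j _ => ?_
    by_cases hij : i = j
    · rw [← hij, h0, mul_zero]
    · rw [hb' _ _ hij, mul_zero]
  let I := {i // 0 < Q (b i) (b i)}
  let f : S →ₗ[ℝ] (I → ℝ) := LinearMap.pi fun i => b.coord i.1 ∘ₗ S.subtype
  have hf (x : S) (i : I) : f x i = b.repr x i.1 := rfl
  have hf1 : Function.Injective f := by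
    rw [← LinearMap.ker_eq_bot, LinearMap.ker_eq_bot']
    intro x h0
    have h1 (i) : (b.repr x i) ^ 2 * Q (b i) (b i) ≤ 0 := by
      by_cases hi : 0 < Q (b i) (b i)
      · have := congrFun h0 ⟨i, hi⟩
        rw [hf] at this
        simp [this]
      · exact mul_nonpos_of_nonneg_of_nonpos (sq_nonneg _) (not_lt.mp hi)
    have h2 := hS x x.2
    rw [hsum] at h2
    have h3 := (Finset.sum_eq_zero_iff_of_nonpos fun i _ => h1 i).mp
      (le_antisymm (Finset.sum_nonpos fun i _ => h1 i) h2)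
    refine Subtype.ext (b.ext_elem fun i => ?_)
    have := h3 i (Finset.mem_univ i)
    rw [mul_eq_zero, or_iff_left (hne i)] at this
    simpa using this
  have hli : LinearIndependent ℝ fun i : I => b i.1 := b.linearIndependent.comp _ Subtype.val_injective
  refine ⟨Submodule.span ℝ (Set.range fun i : I => b i.1), ?_, fun x hx hx0 => ?_⟩
  · rw [finrank_span_eq_card hli, ← finrank_fintype_fun_eq_card (R := ℝ)]
    exact LinearMap.finrank_le_finrank_of_injective hf1
  · have hz (i) (hi : ¬ 0 < Q (b i) (b i)) : b.repr x i = 0 := by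
      clear hx0
      induction hx using Submodule.span_induction with
      | mem x hx =>
        obtain ⟨k, rfl⟩ := hx
        rw [b.repr_self, Finsupp.single_apply, if_neg]
        rintro rfl
        exact hi k.2
      | zero => simp
      | add x y _ _ hx hy => rw [map_add, Finsupp.add_apply, hx, hy, add_zero]
      | smul a x _ hx => rw [map_smul, Finsupp.smul_apply, hx, smul_zero]
    rw [hsum]
    refine Finset.sum_pos' (fun i _ => ?_) ?_
    · by_cases hi : 0 < Q (b i) (b i)
      · exact mul_nonneg (sq_nonneg _) hi.le
      · simp [hz i hi]
    · by_contra! h1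
      refine hx0 (b.ext_elem fun i => ?_)
      rw [map_zero, Finsupp.zero_apply]
      by_contra h2
      by_cases hi : 0 < Q (b i) (b i)
      · have h3 := h1 i (Finset.mem_univ i)
        have := mul_pos (sq_pos_of_ne_zero h2) hi
        linarith
      · exact h2 (hz i hi)

variable {U₁ U₂ : Type} [AddCommGroup U₁] [Module ℝ U₁] [AddCommGroup U₂] [Module ℝ U₂]

/-- Existence of large semidefinite subspaces. -/
theorem exists_semidefinite [FiniteDimensional ℝ V] [FiniteDimensional ℝ U₁]
    [FiniteDimensional ℝ U₂] {Q : V →ₗ[ℝ] V →ₗ[ℝ] ℝ} {P : U₂ →ₗ[ℝ] U₂ →ₗ[ℝ] ℝ}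
    (hQ : ∀ x y, Q x y = Q y x) (hP : ∀ x y, P x y = P y x) (j : U₁ →ₗ[ℝ] V) (q : V →ₗ[ℝ] U₂)
    (r : U₁ →ₗ[ℝ] U₂) (hj : Function.Injective j) (hq : Function.Surjective q)
    (hqj : ∀ v, q v = 0 ↔ ∃ u, j u = v) (hPQ : ∀ u v, Q v (j u) = P (q v) (r u))
    (hr : ∀ u, (∀ u', P (r u') (r u) = 0) → u = 0)
    (hpos : ∀ x, (∀ u, P x (r u) = 0) → x ≠ 0 → 0 < P x x)
    (hnd : ∀ ζ : ℝ, 0 ≤ ζ → ∀ x, (∀ y, Q x y + ζ * P (q x) (q y) = 0) → x = 0) :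
    ∃ S : Submodule ℝ V, finrank ℝ U₂ ≤ finrank ℝ S ∧
      ∀ x ∈ S, 0 ≤ Q x x ∧ (Q x x = 0 → ∃ u, j u = x) := by
  have hqj0 (u) : q (j u) = 0 := (hqj _).mpr ⟨u, rfl⟩
  let T : Submodule ℝ V := (LinearMap.range r).comap q
  let D : Submodule ℝ V := (LinearMap.ker (T.subtype.dualMap ∘ₗ Q))
  have hD {v : V} : v ∈ D ↔ ∀ t, q t ∈ LinearMap.range r → Q v t = 0 := by
    refine ⟨fun h t ht => LinearMap.congr_fun (f := (T.subtype.dualMap ∘ₗ Q) v) h ⟨t, ht⟩,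
      fun h => ?_⟩
    exact LinearMap.ext fun t => h t.1 t.2
  have hD1 {v : V} (hv : v ∈ D) (u) : P (q v) (r u) = 0 := by
    rw [← hPQ, hD.mp hv]
    rw [hqj0]; exact Submodule.zero_mem _
  have hD2 {v : V} (hv : v ∈ D) (h0 : q v = 0) : v = 0 := by
    obtain ⟨u, rfl⟩ := (hqj v).mp h0
    rw [hr u fun u' => ?_, map_zero]
    obtain ⟨t, ht⟩ := hq (r u')
    rw [← ht, ← hPQ, hQ]
    exact hD.mp hv t ⟨u', ht.symm⟩
  have hdisj : Disjoint T D := by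
    rw [Submodule.disjoint_def]
    rintro v ⟨u, hu⟩ hv
    refine hD2 hv ?_
    rw [← hu, hr u fun u' => ?_, map_zero]
    rw [hP, hu, hD1 hv]
  have hdim : finrank ℝ V ≤ finrank ℝ T + finrank ℝ D := by
    have h1 : finrank ℝ (LinearMap.range (T.subtype.dualMap ∘ₗ Q)) + finrank ℝ D = finrank ℝ V :=
      LinearMap.finrank_range_add_finrank_ker _
    have h2 := (Submodule.finrank_le (LinearMap.range (T.subtype.dualMap ∘ₗ Q))).trans_eq
      (Subspace.dual_finrank_eq (K := ℝ) (V := T))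
    lia
  have htop : T ⊔ D = ⊤ := by
    refine Submodule.eq_top_of_finrank_eq (le_antisymm (Submodule.finrank_le _) ?_)
    have := Submodule.finrank_sup_add_finrank_inf_eq T D
    rw [hdisj.eq_bot, finrank_bot] at this
    lia
  have hDpos (x : D) (hx : x ≠ 0) : 0 < P (q x) (q x) :=
    hpos _ (hD1 x.2) fun h0 => hx (Subtype.ext (hD2 x.2 h0))
  have hQD (x : V) (hx : x ∈ D) (hx0 : x ≠ 0) : 0 < Q x x := by
    have := posDef_of_nondegenerate (A := Q.domRestrict₁₂ D D)
      (P := (P.compl₁₂ q q).domRestrict₁₂ D D) (fun x y => hQ _ _) (fun x y => hP _ _) hDpos ?_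
      (x := ⟨x, hx⟩) (fun h => hx0 (congrArg Subtype.val h))
    · exact this
    · intro ζ hζ x h0
      refine Subtype.ext (hnd ζ hζ x fun y => ?_)
      have hy : y ∈ T ⊔ D := htop ▸ Submodule.mem_top
      obtain ⟨t, ht, d, hd, rfl⟩ := Submodule.mem_sup.mp hy
      have h1 : Q x t = 0 := hD.mp x.2 t ht
      obtain ⟨u, hu⟩ := ht
      have h2 : P (q x) (q t) = 0 := by rw [← hu, hD1 x.2]
      have h3 : Q x d + ζ * P (q x) (q d) = 0 := h0 ⟨d, hd⟩
      rw [map_add, map_add, map_add, h1, h2]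
      linarith
  have hKD : Disjoint (LinearMap.range j) D := by
    rw [Submodule.disjoint_def]
    rintro _ ⟨u, rfl⟩ hv
    exact hD2 hv (hqj0 u)
  have hK0 (u u') : Q (j u) (j u') = 0 := by
    rw [hPQ, hqj0, map_zero, LinearMap.zero_apply]
  refine ⟨LinearMap.range j ⊔ D, ?_, fun x hx => ?_⟩
  · have h1 := Submodule.finrank_sup_add_finrank_inf_eq (LinearMap.range j) D
    rw [hKD.eq_bot, finrank_bot, LinearMap.finrank_range_of_inj hj] at h1
    have h2 := LinearMap.finrank_range_add_finrank_ker q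
    rw [LinearMap.range_eq_top.mpr hq, finrank_top] at h2
    have h3 : LinearMap.ker q = LinearMap.range j := by
      ext v; exact hqj v
    rw [h3, LinearMap.finrank_range_of_inj hj] at h2
    have h4 := LinearMap.finrank_range_add_finrank_ker (q ∘ₗ T.subtype)
    have h5 : finrank ℝ (LinearMap.range (q ∘ₗ T.subtype)) ≤ finrank ℝ U₁ := by
      refine (Submodule.finrank_mono ?_).trans (LinearMap.finrank_range_le r)
      rintro _ ⟨t, rfl⟩
      exact t.2
    have h6 : finrank ℝ (LinearMap.ker (q ∘ₗ T.subtype)) ≤ finrank ℝ U₁ := by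
      have : (LinearMap.ker (q ∘ₗ T.subtype)).map T.subtype ≤ LinearMap.range j := by
        rintro _ ⟨t, ht, rfl⟩
        exact (hqj _).mp ht
      have := Submodule.finrank_mono this
      rwa [LinearMap.finrank_range_of_inj hj, Submodule.finrank_map_subtype_eq] at this
    lia
  · obtain ⟨_, ⟨u, rfl⟩, d, hd, rfl⟩ := Submodule.mem_sup.mp hx
    have h1 : Q d (j u) = 0 := by rw [hPQ, hD1 hd]
    have h2 : Q (j u + d) (j u + d) = Q d d := by
      simp only [map_add, LinearMap.add_apply, hK0, h1, hQ (j u) d]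
      ring
    rw [h2]
    by_cases hd0 : d = 0
    · rw [hd0]; simp
    · have := hQD d hd hd0
      exact ⟨this.le, fun h => absurd h this.ne'⟩

end Definite

end

section

/-! ### The Hodge–Riemann bilinear relations -/

/-- The sign pattern of the Hodge–Riemann relations. -/
def theta (n : ℤ) : ℝ := if n % 4 < 2 then 1 else -1

lemma theta_add_two (n : ℤ) : theta (n + 2) = -theta n := by
  unfold theta
  split_ifs <;> first | (exfalso; omega) | norm_num

lemma theta_mul_self (n : ℤ) : theta n * theta n = 1 := by
  unfold theta
  split_ifs <;> norm_num

section Graded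

variable {V U : Type} [AddCommGroup V] [Module ℝ V] [AddCommGroup U] [Module ℝ U]

/-- The Hodge–Riemann bilinear relations. -/
def HR (gr : ℤ → Submodule ℝ V) (form : V →ₗ[ℝ] V →ₗ[ℝ] ℝ) (L : End ℝ V) (n : ℤ) : Prop :=
  ∀ k : ℕ, ∀ v ∈ gr (-k), (L ^ (k + 1)) v = 0 → v ≠ 0 → 0 < theta (n - k) * form v ((L ^ k) v)

/-- Hard Lefschetz (injectivity). -/
def HL (gr : ℤ → Submodule ℝ V) (L : End ℝ V) : Prop :=
  ∀ k : ℕ, ∀ v ∈ gr (-k), (L ^ k) v = 0 → v = 0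

lemma HR.hl {gr : ℤ → Submodule ℝ V} {form : V →ₗ[ℝ] V →ₗ[ℝ] ℝ} {L : End ℝ V} {n : ℤ}
    (h : HR gr form L n) : HL gr L := by
  intro k v hv h0
  by_contra h1
  have := h k v hv (by rw [pow_succ', Module.End.mul_apply, h0, map_zero]) h1
  rw [h0, map_zero, mul_zero] at this
  exact lt_irrefl _ this

/-- Graded vector spaces with a symmetric form and a Lefschetz operator. -/
structure IsLef (gr : ℤ → Submodule ℝ V) (form : V →ₗ[ℝ] V →ₗ[ℝ] ℝ) (L : End ℝ V) : Prop where
  fin : FiniteDimensional ℝ V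
  symm : ∀ v w, form v w = form w v
  nondeg : ∀ k, ∀ v ∈ gr k, (∀ w ∈ gr (-k), form v w = 0) → v = 0
  deg : ∀ k, ∀ v ∈ gr k, L v ∈ gr (k + 2)
  adj : ∀ v w, form (L v) w = form v (L w)

namespace IsLef

variable {gr : ℤ → Submodule ℝ V} {form : V →ₗ[ℝ] V →ₗ[ℝ] ℝ} {L : End ℝ V}

lemma deg_pow (h : IsLef gr form L) {k : ℤ} {v : V} (hv : v ∈ gr k) (i : ℕ) :
    (L ^ i) v ∈ gr (k + 2 * i) := by
  induction i with
  | zero => simpa using hv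
  | succ i ih =>
    rw [pow_succ', Module.End.mul_apply]
    have := h.deg _ _ ih
    convert this using 2
    push_cast; ring

lemma adj_pow (h : IsLef gr form L) (i : ℕ) (v w : V) : form ((L ^ i) v) w = form v ((L ^ i) w) := by
  induction i generalizing v with
  | zero => rfl
  | succ i ih => rw [pow_succ, Module.End.mul_apply, ih, h.adj, ← Module.End.mul_apply, ← pow_succ', pow_succ]

end IsLef

/-- The formal properties of the passage from `X` to `B_s X`. -/
structure IsLefExt (grU : ℤ → Submodule ℝ U) (formU : U →ₗ[ℝ] U →ₗ[ℝ] ℝ) (R : End ℝ U)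
    (grV : ℤ → Submodule ℝ V) (formV : V →ₗ[ℝ] V →ₗ[ℝ] ℝ) (L : End ℝ V)
    (j : U →ₗ[ℝ] V) (q : V →ₗ[ℝ] U) : Prop where
  source : IsLef grU formU R
  target : IsLef grV formV L
  j_deg : ∀ k, ∀ u ∈ grU k, j u ∈ grV (k + 1)
  q_deg : ∀ k, ∀ v ∈ grV k, q v ∈ grU (k + 1)
  q_L : ∀ v, q (L v) = R (q v)
  j_R : ∀ u, j (R u) = L (j u)
  form_j : ∀ u v, formV (j u) v = formU u (q v)
  q_j : ∀ u, q (j u) = 0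
  j_inj : ∀ k, ∀ u ∈ grU k, j u = 0 → u = 0
  ker_q : ∀ k, ∀ v ∈ grV k, q v = 0 → ∃ u ∈ grU (k - 1), j u = v
  q_surj : ∀ k, ∀ u ∈ grU k, ∃ v ∈ grV (k - 1), q v = u

namespace IsLefExt

variable {grU : ℤ → Submodule ℝ U} {formU : U →ₗ[ℝ] U →ₗ[ℝ] ℝ} {R : End ℝ U}
    {grV : ℤ → Submodule ℝ V} {formV : V →ₗ[ℝ] V →ₗ[ℝ] ℝ} {L : End ℝ V}
    {j : U →ₗ[ℝ] V} {q : V →ₗ[ℝ] U}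

lemma q_L_pow (h : IsLefExt grU formU R grV formV L j q) (i : ℕ) (v : V) :
    q ((L ^ i) v) = (R ^ i) (q v) := by
  induction i with
  | zero => rfl
  | succ i ih => rw [pow_succ', pow_succ', Module.End.mul_apply, h.q_L, ih, Module.End.mul_apply]

lemma j_R_pow (h : IsLefExt grU formU R grV formV L j q) (i : ℕ) (u : U) :
    j ((R ^ i) u) = (L ^ i) (j u) := by
  induction i with
  | zero => rfl
  | succ i ih => rw [pow_succ', pow_succ', Module.End.mul_apply, h.j_R, ih, Module.End.mul_apply]

lemma deform (h : IsLefExt grU formU R grV formV L j q) (ζ : ℝ) :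
    IsLefExt grU formU R grV formV (L + ζ • j ∘ₗ q) j q :=
  { h with
    target :=
      { h.target with
        deg := fun k v hv => by
          refine Submodule.add_mem _ (h.target.deg k v hv) (Submodule.smul_mem _ _ ?_)
          have := h.j_deg _ _ (h.q_deg k v hv)
          rwa [add_assoc] at this
        adj := fun v w => by
          simp only [LinearMap.add_apply, LinearMap.smul_apply, LinearMap.comp_apply, map_add,
            map_smul, h.target.adj, h.form_j]
          rw [h.target.symm v (j _), h.form_j, h.source.symm (q w)] }
    q_L := fun v => by simp [h.q_L, h.q_j]
    j_R := fun v => by simp [h.j_R, h.q_j] }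

lemma deform_pow (h : IsLefExt grU formU R grV formV L j q) (ζ : ℝ) (m : ℕ) (v : V) :
    ((L + ζ • j ∘ₗ q) ^ (m + 1)) v = (L ^ (m + 1)) v + ((m + 1) * ζ) • j ((R ^ m) (q v)) := by
  induction m with
  | zero => simp
  | succ m ih =>
    rw [pow_succ', Module.End.mul_apply, ih]
    simp only [LinearMap.add_apply, LinearMap.smul_apply, LinearMap.comp_apply, map_add, map_smul,
      h.q_j, h.q_L_pow, ← h.j_R, smul_zero, map_zero, add_zero]
    rw [pow_succ' L (m + 1), pow_succ' R m, Module.End.mul_apply, Module.End.mul_apply]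
    push_cast
    module

/-- The primitive form of degree `k`. -/
def pform (gr : ℤ → Submodule ℝ V) (form : V →ₗ[ℝ] V →ₗ[ℝ] ℝ) (L : End ℝ V) (a : ℝ)
    (k : ℕ) (d : ℤ) : gr d →ₗ[ℝ] gr d →ₗ[ℝ] ℝ :=
  a • form.compl₁₂ (gr d).subtype ((L ^ k) ∘ₗ (gr d).subtype)

lemma pform_apply (gr : ℤ → Submodule ℝ V) (form : V →ₗ[ℝ] V →ₗ[ℝ] ℝ) (L : End ℝ V)
    (a : ℝ) (k : ℕ) (d : ℤ) (v w : gr d) :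
    pform gr form L a k d v w = a * form v ((L ^ k) (w : V)) := rfl

lemma pform_symm {gr : ℤ → Submodule ℝ V} {form : V →ₗ[ℝ] V →ₗ[ℝ] ℝ} {L : End ℝ V}
    (h : IsLef gr form L) (a : ℝ) (k : ℕ) (d : ℤ) (v w : gr d) :
    pform gr form L a k d v w = pform gr form L a k d w v := by
  rw [pform_apply, pform_apply, ← h.adj_pow, h.symm]

theorem exists_semidefinite (h : IsLefExt grU formU R grV formV L j q) {n : ℤ}
    (hR : HR grU formU R n) (hL : ∀ ζ : ℝ, 0 ≤ ζ → HL grV (L + ζ • j ∘ₗ q)) (k : ℕ) :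
    ∃ S : Submodule ℝ (grV (-k)), finrank ℝ (grU (-k + 1)) ≤ finrank ℝ S ∧
      ∀ x ∈ S, 0 ≤ theta (n + 1 - k) * formV x ((L ^ k) (x : V)) ∧
        (theta (n + 1 - k) * formV x ((L ^ k) (x : V)) = 0 → ∃ u ∈ grU (-k - 1), j u = x) := by
  have := h.source.fin
  have := h.target.fin
  have ht (m : ℤ) : theta m ≠ 0 := fun h0 => by simpa [h0] using theta_mul_self m
  rcases k with _ | m
  · let j' : grU (-(0 : ℕ) - 1) →ₗ[ℝ] grV (-(0 : ℕ)) := j.restrict fun u hu => by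
      have := h.j_deg _ u hu
      rwa [sub_add_cancel] at this
    have hj' (u) : (j' u : V) = j u := rfl
    have hj : Function.Injective j' := by
      rw [← LinearMap.ker_eq_bot, LinearMap.ker_eq_bot']
      exact fun u he => Subtype.ext (h.j_inj _ u u.2 (congrArg Subtype.val he))
    refine ⟨LinearMap.range j', ?_, ?_⟩
    · rw [LinearMap.finrank_range_of_inj hj]
      let f : grU (-(0 : ℕ) + 1) →ₗ[ℝ] Dual ℝ (grU (-(0 : ℕ) - 1)) :=
        formU.compl₁₂ (Submodule.subtype _) (Submodule.subtype _)
      have hf : Function.Injective f := by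
        rw [← LinearMap.ker_eq_bot, LinearMap.ker_eq_bot']
        intro x h0
        refine Subtype.ext (h.source.nondeg _ _ x.2 fun w hw => ?_)
        have hw' : w ∈ grU (-(0 : ℕ) - 1) := by
          convert hw using 2
          simp
        exact LinearMap.congr_fun h0 ⟨w, hw'⟩
      exact (LinearMap.finrank_le_finrank_of_injective hf).trans_eq Subspace.dual_finrank_eq
    · rintro _ ⟨u, rfl⟩
      have h0 : formV (j' u) ((L ^ 0) (j' u : V)) = 0 := by
        rw [hj', pow_zero, Module.End.one_apply, h.form_j, h.q_j, map_zero]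
      rw [h0, mul_zero]
      exact ⟨le_rfl, fun _ => ⟨u, u.2, rfl⟩⟩
  · have e1 : (-(m + 1 : ℕ) : ℤ) + 1 = -m := by push_cast; ring
    have e2 : (-(m + 1 : ℕ) : ℤ) - 1 = -(m + 2 : ℕ) := by push_cast; ring
    have e3 : n + 1 - (m + 1 : ℕ) = n - m := by push_cast; ring
    rw [e1, e2, e3]
    let j' : grU (-(m + 2 : ℕ)) →ₗ[ℝ] grV (-(m + 1 : ℕ)) := j.restrict fun u hu => by
      have := h.j_deg _ u hu
      rwa [← e2, sub_add_cancel] at this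
    have hj' (u) : (j' u : V) = j u := rfl
    have hj : Function.Injective j' := by
      rw [← LinearMap.ker_eq_bot, LinearMap.ker_eq_bot']
      exact fun u he => Subtype.ext (h.j_inj _ u u.2 (congrArg Subtype.val he))
    let q' : grV (-(m + 1 : ℕ)) →ₗ[ℝ] grU (-m) := q.restrict fun v hv => by
      have := h.q_deg _ v hv
      rwa [e1] at this
    let r' : grU (-(m + 2 : ℕ)) →ₗ[ℝ] grU (-m) := R.restrict fun v hv => by
      have := h.source.deg _ v hv
      rwa [show (-(m + 2 : ℕ) : ℤ) + 2 = -m by push_cast; ring] at this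
    have hq' (v) : (q' v : U) = q v := rfl
    have hr' (v) : (r' v : U) = R v := rfl
    have hnd (x : grU (-m)) (hx : ∀ u : grU (-(m + 2 : ℕ)), formU x ((R ^ (m + 1)) (u : U)) = 0) :
        (R ^ (m + 1)) (x : U) = 0 := by
      refine h.source.nondeg _ _ (h.source.deg_pow x.2 (m + 1)) fun w hw => ?_
      rw [show -(-(m : ℤ) + 2 * (m + 1 : ℕ)) = -(m + 2 : ℕ) by push_cast; ring] at hw
      rw [h.source.adj_pow]
      exact hx ⟨w, hw⟩
    obtain ⟨S, hS1, hS2⟩ := KL.exists_semidefinite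
      (Q := pform grV formV L (theta (n - m)) (m + 1) (-(m + 1 : ℕ)))
      (P := pform grU formU R (theta (n - m)) m (-m))
      (pform_symm h.target _ _ _) (pform_symm h.source _ _ _) j' q' r' hj
      (fun u => by
        obtain ⟨v, hv, hv'⟩ := h.q_surj _ u.1 u.2
        rw [show -(m : ℤ) - 1 = -(m + 1 : ℕ) by push_cast; ring] at hv
        exact ⟨⟨v, hv⟩, Subtype.ext hv'⟩)
      (fun v => by
        constructor
        · intro h0
          obtain ⟨u, hu, hu'⟩ := h.ker_q _ v.1 v.2 (congrArg Subtype.val h0)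
          rw [e2] at hu
          exact ⟨⟨u, hu⟩, Subtype.ext ((hj' _).trans hu')⟩
        · rintro ⟨u, rfl⟩
          refine Subtype.ext ?_
          rw [hq', hj', h.q_j]; rfl)
      (fun u v => by
        rw [pform_apply, pform_apply, hj', hr', hq', ← h.j_R_pow, h.target.symm, h.form_j,
          h.source.symm, pow_succ, Module.End.mul_apply])
      (fun u hu => by
        have h1 := hnd (r' u) fun u' => by
          have := hu u'
          rw [pform_symm h.source, pform_apply, mul_eq_zero, or_iff_right (ht _), hr' u', 
            ← Module.End.mul_apply, ← pow_succ] at this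
          exact this
        rw [hr', ← Module.End.mul_apply, ← pow_succ] at h1
        exact Subtype.ext (hR.hl _ _ u.2 h1))
      (fun x hx hx0 => by
        have h1 := hnd x fun u => by
          have := hx u
          rw [pform_apply, mul_eq_zero, or_iff_right (ht _), hr', ← Module.End.mul_apply,
            ← pow_succ] at this
          exact this
        exact hR m x x.2 h1 fun h0 => hx0 (Subtype.ext h0))
      (fun ζ hζ x hx => by
        refine Subtype.ext (hL (ζ / (m + 1)) (by positivity) (m + 1) x x.2 ?_)
        have ht' := (h.deform (ζ / (m + 1))).target
        refine ht'.nondeg _ _ (ht'.deg_pow x.2 _) fun w hw => ?_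
        rw [show -(-((m + 1 : ℕ) : ℤ) + 2 * (m + 1 : ℕ)) = -(m + 1 : ℕ) by push_cast; ring] at hw
        have h1 := hx ⟨w, hw⟩
        rw [pform_apply, pform_apply, hq', hq'] at h1
        rw [h.deform_pow, map_add, LinearMap.add_apply, h.target.adj_pow, map_smul,
          LinearMap.smul_apply, h.form_j, h.source.adj_pow]
        have h2 : ((m : ℝ) + 1) * (ζ / (m + 1)) = ζ := by field_simp
        rw [h2]
        have h3 : theta (n - m) * (formV x ((L ^ (m + 1)) w) + ζ * formU (q x) ((R ^ m) (q w))) = 0 := by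
          linear_combination h1
        exact (mul_eq_zero.mp h3).resolve_left (ht _))
    refine ⟨S, hS1, fun x hx => ⟨(hS2 x hx).1, fun h0 => ?_⟩⟩
    obtain ⟨u, hu⟩ := (hS2 x hx).2 h0
    exact ⟨u, u.2, by rw [← hu, hj']⟩

/-- The Hodge–Riemann relations for `B_s X` follow from those for `X` and hard Lefschetz. -/
theorem hr (h : IsLefExt grU formU R grV formV L j q) {n : ℤ}
    (hR : HR grU formU R n) (hL : ∀ ζ : ℝ, 0 ≤ ζ → HL grV (L + ζ • j ∘ₗ q)) :
    HR grV formV L (n + 1) := by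
  have := h.source.fin
  have := h.target.fin
  have hL0 : HL grV L := by simpa using hL 0 le_rfl
  have ht (m : ℤ) : theta m ≠ 0 := fun h0 => by simpa [h0] using theta_mul_self m
  intro k v hv hv1 hv0
  by_contra! hneg
  obtain ⟨S, hS1, hS2⟩ := h.exists_semidefinite hR hL k
  obtain ⟨S', hS1', hS2'⟩ := h.exists_semidefinite hR hL (k + 2)
  obtain ⟨P, hP1, hP2⟩ := exists_posDef
    (Q := pform grV formV L (theta (n + 1 - (k + 2 : ℕ))) (k + 2) (-(k + 2 : ℕ)))
    (pform_symm h.target _ _ _) (fun x hx => by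
      refine Subtype.ext (hL0 _ _ x.2 ?_)
      refine h.target.nondeg _ _ (h.target.deg_pow x.2 _) fun w hw => ?_
      rw [show -(-((k + 2 : ℕ) : ℤ) + 2 * (k + 2 : ℕ)) = -(k + 2 : ℕ) by push_cast; ring] at hw
      have := hx ⟨w, hw⟩
      rw [pform_apply, mul_eq_zero, or_iff_right (ht _)] at this
      rwa [h.target.adj_pow]) (S := S') fun x hx => (hS2' x hx).1
  have hth : theta (n + 1 - (k + 2 : ℕ)) = -theta (n + 1 - k) := by
    have := theta_add_two (n + 1 - (k + 2 : ℕ))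
    rw [show n + 1 - ((k + 2 : ℕ) : ℤ) + 2 = n + 1 - k by push_cast; ring] at this
    rw [this, neg_neg]
  let l : grV (-(k + 2 : ℕ)) →ₗ[ℝ] grV (-k) := L.restrict fun v hv => by
    have := h.target.deg _ v hv
    rwa [show (-(k + 2 : ℕ) : ℤ) + 2 = -k by push_cast; ring] at this
  have hl (x) : (l x : V) = L x := rfl
  have hlinj : Function.Injective l := by
    rw [← LinearMap.ker_eq_bot, LinearMap.ker_eq_bot']
    intro x h0
    refine Subtype.ext (hL0 _ _ x.2 ?_)
    rw [pow_succ, Module.End.mul_apply, ← hl, h0]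
    simp
  let v' : grV (-k) := ⟨v, hv⟩
  have hperp (x) : formV v ((L ^ k) (l x : V)) = 0 := by
    rw [hl, ← Module.End.mul_apply, ← pow_succ, ← h.target.adj_pow, hv1, map_zero,
      LinearMap.zero_apply]
  have hneg' (x) (hx : x ∈ P) (hx0 : x ≠ 0) :
      theta (n + 1 - k) * formV (l x) ((L ^ k) (l x : V)) < 0 := by
    have h1 := hP2 x hx hx0
    rw [pform_apply, hth, pow_succ', Module.End.mul_apply, ← h.target.adj, pow_succ,
      Module.End.mul_apply, ← hl] at h1
    linarith
  have hvl : v' ∉ P.map l := by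
    rintro ⟨x, _, hx⟩
    have h1 : L x = v := congrArg Subtype.val hx
    rw [← h1, ← Module.End.mul_apply, ← pow_succ] at hv1
    rw [← h1, hL0 _ _ x.2 hv1, map_zero] at hv0
    exact hv0 rfl
  have hdis : Disjoint (P.map l) (Submodule.span ℝ {v'}) := by
    rw [Submodule.disjoint_span_singleton]
    exact fun hm => absurd hm hvl
  have hd1 : finrank ℝ (P.map l) = finrank ℝ P :=
    (LinearEquiv.finrank_eq (Submodule.equivMapOfInjective l hlinj P)).symm
  have hd2 := Submodule.finrank_sup_add_finrank_inf_eq (P.map l) (Submodule.span ℝ {v'})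
  rw [hdis.eq_bot, finrank_bot, hd1, finrank_span_singleton (by
    exact fun h0 => hv0 (congrArg Subtype.val h0))] at hd2
  have hdV : finrank ℝ (grV (-k)) ≤ finrank ℝ (grU (-k - 1)) + finrank ℝ (grU (-k + 1)) := by
    let q' : grV (-k) →ₗ[ℝ] grU (-k + 1) := q.restrict fun v hv => h.q_deg _ v hv
    let j' : grU (-k - 1) →ₗ[ℝ] grV (-k) := j.restrict fun u hu => by
      have := h.j_deg _ u hu
      rwa [sub_add_cancel] at this
    have h1 := LinearMap.finrank_range_add_finrank_ker q'
    have h2 : LinearMap.ker q' ≤ LinearMap.range j' := by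
      intro x hx
      obtain ⟨u, hu, hu'⟩ := h.ker_q _ x.1 x.2 (congrArg Subtype.val hx)
      exact ⟨⟨u, hu⟩, Subtype.ext hu'⟩
    have h3 := (Submodule.finrank_mono h2).trans (LinearMap.finrank_range_le j')
    have h4 := Submodule.finrank_le (LinearMap.range q')
    lia
  have e : (-(k + 2 : ℕ) : ℤ) + 1 = -k - 1 := by push_cast; ring
  rw [e] at hS1'
  have hmeet : ¬ Disjoint (P.map l ⊔ Submodule.span ℝ {v'}) S := by
    intro hd
    have h1 := Submodule.finrank_sup_add_finrank_inf_eq (P.map l ⊔ Submodule.span ℝ {v'}) S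
    rw [hd.eq_bot, finrank_bot] at h1
    have h2 := Submodule.finrank_le ((P.map l ⊔ Submodule.span ℝ {v'}) ⊔ S)
    linarith
  refine hmeet (Submodule.disjoint_def.mpr fun y hy hyS => ?_)
  obtain ⟨_, ⟨x, hx, rfl⟩, z, hz, rfl⟩ := Submodule.mem_sup.mp hy
  obtain ⟨c, rfl⟩ := Submodule.mem_span_singleton.mp hz
  obtain ⟨h1, h2⟩ := hS2 _ hyS
  have h3 : formV (l x + c • v' : grV (-k)) ((L ^ k) (l x + c • v' : grV (-k))) =
      formV (l x) ((L ^ k) (l x : V)) + c ^ 2 * formV v ((L ^ k) v) := by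
    have h4 : formV (l x) ((L ^ k) v) = 0 := by
      rw [← h.target.adj_pow, h.target.symm, hperp]
    have h5 : ((l x + c • v' : grV (-k)) : V) = l x + c • v := rfl
    rw [h5]
    simp only [map_add, map_smul, LinearMap.add_apply, LinearMap.smul_apply, smul_eq_mul, hperp, h4]
    ring
  rw [h3] at h1 h2
  have hx0 : x = 0 := by
    by_contra hx0
    have h4 := hneg' x hx hx0
    have h5 := mul_nonneg (sq_nonneg c) (neg_nonneg.mpr hneg)
    nlinarith
  subst hx0
  simp only [map_zero, zero_add, ZeroMemClass.coe_zero] at h1 h2 ⊢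
  obtain ⟨u, hu, hu'⟩ := h2 (by
    have h5 := mul_nonneg (sq_nonneg c) (neg_nonneg.mpr hneg)
    nlinarith)
  have h6 : ((c • v' : grV (-k)) : V) = c • v := rfl
  refine Subtype.ext ?_
  have h7 : (R ^ (k + 1)) u = 0 := h.j_inj _ _ (h.source.deg_pow hu _) (by
    rw [h.j_R_pow, hu', h6, map_smul, hv1, smul_zero])
  rw [show -(k : ℤ) - 1 = -(k + 1 : ℕ) by push_cast; ring] at hu
  rw [← hu', hR.hl _ _ hu h7, map_zero]
  rfl

end IsLefExt

end Graded

end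

section

variable {B W : Type} [Group W] {M : CoxeterMatrix B} {cs : CoxeterSystem M W}

attribute [local instance] wOrder

open Obj

/-! ### The reduction modulo the left action -/

variable (X : Obj cs)

/-- The submodule generated by the left action of weights. -/
def Obj.wspan : Submodule (Pol B) X := ⨆ l : Wt B, LinearMap.range (X.act (lin l))

/-- The reduction of `X`. -/
abbrev Obj.bar : Type := X ⧸ X.wspan

/-- The reduction map. -/
def Obj.bk : X →ₗ[Pol B] X.bar := X.wspan.mkQ

variable {X} {Y Z : Obj cs} {d d' : ℤ}

lemma act_mem_wspan (l : Wt B) (m : X) : X.act (lin l) m ∈ X.wspan :=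
  Submodule.mem_iSup_of_mem l ⟨m, rfl⟩

lemma bk_act (l : Wt B) (m : X) : X.bk (X.act (lin l) m) = 0 :=
  (Submodule.Quotient.mk_eq_zero _).mpr (act_mem_wspan l m)

lemma bk_eq_zero {m : X} : X.bk m = 0 ↔ m ∈ X.wspan := Submodule.Quotient.mk_eq_zero _

lemma bk_surjective : Function.Surjective X.bk := Submodule.mkQ_surjective _

lemma bk_smul (a : ℝ) (m : X) : X.bk (a • m) = a • X.bk m := LinearMap.map_smul_of_tower _ a m

lemma wspan_induction {P : X → Prop} {m : X} (hm : m ∈ X.wspan)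
    (h : ∀ l n, P (X.act (lin l) n)) (hadd : ∀ m n, P m → P n → P (m + n)) : P m := by
  refine Submodule.iSup_induction _ (motive := P) hm ?_ ?_ hadd
  · rintro l _ ⟨n, rfl⟩
    exact h l n
  · simpa using h 0 0

lemma wspan_le_lspan {m : X} (hm : m ∈ X.wspan) : m ∈ X.lspan Set.univ :=
  wspan_induction (P := fun m => m ∈ X.lspan Set.univ) hm
    (fun l n => Submodule.subset_span ⟨l, n, by simp [mem_sup], rfl⟩)
    fun _ _ => Submodule.add_mem _

lemma pr_mem_wspan {m : X} (hm : m ∈ X.wspan) (k : ℤ) : X.pr k m ∈ X.wspan := by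
  refine wspan_induction (P := fun m => X.pr k m ∈ X.wspan) hm (fun l n => ?_)
    fun m n h h' => by rw [map_add]; exact Submodule.add_mem _ h h'
  have := X.pr_act (k - 2) l n
  rw [sub_add_cancel] at this
  rw [this]
  exact act_mem_wspan _ _

section Lift

variable {E : Type} [AddCommGroup E] [Module ℝ E]

/-- The universal property of the reduction. -/
def barLift (f : X →ₗ[ℝ] E) (hf : ∀ l n, f (X.act (lin l) n) = 0) : X.bar →ₗ[ℝ] E :=
  (Submodule.liftQ (X.wspan.restrictScalars ℝ) f fun m hm => by
    refine wspan_induction (P := fun m => m ∈ LinearMap.ker f) hm hf fun _ _ => Submodule.add_mem _)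
    ∘ₗ (Submodule.Quotient.restrictScalarsEquiv ℝ X.wspan).symm.toLinearMap

@[simp] lemma barLift_bk (f : X →ₗ[ℝ] E) (hf : ∀ l n, f (X.act (lin l) n) = 0) (m : X) :
    barLift f hf (X.bk m) = f m := rfl

lemma bar_hom_ext {f g : X.bar →ₗ[ℝ] E} (h : ∀ m, f (X.bk m) = g (X.bk m)) : f = g := by
  refine LinearMap.ext fun v => ?_
  obtain ⟨m, rfl⟩ := bk_surjective v
  exact h m

end Lift

variable (X) in
/-- The graded pieces of the reduction. -/
def barGr (k : ℤ) : Submodule ℝ X.bar := (X.gr k).map (X.bk.restrictScalars ℝ)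

lemma bk_mem_barGr {m : X} {k : ℤ} (hm : m ∈ X.gr k) : X.bk m ∈ barGr X k := ⟨m, hm, rfl⟩

lemma mem_barGr {v : X.bar} {k : ℤ} : v ∈ barGr X k ↔ ∃ m ∈ X.gr k, X.bk m = v := Iff.rfl

variable (X) in
/-- The right multiplication by `rho` on the reduction. -/
def rhoE : End ℝ X.bar := LinearMap.lsmul (Pol B) X.bar (lin rho) |>.restrictScalars ℝ

lemma rhoE_apply (v : X.bar) : rhoE X v = (lin rho : Pol B) • v := rfl

lemma rhoE_bk (m : X) : rhoE X (X.bk m) = X.bk ((lin rho : Pol B) • m) := by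
  rw [rhoE_apply, map_smul]

variable (X) in
/-- The real form on the reduction. -/
def barForm : X.bar →ₗ[ℝ] X.bar →ₗ[ℝ] ℝ :=
  barLift
    { toFun := fun m => barLift
        { toFun := fun n => MvPolynomial.constantCoeff (X.form m n)
          map_add' := fun n n' => by simp
          map_smul' := fun a n => by simp }
        fun l n => by
          simp [form_act_right, constantCoeff_lin]
      map_add' := fun m m' => bar_hom_ext fun n => by simp
      map_smul' := fun a m => bar_hom_ext fun n => by simp }
    fun l n => bar_hom_ext fun m => by
      simp [X.form_act, constantCoeff_lin]

lemma barForm_bk (m n : X) :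
    barForm X (X.bk m) (X.bk n) = MvPolynomial.constantCoeff (X.form m n) := rfl

/-- The map induced on reductions. -/
def barMap {f : X →ₗ[Pol B] Y} (hf : f ∈ homs X Y d) : X.bar →ₗ[ℝ] Y.bar :=
  barLift (Y.bk ∘ₗ f |>.restrictScalars ℝ) fun l n => by
    simp [homs_act hf, bk_act]

lemma barMap_bk {f : X →ₗ[Pol B] Y} (hf : f ∈ homs X Y d) (m : X) :
    barMap hf (X.bk m) = Y.bk (f m) := rfl

lemma barMap_smul {f : X →ₗ[Pol B] Y} (hf : f ∈ homs X Y d) (r : Pol B) (v : X.bar) :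
    barMap hf (r • v) = r • barMap hf v := by
  obtain ⟨m, rfl⟩ := bk_surjective v
  rw [← map_smul, barMap_bk, barMap_bk, map_smul, map_smul]

lemma barMap_rhoE {f : X →ₗ[Pol B] Y} (hf : f ∈ homs X Y d) (v : X.bar) :
    barMap hf (rhoE X v) = rhoE Y (barMap hf v) := barMap_smul hf _ v

lemma barMap_rhoE_pow {f : X →ₗ[Pol B] Y} (hf : f ∈ homs X Y d) (k : ℕ) (v : X.bar) :
    barMap hf ((rhoE X ^ k) v) = (rhoE Y ^ k) (barMap hf v) := by
  induction k with
  | zero => rfl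
  | succ k ih => rw [pow_succ', pow_succ', Module.End.mul_apply, barMap_rhoE, ih,
      Module.End.mul_apply]

lemma barMap_mem {f : X →ₗ[Pol B] Y} (hf : f ∈ homs X Y d) {k : ℤ} {v : X.bar}
    (hv : v ∈ barGr X k) : barMap hf v ∈ barGr Y (k + d) := by
  obtain ⟨m, hm, rfl⟩ := hv
  exact ⟨f m, homs_gr hf hm, rfl⟩

lemma barForm_barMap {f : X →ₗ[Pol B] Y} {g : Y →ₗ[Pol B] X} (h : IsAdj d f g) (v : X.bar)
    (w : Y.bar) : barForm Y (barMap h.left v) w = barForm X v (barMap h.right w) := by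
  obtain ⟨m, rfl⟩ := bk_surjective v
  obtain ⟨n, rfl⟩ := bk_surjective w
  rw [barMap_bk, barMap_bk, barForm_bk, barForm_bk, h.form]

/-- The reduction is finite-dimensional and its form is perfect. -/
def BarLef (X : Obj cs) : Prop := IsLef (barGr X) (barForm X) (rhoE X)

lemma BarLef.mk (fin : FiniteDimensional ℝ X.bar)
    (nondeg : ∀ k, ∀ v ∈ barGr X k, (∀ w ∈ barGr X (-k), barForm X v w = 0) → v = 0) :
    BarLef X where
  fin := fin
  symm v w := by
    obtain ⟨m, rfl⟩ := bk_surjective v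
    obtain ⟨n, rfl⟩ := bk_surjective w
    rw [barForm_bk, barForm_bk, X.form_comm]
  nondeg := nondeg
  deg k v hv := by
    obtain ⟨m, hm, rfl⟩ := hv
    refine ⟨(lin rho : Pol B) • m, ?_, ?_⟩
    · rw [SetLike.mem_coe, mem_gr, X.pr_smul, mem_gr.mp hm]
    · exact (rhoE_bk m).symm
  adj v w := by
    obtain ⟨m, rfl⟩ := bk_surjective v
    obtain ⟨n, rfl⟩ := bk_surjective w
    rw [rhoE_bk, rhoE_bk, barForm_bk, barForm_bk, X.form_smul]

lemma BarLef.summand {f : Y →ₗ[Pol B] X} {g : X →ₗ[Pol B] Y} (h : IsAdj 0 f g)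
    (hgf : ∀ y, g (f y) = y) (hX : BarLef X) : BarLef Y := by
  have := hX.fin
  have hb (v : Y.bar) : barMap h.right (barMap h.left v) = v := by
    obtain ⟨m, rfl⟩ := bk_surjective v
    rw [barMap_bk, barMap_bk, hgf]
  refine BarLef.mk (Module.Finite.of_surjective (barMap h.right) fun v => ⟨_, hb v⟩)
    fun k v hv h0 => ?_
  rw [← hb v, hX.nondeg k (barMap h.left v) (by simpa using barMap_mem h.left hv), map_zero]
  intro w hw
  rw [barForm_barMap h]
  exact h0 _ (by simpa using barMap_mem h.right hw)

lemma HR.summand {f : Y →ₗ[Pol B] X} {g : X →ₗ[Pol B] Y} (h : IsAdj 0 f g)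
    (hgf : ∀ y, g (f y) = y) {n : ℤ} (hX : HR (barGr X) (barForm X) (rhoE X) n) :
    HR (barGr Y) (barForm Y) (rhoE Y) n := by
  have hb (v : Y.bar) : barMap h.right (barMap h.left v) = v := by
    obtain ⟨m, rfl⟩ := bk_surjective v
    rw [barMap_bk, barMap_bk, hgf]
  intro k v hv h1 h0
  have := hX k (barMap h.left v) (by simpa using barMap_mem h.left hv)
    (by rw [← barMap_rhoE_pow, h1, map_zero]) fun h2 => h0 (by rw [← hb v, h2, map_zero])
  rwa [barForm_barMap h, barMap_rhoE_pow, hb] at this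

section Bs

variable (s : B)

lemma exists_sub_jmap_mem {m : X} (hm : m ∈ X.wspan) :
    ∃ u : X, sndY s X m - jmap s X u ∈ (bs cs s X).wspan := by
  refine wspan_induction (P := fun m => ∃ u : X, sndY s X m - jmap s X u ∈ (bs cs s X).wspan) hm
    (fun l n => ⟨-X.act (dem M s (lin (sref M s l))) n, ?_⟩) ?_
  · convert act_mem_wspan (sref M s l) (sndY s X n) using 1
    refine bs_ext _ _ ?_ ?_
    · simp [bs_act_fst]
    · simp [bs_act_snd, sact_lin, sref_sref]
  · rintro m n ⟨u, hu⟩ ⟨u', hu'⟩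
    refine ⟨u + u', ?_⟩
    convert Submodule.add_mem _ hu hu' using 1
    rw [map_add, map_add]; abel

lemma exists_jmap_of_mmap_mem {m : bs cs s X} (hm : mmap s X m ∈ X.wspan) :
    ∃ u : X, m - jmap s X u ∈ (bs cs s X).wspan := by
  have h : m.2 ∈ X.wspan := by
    have h1 := Submodule.sub_mem _ hm (act_mem_wspan (root s) m.1)
    rwa [mmap_apply, al, add_sub_cancel_left] at h1
  obtain ⟨u, hu⟩ := exists_sub_jmap_mem s h
  refine ⟨m.1 + u, ?_⟩
  convert hu using 1
  nth_rw 1 [← sum_eq m]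
  rw [map_add]; abel

/-- The reduction of `X → B_s X`. -/
abbrev barJ (X : Obj cs) : X.bar →ₗ[ℝ] (bs cs s X).bar := barMap (isAdj_jmap (X := X) s).left

/-- The reduction of `B_s X → X`. -/
abbrev barQ (X : Obj cs) : (bs cs s X).bar →ₗ[ℝ] X.bar := barMap (isAdj_jmap (X := X) s).right

lemma barQ_barJ (v : X.bar) : barQ s X (barJ s X v) = 0 := by
  obtain ⟨m, rfl⟩ := bk_surjective v
  rw [barMap_bk, barMap_bk, mmap_apply, jmap_fst, jmap_snd, add_zero, al, bk_act]

lemma exists_barJ {v : (bs cs s X).bar} (hv : barQ s X v = 0) : ∃ u, barJ s X u = v := by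
  obtain ⟨m, rfl⟩ := bk_surjective v
  rw [barMap_bk, bk_eq_zero] at hv
  obtain ⟨u, hu⟩ := exists_jmap_of_mmap_mem s hv
  refine ⟨X.bk u, ?_⟩
  rw [← bk_eq_zero, map_sub, sub_eq_zero] at hu
  rw [barMap_bk, hu]

lemma exists_barJ_gr {k : ℤ} {v : (bs cs s X).bar} (hv : v ∈ barGr _ k) (h0 : barQ s X v = 0) :
    ∃ u ∈ barGr X (k - 1), barJ s X u = v := by
  obtain ⟨m, hm, rfl⟩ := mem_barGr.mp hv
  rw [barMap_bk, bk_eq_zero] at h0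
  obtain ⟨u, hu⟩ := exists_jmap_of_mmap_mem s h0
  have h1 := pr_mem_wspan hu k
  have h2 := homs_pr (isAdj_jmap (X := X) s).left (k - 1) u
  rw [sub_add_cancel] at h2
  rw [map_sub, ← h2, mem_gr.mp hm, ← bk_eq_zero, map_sub, sub_eq_zero] at h1
  exact ⟨X.bk (X.pr (k - 1) u), bk_mem_barGr (pr_mem _ _ _), by rw [barMap_bk, h1]⟩

lemma exists_barQ_gr {k : ℤ} {u : X.bar} (hu : u ∈ barGr X k) :
    ∃ v ∈ barGr (bs cs s X) (k - 1), barQ s X v = u := by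
  obtain ⟨m, hm, rfl⟩ := mem_barGr.mp hu
  refine ⟨(bs cs s X).bk (sndY s X m), bk_mem_barGr (mem_gr.mpr (bs_ext _ _ ?_ ?_)), ?_⟩
  · simp [bs_pr_fst]
  · simp [bs_pr_snd, mem_gr.mp hm]
  · rw [barMap_bk, mmap_apply]; simp

theorem BarLef.isLefExt (h : BarLef X) :
    IsLefExt (barGr X) (barForm X) (rhoE X) (barGr (bs cs s X)) (barForm (bs cs s X))
      (rhoE (bs cs s X)) (barJ s X) (barQ s X) := by
  have hj := isAdj_jmap (X := X) s
  have hfin := h.fin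
  have hinj (k : ℤ) (u) (hu : u ∈ barGr X k) (h0 : barJ s X u = 0) : u = 0 := by
    refine h.nondeg k u hu fun w hw => ?_
    obtain ⟨v, -, rfl⟩ := exists_barQ_gr s hw
    rw [← barForm_barMap hj, h0, map_zero, LinearMap.zero_apply]
  refine
    { source := h
      target := BarLef.mk ?_ ?_
      j_deg := fun k u hu => barMap_mem hj.left hu
      q_deg := fun k u hu => barMap_mem hj.right hu
      q_L := fun v => barMap_rhoE hj.right v
      j_R := fun v => barMap_rhoE hj.left v
      form_j := fun u v => barForm_barMap hj u v
      q_j := barQ_barJ s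
      j_inj := hinj
      ker_q := fun k v hv h0 => exists_barJ_gr s hv h0
      q_surj := fun k u hu => exists_barQ_gr s hu }
  · have h1 : FiniteDimensional ℝ (LinearMap.ker (barQ s X)) :=
      Submodule.finiteDimensional_of_le (S₂ := LinearMap.range (barJ s X)) fun v hv =>
        exists_barJ s hv
    have h2 : FiniteDimensional ℝ ((bs cs s X).bar ⧸ LinearMap.ker (barQ s X)) :=
      Module.Finite.equiv (LinearMap.quotKerEquivRange (barQ s X)).symm
    exact Module.Finite.of_submodule_quotient (LinearMap.ker (barQ s X))
  · intro k v hv h0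
    have h1 : barQ s X v = 0 := by
      refine h.nondeg _ _ (barMap_mem hj.right hv) fun w hw => ?_
      have h2 := barMap_mem hj.left hw
      rw [neg_add, neg_add_cancel_right] at h2
      rw [barForm_barMap hj.symm]
      exact h0 _ h2
    obtain ⟨u, hu, rfl⟩ := exists_barJ_gr s hv h1
    rw [h.nondeg _ u hu, map_zero]
    intro w hw
    obtain ⟨v, hv', rfl⟩ := exists_barQ_gr s hw
    rw [← barForm_barMap hj]
    refine h0 _ ?_
    rwa [neg_sub, sub_right_comm, sub_self, zero_sub] at hv'

end Bs

end

section

/-! ### Hard Lefschetz for the deformed operators -/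

lemma theta_even_add {a : ℤ} (ha : Even a) (b : ℤ) : theta (a + b) = theta a * theta b := by
  obtain ⟨c, rfl⟩ := ha
  unfold theta
  split_ifs <;> first | (exfalso; omega) | norm_num

section Weak

variable {V U : Type} [AddCommGroup V] [Module ℝ V] [AddCommGroup U] [Module ℝ U]

/-- A semidefinite version of the Hodge–Riemann relations, relative to a map `j : U → V`. -/
def WeakHR (grU : ℤ → Submodule ℝ U) (gr : ℤ → Submodule ℝ V) (form : V →ₗ[ℝ] V →ₗ[ℝ] ℝ)
    (L : End ℝ V) (j : U →ₗ[ℝ] V) (n : ℤ) : Prop :=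
  ∀ k : ℕ, ∀ v ∈ gr (-k), (L ^ (k + 1)) v = 0 → 0 ≤ theta (n - k) * form v ((L ^ k) v) ∧
    (form v ((L ^ k) v) = 0 → ∀ l, ∀ u ∈ grU l, j u = v → u = 0)

variable {grU : ℤ → Submodule ℝ U} {formU : U →ₗ[ℝ] U →ₗ[ℝ] ℝ} {R : End ℝ U}
    {grV : ℤ → Submodule ℝ V} {formV : V →ₗ[ℝ] V →ₗ[ℝ] ℝ} {L : End ℝ V}
    {j : U →ₗ[ℝ] V} {q : V →ₗ[ℝ] U} {n : ℤ}

lemma HR.nonneg (h : HR grU formU R n) {k : ℕ} {u : U} (hu : u ∈ grU (-k))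
    (h1 : (R ^ (k + 1)) u = 0) : 0 ≤ theta (n - k) * formU u ((R ^ k) u) := by
  rcases eq_or_ne u 0 with rfl | h0
  · simp
  · exact (h k u hu h1 h0).le

lemma HR.weakHR (h : IsLefExt grU formU R grV formV L j q) (hV : HR grV formV L n) :
    WeakHR grU grV formV L j n := by
  refine fun k v hv h1 => ⟨hV.nonneg hv h1, fun h2 l u hu h3 => h.j_inj l u hu ?_⟩
  by_contra h0
  have := hV k v hv h1 (h3 ▸ h0)
  rw [h2, mul_zero] at this
  exact lt_irrefl _ this

theorem IsLefExt.weakHR_of_section (h : IsLefExt grU formU R grV formV L j q)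
    (hR : HR grU formU R n) {p : V →ₗ[ℝ] U} {i : U →ₗ[ℝ] V}
    (p_deg : ∀ k, ∀ v ∈ grV k, p v ∈ grU (k - 1)) (p_L : ∀ v, p (L v) = R (p v))
    (hpj : ∀ u, p (j u) = u) (hsum : ∀ v, j (p v) + i (q v) = v)
    (hform : ∀ u v, formV (i u) v = formU u (p v)) {ζ : ℝ} (hζ : 0 ≤ ζ) :
    WeakHR grU grV formV (L + ζ • j ∘ₗ q) j (n + 1) := by
  intro k v hv h1
  have p_pow (m : ℕ) (v : V) : p ((L ^ m) v) = (R ^ m) (p v) := by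
    induction m with
    | zero => rfl
    | succ m ih => rw [pow_succ', pow_succ', Module.End.mul_apply, p_L, ih, Module.End.mul_apply]
  have hb1 : p v ∈ grU (-(k + 1 : ℕ)) := by
    convert p_deg _ v hv using 2
    push_cast; ring
  have hb0 : q v ∈ grU (-k + 1) := h.q_deg _ v hv
  have hpow (m : ℕ) : p (((L + ζ • j ∘ₗ q) ^ m) v) =
      (R ^ m) (p v) + (m * ζ) • (R ^ (m - 1)) (q v) := by
    cases m with
    | zero => simp
    | succ m => rw [h.deform_pow, map_add, map_smul, hpj, p_pow]; push_cast; rfl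
  have hqpow := (h.deform ζ).q_L_pow
  have hq1 : (R ^ (k + 1)) (q v) = 0 := by rw [← hqpow, h1, map_zero]
  have hp1 : (R ^ (k + 1)) (p v) + ((k + 1) * ζ) • (R ^ k) (q v) = 0 := by
    have := hpow (k + 1)
    rw [h1, map_zero] at this
    simpa using this.symm
  have hval : formV v (((L + ζ • j ∘ₗ q) ^ k) v) =
      2 * formU (q v) ((R ^ k) (p v)) + k * ζ * formU (q v) ((R ^ (k - 1)) (q v)) := by
    conv_lhs => rw [← hsum v, map_add, LinearMap.add_apply, h.form_j, hform, hsum v, hqpow, hpow,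
      map_add, map_smul, ← h.source.adj_pow, h.source.symm]
    rw [smul_eq_mul]; ring
  have hu {l u} (hu : j u = v) (h0 : p v = 0) : ∀ (_ : u ∈ grU l), u = 0 := fun _ => by
    rw [← hpj u, hu, h0]
  rcases hζ.eq_or_lt with rfl | hζ
  · have h0 : p v = 0 := hR.hl (k + 1) (p v) hb1 (by simpa using hp1)
    rw [hval, h0]
    exact ⟨by simp, fun _ l u hu1 hu2 => hu hu2 h0 hu1⟩
  set a : ℝ := ((k + 1) * ζ)⁻¹ with ha
  have hk : (0 : ℝ) < (k + 1) * ζ := by positivity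
  have ha0 : 0 < a := inv_pos.mpr hk
  have hak : (k + 1) * ζ * a = 1 := mul_inv_cancel₀ hk.ne'
  obtain ⟨b, hb⟩ : ∃ b, b = q v + a • R (p v) := ⟨_, rfl⟩
  have hbd : b ∈ grU (-k + 1) := by
    rw [hb]
    refine Submodule.add_mem _ hb0 (Submodule.smul_mem _ _ ?_)
    convert h.source.deg _ _ hb1 using 2
    push_cast; ring
  have hbk : (R ^ k) b = 0 := by
    rw [hb, map_add, map_smul, ← Module.End.mul_apply, ← pow_succ, eq_neg_of_add_eq_zero_left hp1,
      smul_neg, smul_smul, mul_comm a, hak, one_smul, add_neg_cancel]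
  have hqv : q v = b - a • R (p v) := by rw [hb, add_sub_cancel_right]
  have hp2 : (R ^ (k + 1 + 1)) (p v) = 0 := by
    rw [pow_succ', Module.End.mul_apply, eq_neg_of_add_eq_zero_left hp1, map_neg, map_smul,
      ← Module.End.mul_apply, ← pow_succ', hq1, smul_zero, neg_zero]
  have hb0' : 0 ≤ k * ζ * (theta (n + 1 - k) * formU b ((R ^ (k - 1)) b)) := by
    cases k with
    | zero => simp
    | succ k =>
      refine mul_nonneg (by positivity) ?_
      have := hR.nonneg (k := k) (u := b) (by convert hbd using 2; push_cast; ring) hbk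
      rwa [show n + 1 - ((k + 1 : ℕ) : ℤ) = n - k by push_cast; ring]
  have ht : theta (n + 1 - k) = -theta (n - (k + 1 : ℕ)) := by
    rw [← theta_add_two]; congr 1; push_cast; ring
  have hpp := hR.nonneg (k := k + 1) hb1 hp2
  have e1 : formU b ((R ^ k) (p v)) = 0 := by
    rw [← h.source.adj_pow, hbk, map_zero, LinearMap.zero_apply]
  have e2 : formU (R (p v)) ((R ^ k) (p v)) = formU (p v) ((R ^ (k + 1)) (p v)) := by
    rw [h.source.adj, ← Module.End.mul_apply, ← pow_succ']
  have e3 : k * formU (q v) ((R ^ (k - 1)) (q v)) = k * (formU b ((R ^ (k - 1)) b) +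
      a ^ 2 * formU (p v) ((R ^ (k + 1)) (p v))) := by
    cases k with
    | zero => simp
    | succ k =>
      rw [add_tsub_cancel_right, hqv]
      have e4 : (R ^ k) (R (p v)) = (R ^ (k + 1)) (p v) := by
        rw [← Module.End.mul_apply, ← pow_succ]
      have e5 : formU (R (p v)) ((R ^ k) b) = 0 := by
        rw [← h.source.adj_pow, e4, h.source.symm, e1]
      simp only [map_sub, map_smul, LinearMap.sub_apply, LinearMap.smul_apply, e4, e1, e2, e5,
        smul_eq_mul]
      ring
  have e6 : formV v (((L + ζ • j ∘ₗ q) ^ k) v) = k * ζ * formU b ((R ^ (k - 1)) b) -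
      a * (2 - k * ζ * a) * formU (p v) ((R ^ (k + 1)) (p v)) := by
    have e7 : formU (q v) ((R ^ k) (p v)) = - a * formU (p v) ((R ^ (k + 1)) (p v)) := by
      rw [hqv, map_sub, LinearMap.sub_apply, e1, map_smul, LinearMap.smul_apply, e2, smul_eq_mul]
      ring
    rw [hval, e7]
    linear_combination ζ * e3
  have hc : 0 < a * (2 - k * ζ * a) := by
    refine mul_pos ha0 ?_
    nlinarith [mul_pos hζ ha0]
  have e8 : theta (n + 1 - k) * formV v (((L + ζ • j ∘ₗ q) ^ k) v) =
      k * ζ * (theta (n + 1 - k) * formU b ((R ^ (k - 1)) b)) +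
      a * (2 - k * ζ * a) * (theta (n - (k + 1 : ℕ)) * formU (p v) ((R ^ (k + 1)) (p v))) := by
    rw [e6, ht]; ring
  refine ⟨e8 ▸ add_nonneg hb0' (mul_nonneg hc.le hpp), fun h2 l u hu1 hu2 => hu hu2 ?_ hu1⟩
  by_contra h0
  have h3 := mul_pos hc (hR (k + 1) _ hb1 hp2 h0)
  rw [h2, mul_zero] at e8
  linarith

theorem IsLefExt.hl_of_family (h : IsLefExt grU formU R grV formV L j q) (hR : HR grU formU R n)
    {ι : Type} [Fintype ι] {Ui Vi : ι → Type} [∀ i, AddCommGroup (Ui i)] [∀ i, Module ℝ (Ui i)]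
    [∀ i, AddCommGroup (Vi i)] [∀ i, Module ℝ (Vi i)] {grUi : ∀ i, ℤ → Submodule ℝ (Ui i)}
    {grVi : ∀ i, ℤ → Submodule ℝ (Vi i)} {formVi : ∀ i, Vi i →ₗ[ℝ] Vi i →ₗ[ℝ] ℝ}
    {Li : ∀ i, End ℝ (Vi i)} {ji : ∀ i, Ui i →ₗ[ℝ] Vi i} {f : ∀ i, V →ₗ[ℝ] Vi i}
    {f' : ∀ i, Vi i →ₗ[ℝ] V} {g : ∀ i, U →ₗ[ℝ] Ui i} {F : ι → ℝ} {m : ι → ℤ} {a : ℝ}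
    (ha : 0 < a) (hn : 0 ≤ n) (hL : ∀ v, L v = ∑ i, F i • f' i (f i v) + a • j (q v))
    (symmi : ∀ i v w, formVi i v w = formVi i w v)
    (adj : ∀ i v w, formVi i (f i v) w = formV v (f' i w))
    (f_deg : ∀ i k, ∀ v ∈ grV k, f i v ∈ grVi i (k + 1))
    (g_deg : ∀ i k, ∀ u ∈ grU k, g i u ∈ grUi i (k + 1))
    (f_L : ∀ i v, f i (L v) = Li i (f i v)) (f_j : ∀ i u, f i (j u) = ji i (g i u))
    (weak : ∀ i, WeakHR (grUi i) (grVi i) (formVi i) (Li i) (ji i) (m i + 1))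
    (hF : ∀ i, 0 < F i * theta (n - 1 - m i)) (even : ∀ i, Even (n - 1 - m i))
    (inj : ∀ k, ∀ u ∈ grU k, (∀ i, g i u = 0) → u = 0 ∨ k = n) : HL grV L := by
  intro k v hv h1
  cases k with
  | zero => exact h1
  | succ k =>
  have f_pow (i) (l : ℕ) (v : V) : f i ((L ^ l) v) = (Li i ^ l) (f i v) := by
    induction l with
    | zero => rfl
    | succ l ih => rw [pow_succ', pow_succ', Module.End.mul_apply, f_L, ih, Module.End.mul_apply]
  have hq : q v ∈ grU (-k) := by
    convert h.q_deg _ v hv using 2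
    push_cast; ring
  have hq0 : (R ^ (k + 1)) (q v) = 0 := by rw [← h.q_L_pow, h1, map_zero]
  have hf (i) : f i v ∈ grVi i (-k) := by
    convert f_deg i _ v hv using 2
    push_cast; ring
  have hf0 (i) : (Li i ^ (k + 1)) (f i v) = 0 := by rw [← f_pow, h1, map_zero]
  have e0 : formV v ((L ^ (k + 1)) v) = ∑ i, F i * formVi i (f i v) ((Li i ^ k) (f i v)) +
      a * formU (q v) ((R ^ k) (q v)) := by
    rw [pow_succ', Module.End.mul_apply, ← h.target.adj, hL]
    simp only [map_add, map_sum, map_smul, LinearMap.add_apply, LinearMap.sum_apply,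
      LinearMap.smul_apply, smul_eq_mul, h.form_j, h.q_L_pow]
    congr 1
    refine Finset.sum_congr rfl fun i _ => ?_
    rw [h.target.symm, ← adj, f_pow, symmi]
  have hi (i) : theta (n - k) = theta (n - 1 - m i) * theta (m i + 1 - k) := by
    rw [← theta_even_add (even i)]; congr 1; ring
  have e1 (i) : 0 ≤ theta (n - k) * (F i * formVi i (f i v) ((Li i ^ k) (f i v))) := by
    have := mul_nonneg (hF i).le (weak i k _ (hf i) (hf0 i)).1
    rw [hi i]
    linarith
  have e2 := hR.nonneg hq hq0
  have e3 : ∑ i, theta (n - k) * (F i * formVi i (f i v) ((Li i ^ k) (f i v))) +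
      a * (theta (n - k) * formU (q v) ((R ^ k) (q v))) = 0 := by
    rw [h1, map_zero] at e0
    rw [← Finset.mul_sum]
    linear_combination -theta (n - k) * e0
  have e4 := Finset.sum_nonneg fun i (_ : i ∈ Finset.univ) => e1 i
  have e5 := mul_nonneg ha.le e2
  have e6 : q v = 0 := by
    by_contra h0
    have := mul_pos ha (hR k _ hq hq0 h0)
    linarith
  obtain ⟨u, hu, rfl⟩ := h.ker_q _ v hv e6
  have e7 := (Finset.sum_eq_zero_iff_of_nonneg fun i _ => e1 i).mp (by linarith)
  have ht : theta (n - k) ≠ 0 := fun h0 => by simpa [h0] using theta_mul_self (n - k)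
  have e8 (i) : g i u = 0 := by
    refine (weak i k _ (hf i) (hf0 i)).2 ?_ _ _ (g_deg i _ u hu) (f_j i u).symm
    have hF0 : F i ≠ 0 := left_ne_zero_of_mul (hF i).ne'
    simpa [ht, hF0] using e7 i (Finset.mem_univ i)
  rcases inj _ u hu e8 with rfl | h2
  · exact map_zero _
  · push_cast at h2
    omega

end Weak

end

section

variable {B W : Type} [Group W] {M : CoxeterMatrix B} {cs : CoxeterSystem M W}

attribute [local instance] wOrder

open Obj

/-! ### Low-degree coefficients of pairings -/

lemma coeff_mul_low {a b : ℤ[T;T⁻¹]} {i j : ℤ} (ha : ∀ k < i, a.coeff k = 0)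
    (hb : ∀ k < j, b.coeff k = 0) {k : ℤ} (hk : k < i + j) : (a * b).coeff k = 0 := by
  rw [AddMonoidAlgebra.coeff_mul_apply_left]
  refine Finset.sum_eq_zero fun h _ => ?_
  rcases lt_or_ge h i with h1 | h1
  · simp [ha h h1]
  · simp [hb (-h + k) (by lia)]

/-- The characters with leading term `w` and all other coefficients in positive degrees. -/
structure IsStd (w : W) (p : W →₀ ℤ[T;T⁻¹]) : Prop where
  self : p w = 1
  ne : ∀ u ≠ w, ∀ k ≤ 0, (p u).coeff k = 0

omit [Group W] in
lemma coeff_cpair (p c : W →₀ ℤ[T;T⁻¹]) (k : ℤ) :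
    (cpair p c).coeff k = ∑ u ∈ p.support, (p u * c u).coeff k := by
  rw [cpair, Finsupp.sum, AddMonoidAlgebra.coeff_sum, Finsupp.finsetSum_apply]

omit [Group W] in
lemma IsStd.coeff_neg {w : W} {p : W →₀ ℤ[T;T⁻¹]} (hp : IsStd w p) (u : W) {k : ℤ} (hk : k < 0) :
    (p u).coeff k = 0 := by
  rcases eq_or_ne u w with rfl | h
  · rw [hp.self, AddMonoidAlgebra.one_def, AddMonoidAlgebra.coeff_single, Finsupp.single_eq_of_ne hk.ne]
  · exact hp.ne u h k hk.le

omit [Group W] in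
lemma IsStd.coeff_self {w : W} {p : W →₀ ℤ[T;T⁻¹]} (hp : IsStd w p) : (p w).coeff 0 = 1 := by
  rw [hp.self, AddMonoidAlgebra.one_def, AddMonoidAlgebra.coeff_single, Finsupp.single_eq_same]

omit [Group W] in
lemma coeff_cpair_pos {p c : W →₀ ℤ[T;T⁻¹]} (hp : ∀ u, ∀ k ≤ 0, (p u).coeff k = 0)
    (hc : ∀ u, ∀ k < 0, (c u).coeff k = 0) {k : ℤ} (hk : k ≤ 0) : (cpair p c).coeff k = 0 := by
  rw [coeff_cpair]
  exact Finset.sum_eq_zero fun u _ =>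
    coeff_mul_low (i := 1) (j := 0) (fun k hk => hp u k (by lia)) (hc u) (by lia)

omit [Group W] in
lemma IsStd.coeff_cpair {w : W} {p c : W →₀ ℤ[T;T⁻¹]} (hp : IsStd w p)
    (hc : ∀ u, ∀ k < 0, (c u).coeff k = 0) {k : ℤ} (hk : k ≤ 0) :
    (cpair p c).coeff k = (c w).coeff k := by
  rw [KL.coeff_cpair, Finset.sum_eq_single w]
  · rw [hp.self, one_mul]
  · exact fun u _ h => coeff_mul_low (i := 1) (j := 0) (fun k hk => hp.ne u h k (by lia)) (hc u)
      (by lia)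
  · intro h
    rw [Finsupp.notMem_support_iff, hp.self] at h
    exact absurd h one_ne_zero

/-- The span of the characters of iterated products. -/
inductive SelfDual (cs : CoxeterSystem M W) : (W →₀ ℤ[T;T⁻¹]) → Prop
  | one : SelfDual cs (Finsupp.single 1 1)
  | bs (s : B) (p) : SelfDual cs p → SelfDual cs (bsC cs s p)
  | sub (p q) : SelfDual cs p → SelfDual cs q → SelfDual cs (p - q)

/-! ### Indecomposable objects -/

/-- The properties of the indecomposable object attached to `w`. -/
structure Ind (w : W) (X : Obj cs) (one : X) (p : W →₀ ℤ[T;T⁻¹]) : Prop where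
  good : Good X
  char : Char X p
  homChar : HomChar X p
  std : IsStd w p
  len : ∀ u ≠ w, p u ≠ 0 → cs.length u < cs.length w
  dual : SelfDual cs p
  lef : BarLef X
  hr : HR (barGr X) (barForm X) (rhoE X) (cs.length w)
  low : ∀ k < -(cs.length w : ℤ), X.gr k = ⊥
  one_mem : one ∈ X.gr (-cs.length w)
  one_ne : one ≠ 0
  gr_one : ∀ m ∈ X.gr (-cs.length w), ∃ a : ℝ, m = a • one
  parity : ∀ k, X.gr k ≠ ⊥ → Even (k - cs.length w)
  sup : ∀ m, m ∈ X.sup {u | cs.length u < cs.length w ∨ u = w}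
  ext : ∀ P : Obj cs, Good P → ∀ g ∈ P.gimg {w} {u | lenHt cs u ≤ lenHt cs w} (-cs.length w),
    ∃ φ φ', IsAdj (X := X) (Y := P) 0 φ φ' ∧ P.ev {w} (φ one) = g

variable {X Y N : Obj cs} {w : W} {one : X} {p c : W →₀ ℤ[T;T⁻¹]}

lemma HomChar.eq_bot (h : HomChar X p) (hp : IsStd w p) (hN : Good N) (hc : Char N c)
    (hc0 : ∀ u, ∀ k < 0, (c u).coeff k = 0) {k : ℤ} (hk : k < 0) : homs X N k = ⊥ :=
  h.eq_zero hN hc (fun k hk => by rw [hp.coeff_cpair hc0 hk.le, hc0 w k hk]) hk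

lemma HomChar.eq_bot' (h : HomChar X p) (hp : IsStd w p) (hN : Good N) (hc : Char N c)
    (hc0 : ∀ u, ∀ k < 0, (c u).coeff k = 0) (hw : (c w).coeff 0 = 0) {k : ℤ} (hk : k ≤ 0) :
    homs X N k = ⊥ := by
  refine h.eq_zero hN hc (n := 1) (fun k hk => ?_) (by lia)
  rw [hp.coeff_cpair hc0 (by lia)]
  rcases (show k ≤ 0 by lia).eq_or_lt with rfl | h1
  · exact hw
  · exact hc0 w k h1

lemma eq_zero_of_coeff (hX : Good X) (hc : Char X p) (h : HomChar X p)
    (hp : ∀ u, ∀ k ≤ 0, (p u).coeff k = 0) (x : X) : x = 0 := by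
  have h1 : homs X X 0 = ⊥ := h.eq_zero hX hc (n := 1)
    (fun k hk => coeff_cpair_pos hp (fun u k hk => hp u k hk.le) (by lia)) one_pos
  have h2 := homs_id (X := X)
  rw [h1, Submodule.mem_bot] at h2
  exact LinearMap.congr_fun h2 x

lemma Ind.hom_eq_zero (h : Ind w X one p) {w' : W} {one' : Y} {p' : W →₀ ℤ[T;T⁻¹]}
    (h' : Ind w' Y one' p') (hne : w ≠ w') {k : ℤ} (hk : k ≤ 0) : homs X Y k = ⊥ :=
  h.homChar.eq_bot' h.std h'.good h'.char (fun u _ hk => h'.std.coeff_neg u hk)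
    (h'.std.ne w hne 0 le_rfl) hk

lemma Ind.end_neg (h : Ind w X one p) {k : ℤ} (hk : k < 0) : homs X X k = ⊥ :=
  h.homChar.eq_bot h.std h.good h.char (fun u _ hk => h.std.coeff_neg u hk) hk

lemma Ind.exists_smul (h : Ind w X one p) {f : X →ₗ[Pol B] X} (hf : f ∈ homs X X 0) :
    ∃ a : ℝ, f = a • LinearMap.id := by
  obtain ⟨h1, h2⟩ := h.homChar.hasQ X p h.good h.char 0
  rw [h.std.coeff_cpair (fun u _ hk => h.std.coeff_neg u hk) le_rfl, h.std.coeff_self] at h2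
  have h3 : lam (B := B) (homs X X) 0 = ⊥ := by
    rw [lam, Submodule.span_eq_bot]
    rintro _ ⟨l, g, hg, rfl⟩
    rw [h.end_neg (by norm_num), Submodule.mem_bot] at hg
    rw [hg, smul_zero]
  rw [h3] at h2
  have h4 : finrank ℝ (homs X X 0) = 1 := by
    rw [← (Submodule.quotEquivOfEqBot ((⊥ : Submodule ℝ (X →ₗ[Pol B] X)).submoduleOf (homs X X 0))
      (by rw [Submodule.submoduleOf, Submodule.comap_bot, Submodule.ker_subtype])).finrank_eq]
    exact_mod_cast h2
  have h5 : (⟨LinearMap.id, homs_id⟩ : homs X X 0) ≠ 0 := fun h0 =>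
    h.one_ne (LinearMap.congr_fun (Subtype.ext_iff.mp h0) one)
  obtain ⟨a, ha⟩ := (finrank_eq_one_iff_of_nonzero' _ h5).mp h4 ⟨f, hf⟩
  exact ⟨a, (Subtype.ext_iff.mp ha).symm⟩

/-! ### Descents -/

/-- A splitting of the inclusion `X → B_s X`, in the form of a twisted derivation. -/
structure IsDesc (s : B) (X : Obj cs) (g : X →ₗ[Pol B] X) : Prop where
  pr : ∀ k m, g (X.pr k m) = X.pr (k - 2) (g m)
  act : ∀ r m, X.act r (g m) = X.act (dem M s r) m + g (X.act (sact M s r) m)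
  form : ∀ m n, dem M s (X.form m n) = X.form (g m) n + sact M s (X.form m (g n))

lemma dem_dem (s : B) (r : Pol B) : dem M s (dem M s r) = 0 := by
  refine mul_left_cancel₀ (al_ne_zero s) ?_
  rw [al_mul_dem, sact_dem, sub_self, mul_zero]

variable (s : B)

/-- The derivation of `B_s X`. -/
def bsD (X : Obj cs) : bs cs s X →ₗ[Pol B] bs cs s X :=
  LinearMap.prod 0 (LinearMap.fst (Pol B) X X)

@[simp] lemma bsD_fst (m : bs cs s X) : (bsD s X m).1 = 0 := rfl
@[simp] lemma bsD_snd (m : bs cs s X) : (bsD s X m).2 = m.1 := rfl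

lemma isDesc_bsD (X : Obj cs) : IsDesc s (bs cs s X) (bsD s X) where
  pr k m := bs_ext _ _ (by simp [bs_pr_fst]) (by
    rw [bsD_snd, bs_pr_fst, bs_pr_snd, bsD_snd]; congr 2; ring)
  act r m := by
    have : dem M s (sact M s r) = -dem M s r := dem_sact s r
    refine bs_ext _ _ ?_ ?_
    · simp [bs_act_fst, dem_dem]
    · simp [bs_act_fst, bs_act_snd, sact_dem, this]
  form m n := by
    simp only [bs_form, bsD_fst, bsD_snd, map_zero, LinearMap.zero_apply, mul_zero, zero_add,
      map_add, dem_al_mul, dem_dem, sact_dem]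
    ring

variable {s}

lemma IsDesc.summand {g : X →ₗ[Pol B] X} (hg : IsDesc s X g) {a : ℝ} (ha : a ≠ 0)
    {i : Y →ₗ[Pol B] X} {i' : X →ₗ[Pol B] Y} (h : IsAdj 0 i i') (hi : ∀ y, i' (i y) = a • y) :
    IsDesc s Y (a⁻¹ • i' ∘ₗ g ∘ₗ i) where
  pr k m := by
    have h1 := homs_pr h.left k m
    have h2 := homs_pr h.right (k - 2) (g (i m))
    rw [add_zero] at h1 h2
    simp [h1, h2, hg.pr]
  act r m := by
    simp only [LinearMap.smul_apply, LinearMap.comp_apply]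
    rw [← C_smul, act_smul, ← homs_act h.right, hg.act, map_add, ← homs_act h.left, hi, smul_add,
      C_smul, C_smul, smul_smul, inv_mul_cancel₀ ha, one_smul, homs_act h.left]
  form m n := by
    simp only [LinearMap.smul_apply, LinearMap.comp_apply]
    have h1 := hg.form (i m) (i n)
    rw [h.form, hi, map_smul, map_smul, ← h.symm.form, h.form m] at h1
    rw [map_smul, map_smul, map_smul, LinearMap.smul_apply, ← smul_add, ← h1, smul_smul, inv_mul_cancel₀ ha,
      one_smul]

/-- The projection `B_s X → X` attached to a descent. -/
def desL (g : X →ₗ[Pol B] X) : bs cs s X →ₗ[Pol B] X := LinearMap.coprod LinearMap.id g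

/-- The adjoint of the projection attached to a descent. -/
def desR (g : X →ₗ[Pol B] X) : X →ₗ[Pol B] bs cs s X :=
  LinearMap.prod g (LinearMap.id - X.act (al s) ∘ₗ g)

lemma desL_apply (g : X →ₗ[Pol B] X) (m : bs cs s X) : desL g m = m.1 + g m.2 := rfl

@[simp] lemma desR_fst (g : X →ₗ[Pol B] X) (m : X) : (desR (s := s) g m).1 = g m := rfl

@[simp] lemma desR_snd (g : X →ₗ[Pol B] X) (m : X) :
    (desR (s := s) g m).2 = m - X.act (al s) (g m) := rfl

lemma IsDesc.isAdj {g : X →ₗ[Pol B] X} (hg : IsDesc s X g) :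
    IsAdj (-1) (desL (s := s) g) (desR g) where
  left := by
    refine ⟨fun r m => ?_, fun k m => ?_⟩
    · rw [desL_apply, desL_apply, bs_act_fst, bs_act_snd, map_add, hg.act]; abel
    · rw [desL_apply, desL_apply, bs_pr_fst, bs_pr_snd, map_add, hg.pr]
      congr 3; ring
  right := by
    have h1 (r : Pol B) (m : X) : g (X.act r m) = X.act (sact M s r) (g m) + X.act (dem M s r) m := by
      rw [hg.act, sact_sact, dem_sact, map_neg, LinearMap.neg_apply]; abel
    have h2 (r : Pol B) : sact M s r = r - al s * dem M s r := by rw [al_mul_dem]; ring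
    refine ⟨fun r m => bs_ext _ _ ?_ ?_, fun k m => bs_ext _ _ ?_ ?_⟩
    · rw [desR_fst, bs_act_fst, desR_fst, desR_snd, h1, h2, map_sub, map_sub, ← act_mul, mul_comm (al s)]
      simp only [LinearMap.sub_apply]
      abel
    · have h3 : X.act (sact M s r) m = X.act r m - X.act (al s) (X.act (dem M s r) m) := by
        rw [h2, map_sub, LinearMap.sub_apply, act_mul]
      rw [desR_snd, bs_act_snd, desR_snd, h1, map_add, map_sub, h3, act_comm _ (al s) (sact M s r)]
      abel
    · rw [desR_fst, bs_pr_fst, desR_fst, hg.pr]; congr 2; ring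
    · rw [desR_snd, bs_pr_snd, desR_snd, map_sub, hg.pr]
      have h3 := X.pr_act (k - 2) (root s) (g m)
      rw [sub_add_cancel] at h3
      rw [show k + -1 + 1 = k by ring, al, h3]
  form m n := by
    rw [desL_apply, bs_form, desR_fst, desR_snd, map_add, LinearMap.add_apply, map_sub, map_sub,
      form_act_right, form_act_right, map_sub, dem_al_mul]
    linear_combination -hg.form m.2 n

lemma IsDesc.desL_desR {g : X →ₗ[Pol B] X} (hg : IsDesc s X g) (hX : homs X X (-2) = ⊥) (m : X) :
    desL (s := s) g (desR g m) = 0 := by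
  have := homs_comp hg.isAdj.right hg.isAdj.left
  rw [show (-1 + -1 : ℤ) = -2 by norm_num, hX, Submodule.mem_bot] at this
  exact LinearMap.congr_fun this m

lemma desL_jmap (g : X →ₗ[Pol B] X) (m : X) : desL (s := s) g (jmap s X m) = m := by
  rw [desL_apply, jmap_fst, jmap_snd, map_zero, add_zero]

lemma IsDesc.sum_eq {g : X →ₗ[Pol B] X} (hg : IsDesc s X g) (hX : homs X X (-2) = ⊥)
    (m : bs cs s X) : jmap s X (desL g m) +
      desR g (mmap s X m - X.act (al s) (desL (s := s) g m)) = m := by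
  have h1 : mmap s X m - X.act (al s) (desL (s := s) g m) = m.2 - X.act (al s) (g m.2) := by
    rw [mmap_apply, desL_apply, map_add]; abel
  have h2 := hg.desL_desR hX m.2
  rw [desL_apply, desR_fst, desR_snd] at h2
  have h3 := eq_neg_of_add_eq_zero_right h2
  rw [h1]
  refine bs_ext _ _ ?_ ?_
  · rw [bs_fst_add, jmap_fst, desR_fst, h3, desL_apply]; abel
  · rw [bs_snd_add, jmap_snd, desR_snd, h3, map_neg]; abel

lemma IsDesc.eq_desR {g : X →ₗ[Pol B] X} (hg : IsDesc s X g) (hX : homs X X (-2) = ⊥)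
    {m : bs cs s X} (hm : desL g m = 0) : m = desR g (mmap s X m) := by
  have := hg.sum_eq hX m
  rw [hm, map_zero, map_zero, sub_zero, zero_add] at this
  exact this.symm

end

section

variable {B W : Type} [Group W] {M : CoxeterMatrix B} {cs : CoxeterSystem M W}

attribute [local instance] wOrder

open Obj

/-- The indecomposable object attached to `w`, with an expression of the right multiplication by
`rho` through objects of smaller length. -/
inductive IsKL : W → Obj cs → (W →₀ ℤ[T;T⁻¹]) → Prop
  | mk {w : W} {X : Obj cs} {p : W →₀ ℤ[T;T⁻¹]} (one : X) (ind : Ind w X one p)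
    (ι : Type) [Fintype ι] (z : ι → W) (Z : ι → Obj cs) (pZ : ι → W →₀ ℤ[T;T⁻¹])
    (f : ∀ i, X →ₗ[Pol B] Z i) (f' : ∀ i, Z i →ₗ[Pol B] X) (F : ι → ℝ)
    (isKL : ∀ i, IsKL (z i) (Z i) (pZ i))
    (adj : ∀ i, IsAdj 1 (f i) (f' i))
    (len : ∀ i, cs.length (z i) < cs.length w)
    (even : ∀ i, Even ((cs.length w : ℤ) - 1 - cs.length (z i)))
    (pos : ∀ i, 0 < F i * theta ((cs.length w : ℤ) - 1 - cs.length (z i)))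
    (rho_eq : ∀ m : X, (lin rho : Pol B) • m =
      X.act (lin (geo cs w rho)) m + ∑ i, F i • f' i (f i m))
    (inj : ∀ k, ∀ v ∈ barGr X k, (∀ i, barMap (adj i).left v = 0) → v = 0 ∨ k = cs.length w)
    (desc : ∀ s, cs.length (cs.simple s * w) < cs.length w → ∃ g, IsDesc s X g) : IsKL w X p

variable {X Y : Obj cs} {d : ℤ} {s : B}

lemma barMap_barJ {f : X →ₗ[Pol B] Y} (hf : f ∈ homs X Y d) (u : X.bar) :
    barMap (bsMap_mem (s := s) hf) (barJ s X u) = barJ s Y (barMap hf u) := by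
  obtain ⟨m, rfl⟩ := bk_surjective u
  rw [barMap_bk, barMap_bk, barMap_bk, barMap_bk]
  exact congrArg _ (bs_ext _ _ rfl (map_zero f))

lemma barQ_barMap {f : X →ₗ[Pol B] Y} (hf : f ∈ homs X Y d) (v : (bs cs s X).bar) :
    barQ s Y (barMap (bsMap_mem (s := s) hf) v) = barMap hf (barQ s X v) := by
  obtain ⟨m, rfl⟩ := bk_surjective v
  change Y.bk (Y.act (al s) (f m.1) + f m.2) = Y.bk (f (X.act (al s) m.1 + m.2))
  rw [map_add f, homs_act hf]

lemma bs_rho_eq {ι : Type} [Fintype ι] {Z : ι → Obj cs}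
    {f : ∀ i, X →ₗ[Pol B] Z i} {f' : ∀ i, Z i →ₗ[Pol B] X} {F : ι → ℝ} {l : Wt B}
    (h : ∀ m : X, (lin rho : Pol B) • m = X.act (lin l) m + ∑ i, F i • f' i (f i m))
    (m : bs cs s X) : (lin rho : Pol B) • m = (bs cs s X).act (lin (sref M s l)) m +
      coroot M s l • jmap s X (mmap s X m) + ∑ i, F i • bsMap s (f' i) (bsMap s (f i) m) := by
  have hl : (lin l : Pol B) = lin (sref M s l) + MvPolynomial.C (coroot M s l) * al s := by
    rw [sref_apply, map_sub, map_smul, al, MvPolynomial.smul_eq_C_mul, sub_add_cancel]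
  have hc : coroot M s (sref M s l) = -coroot M s l := by
    rw [sref_apply, map_sub, map_smul, coroot_root_self, smul_eq_mul]; ring
  refine bs_ext _ _ ?_ ?_
  · have hs : (∑ i, F i • bsMap s (f' i) (bsMap s (f i) m)).1 = ∑ i, F i • f' i (f i m.1) :=
      map_sum (LinearMap.fst (Pol B) X X) _ _
    rw [bs_fst_add, bs_fst_add, hs, bs_act_lin, hc]
    change (lin rho : Pol B) • m.1 = _ + coroot M s l • mmap s X m + _
    rw [h, hl, X.act_add, X.act_mul, X.act_C, mmap_apply]
    module
  · have hs : (∑ i, F i • bsMap s (f' i) (bsMap s (f i) m)).2 = ∑ i, F i • f' i (f i m.2) :=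
      map_sum (LinearMap.snd (Pol B) X X) _ _
    rw [bs_snd_add, bs_snd_add, hs, bs_act_lin, sref_sref]
    change (lin rho : Pol B) • m.2 = _ + coroot M s l • (0 : X) + _
    rw [h, smul_zero, add_zero]

lemma rhoE_bs {ι : Type} [Fintype ι] {Z : ι → Obj cs}
    {f : ∀ i, X →ₗ[Pol B] Z i} {f' : ∀ i, Z i →ₗ[Pol B] X} {F : ι → ℝ}
    (adj : ∀ i, IsAdj 1 (f i) (f' i)) {l : Wt B}
    (h : ∀ m : X, (lin rho : Pol B) • m = X.act (lin l) m + ∑ i, F i • f' i (f i m))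
    (v : (bs cs s X).bar) : rhoE (bs cs s X) v =
      ∑ i, F i • barMap (bsMap_mem (s := s) (adj i).right) (barMap (bsMap_mem (s := s) (adj i).left) v) +
        coroot M s l • barJ s X (barQ s X v) := by
  obtain ⟨m, rfl⟩ := bk_surjective v
  rw [rhoE_bk, bs_rho_eq h, map_add, map_add, bk_act, zero_add, map_sum, bk_smul, add_comm]
  simp only [bk_smul]
  rfl

lemma IsDesc.weakHR {g : X →ₗ[Pol B] X} (hg : IsDesc s X g) (hX : homs X X (-2) = ⊥)
    (hl : BarLef X) {n : ℤ} (hr : HR (barGr X) (barForm X) (rhoE X) n) {ζ : ℝ} (hζ : 0 ≤ ζ) :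
    WeakHR (barGr X) (barGr (bs cs s X)) (barForm (bs cs s X))
      (rhoE (bs cs s X) + ζ • barJ s X ∘ₗ barQ s X) (barJ s X) (n + 1) := by
  refine (hl.isLefExt s).weakHR_of_section hr (p := barMap hg.isAdj.left)
    (i := barMap hg.isAdj.right) (fun k v hv => barMap_mem hg.isAdj.left hv)
    (barMap_rhoE hg.isAdj.left) (fun u => ?_) (fun v => ?_) (fun u v => ?_) hζ
  · obtain ⟨m, rfl⟩ := bk_surjective u
    rw [barMap_bk, barMap_bk, desL_jmap]
  · obtain ⟨m, rfl⟩ := bk_surjective v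
    rw [barMap_bk, barMap_bk, barMap_bk, barMap_bk, ← map_add]
    conv_rhs => rw [← hg.sum_eq hX m]
    rw [map_sub, homs_act hg.isAdj.right, map_add, map_add, map_sub, al, bk_act, sub_zero]
  · exact barForm_barMap hg.isAdj.symm u v

theorem IsKL.hr_bs {w : W} {p : W →₀ ℤ[T;T⁻¹]} (h : IsKL w X p) (s : B)
    (hs : cs.length w < cs.length (cs.simple s * w)) {ζ : ℝ} (hζ : 0 ≤ ζ) :
    HR (barGr (bs cs s X)) (barForm (bs cs s X)) (rhoE (bs cs s X) + ζ • barJ s X ∘ₗ barQ s X)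
      (cs.length w + 1) := by
  induction h generalizing ζ with
  | @mk w X p one ind ι _ z Z pZ f f' F isKL adj len even pos rho_eq inj desc ih =>
  have hE := ind.lef.isLefExt s
  have weak (i : ι) {ζ : ℝ} (hζ : 0 ≤ ζ) : WeakHR (barGr (Z i)) (barGr (bs cs s (Z i)))
      (barForm (bs cs s (Z i))) (rhoE (bs cs s (Z i)) + ζ • barJ s (Z i) ∘ₗ barQ s (Z i))
      (barJ s (Z i)) (cs.length (z i) + 1) := by
    rcases lt_or_gt_of_ne (cs.length_simple_mul_ne (z i) s) with h1 | h1
    · obtain @⟨_, _, _, one', ind', _, _, _, _, _, _, _, _, _, _, _, _, _, _, _, desc'⟩ := isKL i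
      obtain ⟨g, hg⟩ := desc' s h1
      exact hg.weakHR (ind'.end_neg (by norm_num)) ind'.lef ind'.hr hζ
    · obtain @⟨_, _, _, one', ind', _⟩ := isKL i
      exact HR.weakHR ((ind'.lef.isLefExt s).deform ζ) (ih i h1 hζ)
  have hL {ζ : ℝ} (hζ : 0 ≤ ζ) : HL (barGr (bs cs s X))
      (rhoE (bs cs s X) + ζ • barJ s X ∘ₗ barQ s X) := by
    refine (hE.deform ζ).hl_of_family ind.hr (ι := ι) (f' := fun i => barMap (bsMap_mem (s := s) (adj i).right))
      (f := fun i => barMap (bsMap_mem (s := s) (adj i).left)) (F := F)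
      (g := fun i => barMap (adj i).left) (a := coroot M s (geo cs w rho) + ζ)
      (m := fun i => cs.length (z i)) (grUi := fun i => barGr (Z i))
      (grVi := fun i => barGr (bs cs s (Z i))) (formVi := fun i => barForm (bs cs s (Z i)))
      (Li := fun i => rhoE (bs cs s (Z i)) + ζ • barJ s (Z i) ∘ₗ barQ s (Z i))
      (ji := fun i => barJ s (Z i))
      (add_pos_of_pos_of_nonneg (coroot_rho_pos cs hs) hζ) (by positivity) (fun v => ?_)
      (fun i v w => ?_) (fun i v w => ?_) 
      (fun i k v hv => barMap_mem (bsMap_mem (adj i).left) hv)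
      (fun i k u hu => barMap_mem (adj i).left hu) (fun i v => ?_)
      (fun i u => barMap_barJ (adj i).left u)
      (fun i => weak i hζ) pos even inj
    · rw [LinearMap.add_apply, rhoE_bs adj rho_eq, add_smul, add_assoc]; rfl
    · obtain @⟨_, _, _, one', ind', _⟩ := isKL i
      exact (ind'.lef.isLefExt s).target.symm v w
    · exact barForm_barMap (adj i).bsMap v w
    · simp only [LinearMap.add_apply, LinearMap.smul_apply, LinearMap.comp_apply, map_add, map_smul]
      rw [barMap_rhoE, barMap_barJ (adj i).left, barQ_barMap (adj i).left]
  refine (hE.deform ζ).hr ind.hr fun ζ' hζ' => ?_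
  rw [add_assoc, ← add_smul]
  exact hL (add_nonneg hζ hζ')

end

section

variable {B W : Type} [Group W] {M : CoxeterMatrix B} {cs : CoxeterSystem M W}

attribute [local instance] wOrder

open Obj

variable {X Y N : Obj cs} {w y : W} {one : X} {p c : W →₀ ℤ[T;T⁻¹]} {n : ℤ}

lemma Char.nonneg (hc : Char X c) (u : W) (k : ℤ) : 0 ≤ (c u).coeff k := by
  have := (hc.height (lenHt_isHeight cs) u (k - cs.length u)).2
  rw [sub_add_cancel] at this
  rw [← this]
  positivity

lemma exists_complement {f : Y →ₗ[Pol B] N} {f' : N →ₗ[Pol B] Y} {a : ℝ} (ha : a ≠ 0)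
    (h : IsAdj 0 f f') (hf : ∀ y, f' (f y) = a • y) :
    ∃ (R : Obj cs) (i : R →ₗ[Pol B] N) (i' : N →ₗ[Pol B] R), Split a f f' i i' := by
  have hk (x : N) : x - a⁻¹ • f (f' x) ∈ LinearMap.ker f' := by
    rw [LinearMap.mem_ker, map_sub, LinearMap.map_smul_of_tower, hf, inv_smul_smul₀ ha, sub_self]
  let e : N →ₗ[Pol B] N := LinearMap.id - a⁻¹ • (f ∘ₗ f')
  have he : IsAdj 0 e e := by
    have h1 : IsAdj (X := N) (Y := N) 0 (f ∘ₗ f') (f ∘ₗ f') := h.comp h.symm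
    have h2 := (IsAdj.id (X := N)).add (h1.smul (-a⁻¹))
    have h3 : e = LinearMap.id + (-a⁻¹) • (f ∘ₗ f') := by rw [neg_smul, ← sub_eq_add_neg]
    rwa [← h3] at h2
  let R := N.sub (LinearMap.ker f')
    (fun r m hm => by rw [LinearMap.mem_ker] at hm ⊢; rw [homs_act h.right, hm, map_zero])
    (fun k m hm => by rw [LinearMap.mem_ker] at hm ⊢; rw [homs_pr h.right, hm, map_zero])
  let i : R →ₗ[Pol B] N := (LinearMap.ker f').subtype
  let i' : N →ₗ[Pol B] R := e.codRestrict (LinearMap.ker f') hk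
  have hi (x : R) : f' (i x) = 0 := x.2
  have hR {x x' : R} (hx : i x = i x') : x = x' := Subtype.ext hx
  refine ⟨R, i, i', ha, h, ⟨⟨fun r m => rfl, fun k m => by rw [add_zero]; rfl⟩,
    ⟨fun r m => hR (homs_act he.left r m), fun k m => hR (homs_pr he.left k m)⟩, fun m x => ?_⟩,
    hf, fun x => hR ?_, fun x => ?_⟩
  · have h1 : N.form (e (i m)) x = N.form (i m) (e x) := he.form _ _
    have h2 : e (i m) = i m := by
      change i m - a⁻¹ • f (f' (i m)) = i m
      rw [hi, map_zero, smul_zero, sub_zero]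
    rw [h2] at h1
    exact h1
  · change i x - a⁻¹ • f (f' (i x)) = i x
    rw [hi, map_zero, smul_zero, sub_zero]
  · change a⁻¹ • f (f' x) + (x - a⁻¹ • f (f' x)) = x
    abel

/-- Objects which can be split by means of the Hodge–Riemann relations. -/
structure Pre (n : ℤ) (N : Obj cs) (c : W →₀ ℤ[T;T⁻¹]) : Prop where
  good : Good N
  char : Char N c
  homChar : HomChar N c
  neg : ∀ u, ∀ k < 0, (c u).coeff k = 0
  dual : SelfDual cs c
  lef : BarLef N
  hr : HR (barGr N) (barForm N) (rhoE N) n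

lemma Ind.pre (h : Ind w X one p) : Pre (cs.length w) X p :=
  ⟨h.good, h.char, h.homChar, fun u _ hk => h.std.coeff_neg u hk, h.dual, h.lef, h.hr⟩

lemma lenHt_lt_of {u v : W} (h : cs.length u < cs.length v) : lenHt cs u < lenHt cs v :=
  Prod.Lex.toLex_lt_toLex.mpr (Or.inl h)

lemma Ind.one_mem_sup (h : Ind w X one p) : one ∈ X.sup {u | lenHt cs u ≤ lenHt cs w} := by
  refine sup_mono ?_ (h.sup one)
  rintro u (hu | rfl)
  · exact (lenHt_lt_of hu).le
  · exact le_refl (lenHt cs _)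

theorem Pre.exists_split_map (hN : Pre n N c) (h : Ind w X one p) (h0 : (c w).coeff 0 ≠ 0) :
    ∃ (a : ℝ) (f : X →ₗ[Pol B] N) (f' : N →ₗ[Pol B] X), IsAdj 0 f f' ∧ (∀ x, f' (f x) = a • x) ∧
      0 < a * theta (n - cs.length w) := by
  have hg : ∃ g ∈ N.gimg {w} {u | lenHt cs u ≤ lenHt cs w} (-cs.length w), g ≠ 0 := by
    by_contra! hg
    have h1 := (hN.char.height (lenHt_isHeight cs) w (-cs.length w)).2
    rw [neg_add_cancel] at h1
    have h2 : Subsingleton (N.gimg {w} {u | lenHt cs u ≤ lenHt cs w} (-cs.length w)) :=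
      ⟨fun x y => Subtype.ext ((hg _ x.2).trans (hg _ y.2).symm)⟩
    rw [finrank_zero_of_subsingleton] at h1
    exact h0 h1.symm
  obtain ⟨g, hg, hg0⟩ := hg
  obtain ⟨φ, φ', hφ, hφg⟩ := h.ext N hN.good g hg
  obtain ⟨a, ha⟩ := h.exists_smul (f := φ' ∘ₗ φ) (by simpa using homs_comp hφ.left hφ.right)
  have ha (x : X) : φ' (φ x) = a • x := LinearMap.congr_fun ha x
  refine ⟨a, φ, φ', hφ, ha, ?_⟩
  have hne : barMap hφ.left (X.bk one) ≠ 0 := by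
    intro h1
    rw [barMap_bk, bk_eq_zero] at h1
    have h2 := homs_gr hφ.left h.one_mem
    rw [add_zero] at h2
    refine hg0 ?_
    rw [← hφg]
    exact purity (lenHt_isHeight cs) hN.good hN.char (hN.neg w) (homs_sup hφ.left h.one_mem_sup)
      h2 (wspan_le_lspan h1)
  have hv := bk_mem_barGr h.one_mem
  have hpow : (rhoE X ^ (cs.length w + 1)) (X.bk one) = 0 := by
    refine h.lef.nondeg _ _ (h.lef.deg_pow hv _) fun v hv => ?_
    obtain ⟨m, hm, rfl⟩ := mem_barGr.mp hv
    rw [h.low _ (by push_cast; lia), Submodule.mem_bot] at hm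
    rw [hm, map_zero, map_zero]
  have h1 := h.hr (cs.length w) (X.bk one) hv hpow fun h1 => hne (by rw [h1, map_zero])
  have h2 := hN.hr (cs.length w) (barMap hφ.left (X.bk one))
    (by simpa using barMap_mem hφ.left hv) (by rw [← barMap_rhoE_pow, hpow, map_zero]) hne
  have h3 (v : X.bar) : barMap hφ.right (barMap hφ.left v) = a • v := by
    obtain ⟨m, rfl⟩ := bk_surjective v
    rw [barMap_bk, barMap_bk, ha, bk_smul]
  rw [barForm_barMap hφ, ← barMap_rhoE_pow, h3, map_smul, smul_eq_mul] at h2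
  rw [sub_self, show theta 0 = 1 by norm_num [theta], one_mul] at h1
  refine pos_of_mul_pos_left (b := barForm X (X.bk one) ((rhoE X ^ cs.length w) (X.bk one))) ?_ h1.le
  linarith

lemma Pre.remainder {f : X →ₗ[Pol B] N} {f' : N →ₗ[Pol B] X} {R : Obj cs} {i : R →ₗ[Pol B] N}
    {i' : N →ₗ[Pol B] R} {a : ℝ} (S : Split a f f' i i') (hN : Pre n N c) (h : Ind w X one p) :
    Pre n R (c - p) where
  good := S.good hN.good
  char := S.char hN.char h.char
  homChar := S.homChar hN.homChar h.homChar
  neg u k hk := by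
    rw [Finsupp.sub_apply, AddMonoidAlgebra.coeff_sub, Finsupp.sub_apply, hN.neg u k hk,
      h.std.coeff_neg u hk, sub_zero]
  dual := hN.dual.sub _ _ h.dual
  lef := hN.lef.summand S.adj' S.comp'
  hr := hN.hr.summand S.adj' S.comp'

/-- A decomposition of `N` into indecomposable objects attached to elements of `S` and a
remainder. -/
structure Dec (n : ℤ) (S : Set W) (N : Obj cs) (c : W →₀ ℤ[T;T⁻¹]) where
  R : Obj cs
  q : W →₀ ℤ[T;T⁻¹]
  i : R →ₗ[Pol B] N
  i' : N →ₗ[Pol B] R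
  ι : Type
  fin : Fintype ι
  y : ι → W
  Y : ι → Obj cs
  p : ι → W →₀ ℤ[T;T⁻¹]
  f : ∀ j, Y j →ₗ[Pol B] N
  f' : ∀ j, N →ₗ[Pol B] Y j
  a : ι → ℝ
  pre : Pre n R q
  adj_i : IsAdj 0 i i'
  comp_i : ∀ x, i' (i x) = x
  coeff_q : ∀ u ∈ S, (q u).coeff 0 = 0
  q_eq : ∀ u, (∀ y ∈ S, cs.length y < cs.length u) → q u = c u
  mem : ∀ j, y j ∈ S
  isKL : ∀ j, IsKL (y j) (Y j) (p j)
  adj : ∀ j, IsAdj 0 (f j) (f' j)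
  comp : ∀ j x, f' j (f j x) = a j • x
  pos : ∀ j, 0 < a j * theta (n - cs.length (y j))
  sum : ∀ x, ∑ j, (a j)⁻¹ • f j (f' j x) + i (i' x) = x

/-- The total multiplicity in degree zero. -/
def mult (c : W →₀ ℤ[T;T⁻¹]) : ℤ := c.sum fun _ a => a.coeff 0

omit [Group W] in
lemma mult_sub (c p : W →₀ ℤ[T;T⁻¹]) : mult (c - p) = mult c - mult p :=
  Finsupp.sum_sub_index fun _ a b => by rw [AddMonoidAlgebra.coeff_sub, Finsupp.sub_apply]

omit [Group W] in
lemma IsStd.mult (h : IsStd w p) : mult p = 1 := by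
  classical
  rw [KL.mult, Finsupp.sum, Finset.sum_eq_single w, h.coeff_self]
  · exact fun u _ hu => h.ne u hu 0 le_rfl
  · intro h1
    rw [Finsupp.notMem_support_iff.mp h1]
    rfl

theorem nonempty_dec (S : Set W) (hS : ∀ y ∈ S, ∃ (Y : Obj cs) (p : W →₀ ℤ[T;T⁻¹]), IsKL y Y p)
    (hN : Pre n N c) : Nonempty (Dec n S N c) := by
  have h0 : 0 ≤ mult c := Finset.sum_nonneg fun u _ => hN.char.nonneg u 0
  obtain ⟨k, hk⟩ := Int.eq_ofNat_of_zero_le h0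
  clear h0
  induction k generalizing N c with
  | zero =>
    refine ⟨⟨N, c, LinearMap.id, LinearMap.id, Empty, inferInstance, Empty.elim, fun j => j.elim,
      fun j => j.elim, fun j => j.elim, fun j => j.elim, Empty.elim, hN, IsAdj.id, fun _ => rfl,
      fun u _ => ?_, fun _ _ => rfl, fun j => j.elim, fun j => j.elim, fun j => j.elim,
      fun j => j.elim, fun j => j.elim, fun x => by simp⟩⟩
    by_cases hu : u ∈ c.support
    · exact (Finset.sum_eq_zero_iff_of_nonneg fun u _ => hN.char.nonneg u 0).mp hk u hu
    · rw [Finsupp.notMem_support_iff.mp hu]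
      rfl
  | succ k ih =>
    by_cases h1 : ∀ u ∈ S, (c u).coeff 0 = 0
    · exact ⟨⟨N, c, LinearMap.id, LinearMap.id, Empty, inferInstance, Empty.elim, fun j => j.elim,
        fun j => j.elim, fun j => j.elim, fun j => j.elim, Empty.elim, hN, IsAdj.id, fun _ => rfl,
        h1, fun _ _ => rfl, fun j => j.elim, fun j => j.elim, fun j => j.elim,
        fun j => j.elim, fun j => j.elim, fun x => by simp⟩⟩
    push Not at h1
    obtain ⟨w, hw, h1⟩ := h1
    obtain ⟨X, p, hX⟩ := hS w hw
    obtain ⟨one, h⟩ : ∃ one, Ind w X one p := by obtain ⟨one, h⟩ := hX; exact ⟨one, h⟩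
    obtain ⟨a, f, f', hf, hff, ha⟩ := hN.exists_split_map h h1
    obtain ⟨R, i, i', hS⟩ := exists_complement (left_ne_zero_of_mul ha.ne') hf hff
    obtain ⟨D⟩ := ih (hN.remainder hS h)
      (by rw [mult_sub, h.std.mult, hk]; push_cast; ring)
    let := D.fin
    refine ⟨⟨D.R, D.q, i ∘ₗ D.i, D.i' ∘ₗ i', Option D.ι, inferInstance, fun j => j.elim w D.y,
      fun j => match j with | none => X | some j => D.Y j,
      fun j => match j with | none => p | some j => D.p j,
      fun j => match j with | none => f | some j => i ∘ₗ D.f j,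
      fun j => match j with | none => f' | some j => D.f' j ∘ₗ i',
      fun j => match j with | none => a | some j => D.a j, D.pre, ?_, fun x => ?_, D.coeff_q,
      fun u hu => ?_, fun j => ?_, fun j => ?_, fun j => ?_, fun j => ?_, fun j => ?_,
      fun x => ?_⟩⟩
    · exact hS.adj'.comp D.adj_i
    · exact (congrArg D.i' (hS.comp' _)).trans (D.comp_i x)
    · rw [D.q_eq u hu, Finsupp.sub_apply, sub_eq_self]
      by_contra h2
      have h3 := hu w hw
      have h4 := h.len u (by rintro rfl; exact h3.ne rfl) h2
      exact lt_asymm h3 h4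
    · cases j with
      | none => exact hw
      | some j => exact D.mem j
    · cases j with
      | none => exact hX
      | some j => exact D.isKL j
    · cases j with
      | none => exact hf
      | some j => exact hS.adj'.comp (D.adj j)
    · cases j with
      | none => exact hff
      | some j => exact fun x => (congrArg (D.f' j) (hS.comp' _)).trans (D.comp j x)
    · cases j with
      | none => exact ha
      | some j => exact D.pos j
    · rw [Fintype.sum_option]
      conv_rhs => rw [← hS.sum x, ← D.sum (i' x), map_add, map_sum]
      simp only [LinearMap.map_smul_of_tower, LinearMap.comp_apply, add_assoc]

end

section

variable {B W : Type} [Group W] {M : CoxeterMatrix B} {cs : CoxeterSystem M W}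

attribute [local instance] wOrder

open Obj

variable {X Y N P : Obj cs} {w x y : W} {one : X} {p c : W →₀ ℤ[T;T⁻¹]} {n : ℤ} {s : B}

lemma Good.gimg_pht (hP : Good P) (s : B) (w : W) :
    P.gimg {w} {u | lenHt cs u ≤ lenHt cs w} = P.gimg {w} {u | pht cs s u ≤ pht cs s w} := by
  have hs := pht_isHeight cs s
  have hl := lenHt_isHeight cs
  exact gimg_congr (img_eq_of_top hs (hP.height hs) (hl.closed _) (Set.mem_ofPred.mpr le_rfl)
    (hl.top w))

theorem Ind.ext_bs (h : Ind x X one p) (hs : cs.length x < cs.length (cs.simple s * x))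
    (hP : Good P) {g : P.loc {cs.simple s * x}}
    (hg : g ∈ P.gimg {cs.simple s * x} {u | lenHt cs u ≤ lenHt cs (cs.simple s * x)}
      (-cs.length (cs.simple s * x))) :
    ∃ φ φ', IsAdj (X := bs cs s X) (Y := P) 0 φ φ' ∧
      P.ev {cs.simple s * x} (φ (sndY s X one)) = g := by
  rw [hP.gimg_pht s, pht_simple_le_eq hs] at hg
  obtain ⟨m, hm, hk, rfl⟩ := mem_gimg.mp hg
  have hu := extY_mem (s := s) (y := x) (fun f hf => simple_mul_mem_low hs hf) hm
  have hk' : extY s P x m ∈ (bs cs s P).gr (-cs.length x) := by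
    have := extY_gr (s := s) (y := x) hk
    rwa [show -(cs.length (cs.simple s * x) : ℤ) + 1 = -cs.length x by
      rw [length_up hs]; push_cast; ring] at this
  have hg' : (bs cs s P).ev {x} (extY s P x m) ∈
      (bs cs s P).gimg {x} {u | lenHt cs u ≤ lenHt cs x} (-cs.length x) := by
    rw [(good_bs hP s).gimg_pht s, pht_le_eq]
    exact mem_gimg.mpr ⟨_, hu, hk', rfl⟩
  obtain ⟨e, e', he, hee⟩ := h.ext _ (good_bs hP s) _ hg'
  refine ⟨_, _, he.adjL, ?_⟩
  have h1 : adjL s e (sndY s X one) = (e one).1 := by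
    rw [adjL_apply, sndY_fst, sndY_snd, map_zero]
    exact (congrArg (· + (e one).1)
      (by change P.act (al s) (0 : P) + (0 : P) = 0; rw [map_zero, add_zero])).trans (zero_add _)
  have h2 : e one - extY s P x m ∈ (bs cs s P).sup {x}ᶜ := ev_eq.mp hee
  have h3 : e one ∈ (bs cs s P).sup {cs.simple s * x}ᶜ := by
    refine sup_mono ?_ (homs_sup he.left (h.sup one))
    rintro u (h3 | h3) h4 <;> rw [Set.mem_singleton_iff.mp h4] at h3
    · exact lt_asymm hs h3
    · exact hs.ne (congrArg cs.length (Set.mem_singleton_iff.mp h3).symm)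
  have h4 : extY s P x m ∈ (bs cs s P).sup {cs.simple s * x}ᶜ := by
    refine sup_mono ?_ hu
    rintro u (h3 | h3) h4 <;> rw [Set.mem_singleton_iff.mp h4] at h3
    · exact simple_mul_notMem_low hs h3
    · exact hs.ne (congrArg cs.length (Set.mem_singleton_iff.mp h3).symm)
  have h5 := mem_sup_inter h2 (Submodule.sub_mem _ h3 h4)
  rw [mem_sup_bs_stable] at h5
  · rw [h1, ev_eq]
    exact sup_mono Set.inter_subset_right h5.1
  · rintro f ⟨h6, h7⟩
    refine ⟨fun h8 => h7 ?_, fun h8 => h6 ?_⟩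
    · rw [Set.mem_singleton_iff] at h8 ⊢
      rw [← h8, cs.simple_mul_simple_cancel_left]
    · exact mul_left_cancel h8

lemma IsStd.bsC_self (h : IsStd x p) (hl : ∀ u ≠ x, p u ≠ 0 → cs.length u < cs.length x)
    (hs : cs.length x < cs.length (cs.simple s * x)) : bsC cs s p (cs.simple s * x) = 1 := by
  rw [bsC_down p hs, h.self]
  have : p (cs.simple s * x) = 0 := by
    by_contra h0
    exact lt_asymm hs (hl _ (fun he => hs.ne (congrArg _ he.symm)) h0)
  rw [this, mul_zero, zero_add]

lemma bsC_ne_zero (hl : ∀ u ≠ x, p u ≠ 0 → cs.length u < cs.length x) {u : W}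
    (hu : u ≠ cs.simple s * x) (h : bsC cs s p u ≠ 0) : cs.length u ≤ cs.length x := by
  have hl' (v : W) (hv : p v ≠ 0) : cs.length v ≤ cs.length x := by
    rcases eq_or_ne v x with rfl | h1
    · exact le_rfl
    · exact (hl v h1 hv).le
  rw [bsC_apply] at h
  by_cases h1 : p u = 0
  · rw [h1, mul_zero, zero_add] at h
    have h2 := hl _ (fun h3 => hu (by rw [← h3, cs.simple_mul_simple_cancel_left])) h
    have h3 := cs.length_simple_mul u s
    lia
  · exact hl' u h1

lemma IsKL.exists_ind (h : IsKL w X p) : ∃ one, Ind w X one p := by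
  obtain ⟨one, h⟩ := h
  exact ⟨one, h⟩

lemma IsKL.pre_bs (h : IsKL x X p) (hs : cs.length x < cs.length (cs.simple s * x)) :
    Pre (cs.length x + 1) (bs cs s X) (bsC cs s p) := by
  obtain ⟨one, hi⟩ := h.exists_ind
  refine ⟨good_bs hi.good s, char_bs hi.good hi.char s, hi.homChar.bs s, fun u k hk => ?_,
    hi.dual.bs s, (hi.lef.isLefExt s).target, ?_⟩
  · rcases simple_cases (cs := cs) s u with hu | ⟨u, rfl, hu⟩
    · rw [bsC_up p hu, AddMonoidAlgebra.coeff_add, Finsupp.add_apply, coeff_T_mul,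
        hi.std.coeff_neg _ hk, hi.std.coeff_neg _ (by lia), add_zero]
    · rw [bsC_down p hu, AddMonoidAlgebra.coeff_add, Finsupp.add_apply, coeff_T_mul,
        hi.std.coeff_neg _ hk, hi.std.ne _ _ _ (by lia), add_zero]
      rintro rfl
      rw [cs.simple_mul_simple_cancel_left] at hs
      exact lt_asymm hs hu
  · have := h.hr_bs s hs (le_refl 0)
    rwa [zero_smul, add_zero] at this

/-- Complete decompositions. -/
theorem IsKL.exists_dec {m : ℕ} (hm : ∀ w, cs.length w ≤ m + 1 →
      ∃ (Y : Obj cs) (q : W →₀ ℤ[T;T⁻¹]), IsKL w Y q)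
    (h : IsKL x X p) (hx : cs.length x ≤ m) (hs : cs.length x < cs.length (cs.simple s * x)) :
    ∃ D : Dec (cs.length x + 1) {u | cs.length u ≤ m + 1} (bs cs s X) (bsC cs s p),
      ∀ r : D.R, r = 0 := by
  obtain ⟨one, hi⟩ := h.exists_ind
  obtain ⟨D⟩ := nonempty_dec _ hm (h.pre_bs hs)
  refine ⟨D, eq_zero_of_coeff D.pre.good D.pre.char D.pre.homChar fun u k hk => ?_⟩
  rcases hk.eq_or_lt with rfl | hk
  · rcases le_or_gt (cs.length u) (m + 1) with hu | hu
    · exact D.coeff_q u hu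
    · rw [D.q_eq u fun y hy => lt_of_le_of_lt hy hu]
      by_contra h0
      have := bsC_ne_zero (s := s) hi.len (u := u)
        (by rintro rfl; rw [length_up hs] at hu; lia) (by rintro h1; rw [h1] at h0; exact h0 rfl)
      lia
  · exact D.pre.neg u k hk

end

section

variable {B W : Type} [Group W] {M : CoxeterMatrix B} {cs : CoxeterSystem M W}

attribute [local instance] wOrder

open Obj

variable {X Y N P : Obj cs} {w x y : W} {one : X} {p c : W →₀ ℤ[T;T⁻¹]} {n : ℤ} {s : B}

lemma bs_mem_sup (h : ∀ m, m ∈ X.sup {u | cs.length u < cs.length x ∨ u = x})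
    (hs : cs.length x < cs.length (cs.simple s * x)) (m : bs cs s X) :
    m ∈ (bs cs s X).sup {u | cs.length u < cs.length (cs.simple s * x) ∨ u = cs.simple s * x} := by
  refine mem_sup_bs.mpr ⟨sup_mono ?_ (h _), sup_mono ?_ (h _)⟩
  · rintro u (hu | rfl)
    · exact Or.inl (hu.trans hs)
    · exact Or.inl hs
  · rintro u (hu | rfl)
    · refine Or.inl ?_
      rw [length_up hs]
      have := cs.length_simple_mul u s
      lia
    · exact Or.inr rfl

lemma bs_gr_eq_bot (h : Ind x X one p) (hs : cs.length x < cs.length (cs.simple s * x)) {k : ℤ}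
    (hk : k < -(cs.length (cs.simple s * x) : ℤ)) {m : bs cs s X} (hm : m ∈ (bs cs s X).gr k) :
    m = 0 := by
  have hl := length_up hs
  obtain ⟨h1, h2⟩ := mem_gr_bs.mp hm
  rw [h.low _ (by lia)] at h1 h2
  exact bs_ext _ _ h1 h2

lemma bs_gr_neg (h : Ind x X one p) (hs : cs.length x < cs.length (cs.simple s * x)) {m : bs cs s X}
    (hm : m ∈ (bs cs s X).gr (-cs.length (cs.simple s * x))) : ∃ a : ℝ, m = a • sndY s X one := by
  have hl := length_up hs
  obtain ⟨h1, h2⟩ := mem_gr_bs.mp hm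
  rw [h.low _ (by lia)] at h1
  rw [hl, show (-((cs.length x + 1 : ℕ) : ℤ) + 1) = -cs.length x by push_cast; ring] at h2
  obtain ⟨a, ha⟩ := h.gr_one _ h2
  refine ⟨a, bs_ext _ _ ?_ ha⟩
  change _ = a • (0 : X)
  rw [smul_zero]
  exact h1

lemma sndY_mem_gr (h : Ind x X one p) (hs : cs.length x < cs.length (cs.simple s * x)) :
    sndY s X one ∈ (bs cs s X).gr (-cs.length (cs.simple s * x)) := by
  have hl := length_up hs
  refine mem_gr_bs.mpr ⟨Submodule.zero_mem _, ?_⟩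
  rw [hl, show (-((cs.length x + 1 : ℕ) : ℤ) + 1) = -cs.length x by push_cast; ring]
  exact h.one_mem

lemma Ind.bs_parity (h : Ind x X one p) {k : ℤ} {m : bs cs s X} (hm : m ∈ (bs cs s X).gr k)
    (h0 : m ≠ 0) : Even (k - cs.length x - 1) := by
  obtain ⟨h1, h2⟩ := mem_gr_bs.mp hm
  have hX {j : ℤ} {a : X} (ha : a ∈ X.gr j) (h0 : a ≠ 0) : Even (j - cs.length x) :=
    h.parity j fun hb => h0 (by rwa [hb] at ha)
  by_cases h3 : m.1 = 0
  · have h4 : m.2 ≠ 0 := fun h4 => h0 (bs_ext _ _ h3 h4)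
    have := hX h2 h4
    rw [show k + 1 - cs.length x = k - cs.length x - 1 + 2 by ring] at this
    simpa [Int.even_add] using this
  · have := hX h1 h3
    rwa [show k - 1 - cs.length x = k - cs.length x - 1 by ring] at this

theorem Ind.remainder (h : Ind x X one p) (hs : cs.length x < cs.length (cs.simple s * x))
    (D : Dec (cs.length x + 1) {u | cs.length u ≤ cs.length x} (bs cs s X) (bsC cs s p)) :
    Ind (cs.simple s * x) D.R (D.i' (sndY s X one)) D.q := by
  let := D.fin
  have hl := length_up hs
  have hgr {r : D.R} {k : ℤ} (hr : r ∈ D.R.gr k) : D.i r ∈ (bs cs s X).gr k := by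
    simpa using homs_gr D.adj_i.left hr
  have hgr' {m : bs cs s X} {k : ℤ} (hm : m ∈ (bs cs s X).gr k) : D.i' m ∈ D.R.gr k := by
    simpa using homs_gr D.adj_i.right hm
  have hinj {r : D.R} (hr : D.i r = 0) : r = 0 := by rw [← D.comp_i r, hr, map_zero]
  have hq {u : W} (hu : cs.length x < cs.length u) : D.q u = bsC cs s p u :=
    D.q_eq u fun y hy => lt_of_le_of_lt hy hu
  have hone : D.i (D.i' (sndY s X one)) = sndY s X one := by
    conv_rhs => rw [← D.sum (sndY s X one)]
    rw [Finset.sum_eq_zero, zero_add]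
    intro j _
    have h1 := homs_gr (D.adj j).right (sndY_mem_gr h hs)
    obtain ⟨_, h2⟩ := (D.isKL j).exists_ind
    have h3 := D.mem j
    rw [Set.mem_ofPred] at h3
    rw [h2.low _ (by lia), Submodule.mem_bot] at h1
    rw [h1, map_zero, smul_zero]
  refine ⟨D.pre.good, D.pre.char, D.pre.homChar, ⟨?_, ?_⟩, ?_, D.pre.dual, D.pre.lef, ?_, ?_,
    hgr' (sndY_mem_gr h hs), ?_, ?_, ?_, ?_, ?_⟩
  · rw [hq hs, h.std.bsC_self h.len hs]
  · intro u hu k hk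
    rcases hk.eq_or_lt with rfl | hk
    · rcases le_or_gt (cs.length u) (cs.length x) with h1 | h1
      · exact D.coeff_q u h1
      · rw [hq h1]
        by_contra h2
        exact absurd (bsC_ne_zero h.len hu fun h3 => h2 (by rw [h3]; rfl)) (not_le.mpr h1)
    · exact D.pre.neg u k hk
  · intro u hu h0
    by_contra! h1
    rw [hq (by lia)] at h0
    have := bsC_ne_zero h.len hu h0
    lia
  · have := D.pre.hr
    rw [hl]
    push_cast
    exact this
  · intro k hk
    rw [Submodule.eq_bot_iff]
    exact fun r hr => hinj (bs_gr_eq_bot h hs hk (hgr hr))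
  · intro h0
    rw [h0, map_zero] at hone
    exact h.one_ne (congrArg Prod.snd hone.symm)
  · intro r hr
    obtain ⟨a, ha⟩ := bs_gr_neg h hs (hgr hr)
    refine ⟨a, ?_⟩
    rw [← D.comp_i r, ha, LinearMap.map_smul_of_tower]
  · intro k hk
    obtain ⟨r, hr, h0⟩ := (Submodule.ne_bot_iff _).mp hk
    have := h.bs_parity (hgr hr) fun h1 => h0 (hinj h1)
    rw [hl]
    push_cast
    rwa [← sub_sub]
  · intro r
    rw [← D.comp_i r]
    exact homs_sup D.adj_i.right (bs_mem_sup h.sup hs _)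
  · intro P hP g hg
    obtain ⟨φ, φ', h1, h2⟩ := h.ext_bs hs hP hg
    refine ⟨φ ∘ₗ D.i, D.i' ∘ₗ φ', by simpa using h1.comp D.adj_i, ?_⟩
    rw [LinearMap.comp_apply, hone, h2]

end

section

variable {B W : Type} [Group W] {M : CoxeterMatrix B} {cs : CoxeterSystem M W}

attribute [local instance] wOrder

open Obj

variable {X Y Z N P : Obj cs} {w x y z : W} {one : X} {p q c : W →₀ ℤ[T;T⁻¹]} {n : ℤ} {s : B}

lemma IsKL.exists_isDesc (h : IsKL w X p) (hs : cs.length (cs.simple s * w) < cs.length w) :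
    ∃ g, IsDesc s X g := by
  obtain @⟨_, _, _, _, _, _, _, _, _, _, _, _, _, _, _, _, _, _, _, _, desc⟩ := h
  exact desc s hs

/-- A descent of the target kills the composition with a map from an indecomposable object. -/
lemma IsKL.bsMap_eq_desR {R : Obj cs} {one' : R} (hR : Ind w R one' q) (hZ : IsKL z Z p)
    (hne : w ≠ z) {g : Z →ₗ[Pol B] Z} (hg : IsDesc s Z g) {i : R →ₗ[Pol B] bs cs s X}
    (hi : i ∈ homs R (bs cs s X) 0) {f : X →ₗ[Pol B] Z} (hf : f ∈ homs X Z 1) (m : R) :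
    desL g (bsMap s f (i m)) = 0 := by
  obtain ⟨one, hI⟩ := hZ.exists_ind
  have h1 := homs_comp (homs_comp hi (bsMap_mem (s := s) hf)) hg.isAdj.left
  rw [hR.hom_eq_zero hI hne (by norm_num), Submodule.mem_bot] at h1
  exact LinearMap.congr_fun h1 m

lemma IsKL.desR_eq_zero {R : Obj cs} {one' : R} (hR : Ind w R one' q) (hZ : IsKL z Z p)
    (hne : w ≠ z) {g : Z →ₗ[Pol B] Z} (hg : IsDesc s Z g) {i' : bs cs s X →ₗ[Pol B] R}
    (hi : i' ∈ homs (bs cs s X) R 0) {f' : Z →ₗ[Pol B] X} (hf : f' ∈ homs Z X 1) (m : Z) :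
    i' (bsMap s f' (desR g m)) = 0 := by
  obtain ⟨one, hI⟩ := hZ.exists_ind
  have h1 := homs_comp (homs_comp hg.isAdj.right (bsMap_mem (s := s) hf)) hi
  rw [hI.hom_eq_zero hR hne.symm (by norm_num), Submodule.mem_bot] at h1
  exact LinearMap.congr_fun h1 m

lemma theta_pos_aux {a b F r : ℝ} (h : 0 < F * a) (h' : 0 < r * b) : 0 < F * r⁻¹ * (a * b) := by
  have hb : r ≠ 0 := by rintro rfl; simp at h'
  have h1 : 0 < r⁻¹ * b := by
    have : r⁻¹ * b = r * b * (r⁻¹ * r⁻¹) := by field_simp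
    rw [this]
    exact mul_pos h' (mul_self_pos.mpr (inv_ne_zero hb))
  linarith [mul_pos h h1]

theorem IsKL.exists_up (h : IsKL x X p) (hs : cs.length x < cs.length (cs.simple s * x))
    (hA : ∀ w, cs.length w ≤ cs.length x → ∃ (Y : Obj cs) (q : W →₀ ℤ[T;T⁻¹]), IsKL w Y q) :
    ∃ (R : Obj cs) (q : W →₀ ℤ[T;T⁻¹]), IsKL (cs.simple s * x) R q := by
  classical
  have hl := length_up hs
  obtain ⟨D⟩ := nonempty_dec {u | cs.length u ≤ cs.length x} hA (h.pre_bs hs)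
  have hX := h
  obtain @⟨_, _, _, one, ind, ι, _, z, Z, pZ, f, f', F, isKL, adj, len, even, pos, rho_eq, inj,
    desc⟩ := h
  have hI := ind.remainder hs D
  have hE (k : {k // cs.length (z k) < cs.length (cs.simple s * z k)}) := (isKL k).exists_dec
    (fun w hw => hA w (hw.trans (len k))) le_rfl k.2
  choose E hE using hE
  let : ∀ k, Fintype (E k).ι := fun k => (E k).fin
  have hne (k : ι) : cs.simple s * x ≠ z k := fun he => by
    have := len k
    rw [← he] at this
    lia
  have hsum (k) (m : bs cs s (Z k.1)) : ∑ a, ((E k).a a)⁻¹ • (E k).f a ((E k).f' a m) = m := by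
    conv_rhs => rw [← (E k).sum m, hE k ((E k).i' m), map_zero, add_zero]
  have adj_none : IsAdj 1 (mmap s X ∘ₗ D.i) (D.i' ∘ₗ jmap s X) := by
    have := (isAdj_jmap (X := X) s).symm.comp D.adj_i
    rwa [zero_add] at this
  have adj_some (k) (a) : IsAdj 1 ((E k).f' a ∘ₗ bsMap s (f k.1) ∘ₗ D.i)
      (D.i' ∘ₗ bsMap s (f' k.1) ∘ₗ (E k).f a) := by
    have := ((E k).adj a).symm.comp ((adj k.1).bsMap.comp D.adj_i)
    rwa [zero_add, add_zero] at this
  have hdown (k : ι) (hk : ¬cs.length (z k) < cs.length (cs.simple s * z k)) :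
      ∃ g, IsDesc s (Z k) g :=
    (isKL k).exists_isDesc ((not_lt.mp hk).lt_of_ne (cs.length_simple_mul_ne _ s))
  have hend (k : ι) : homs (Z k) (Z k) (-2) = ⊥ := by
    obtain ⟨_, hI'⟩ := (isKL k).exists_ind
    exact hI'.end_neg (by norm_num)
  have hparity (k) (a) : Even ((cs.length (z k.1) : ℤ) + 1 - cs.length ((E k).y a)) := by
    obtain ⟨_, h1⟩ := (isKL k.1).exists_ind
    obtain ⟨o, h2⟩ := ((E k).isKL a).exists_ind
    have h3 := homs_gr ((E k).adj a).left h2.one_mem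
    rw [add_zero] at h3
    have ha : (E k).a a ≠ 0 := fun h0 => by simpa [h0] using (E k).pos a
    have h4 := h1.bs_parity h3 fun h0 => by
      have := (E k).comp a o
      rw [h0, map_zero] at this
      exact (smul_ne_zero ha h2.one_ne) this.symm
    have h5 := h4.add (even_two_mul ((cs.length (z k.1) : ℤ) + 1))
    refine Eq.mpr (congrArg Even ?_) h5
    ring
  refine ⟨D.R, D.q, .mk (D.i' (sndY s X one)) hI (Option (Σ k, (E k).ι))
    (fun o => o.elim x fun a => (E a.1).y a.2) (fun o => o.elim X fun a => (E a.1).Y a.2)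
    (fun o => o.elim p fun a => (E a.1).p a.2)
    (fun o => match o with
      | none => mmap s X ∘ₗ D.i
      | some a => (E a.1).f' a.2 ∘ₗ bsMap s (f a.1) ∘ₗ D.i)
    (fun o => match o with
      | none => D.i' ∘ₗ jmap s X
      | some a => D.i' ∘ₗ bsMap s (f' a.1) ∘ₗ (E a.1).f a.2)
    (fun o => o.elim (coroot M s (geo cs x rho)) fun a => F a.1 * ((E a.1).a a.2)⁻¹)
    ?_ ?_ ?_ ?_ ?_ ?_ ?_ ?_⟩
  · rintro (_ | a)
    · exact hX
    · exact (E a.1).isKL a.2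
  · rintro (_ | a)
    · exact adj_none
    · exact adj_some a.1 a.2
  · rintro (_ | a)
    · exact hs
    · have h1 := (E a.1).mem a.2
      have h2 := len a.1
      simp only [Set.mem_ofPred] at h1
      change cs.length ((E a.1).y a.2) < _
      lia
  · rintro (_ | a)
    · rw [hl]
      simp
    · have h1 := (even a.1).add (hparity a.1 a.2)
      change Even ((cs.length _ : ℤ) - 1 - cs.length ((E a.1).y a.2))
      rw [hl]
      refine Eq.mpr (congrArg Even ?_) h1
      push_cast
      ring
  · rintro (_ | a)
    · change 0 < coroot M s (geo cs x rho) * theta ((cs.length _ : ℤ) - 1 - cs.length x)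
      rw [hl]
      have : theta (((cs.length x + 1 : ℕ) : ℤ) - 1 - cs.length x) = 1 := by
        push_cast
        simp [theta]
      rw [this, mul_one]
      exact coroot_rho_pos cs hs
    · have := theta_pos_aux (pos a.1) ((E a.1).pos a.2)
      rw [← theta_even_add (even a.1)] at this
      change 0 < F a.1 * ((E a.1).a a.2)⁻¹ * theta ((cs.length _ : ℤ) - 1 - cs.length ((E a.1).y a.2))
      have e : ((cs.length (cs.simple s * x) : ℕ) : ℤ) - 1 - cs.length ((E a.1).y a.2) =
          cs.length x - 1 - cs.length (z a.1) + (cs.length (z a.1) + 1 - cs.length ((E a.1).y a.2)) := by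
        rw [hl]
        push_cast
        ring
      rw [e]
      exact this
  · intro m
    have h1 := congrArg D.i' (bs_rho_eq (s := s) rho_eq (D.i m))
    rw [map_add, map_add, map_smul, D.comp_i, homs_act D.adj_i.right, D.comp_i,
      LinearMap.map_smul_of_tower, map_sum] at h1
    rw [Fintype.sum_option, Fintype.sum_sigma, h1, add_assoc, geo_mul_apply, geo_simple]
    congr 2
    rw [← Fintype.sum_subtype_add_sum_subtype (fun k => cs.length (z k) < cs.length (cs.simple s * z k)),
      Finset.sum_eq_zero (s := (Finset.univ : Finset {k // ¬_})), add_zero]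
    · refine Finset.sum_congr rfl fun k _ => ?_
      conv_lhs => rw [← hsum k (bsMap s (f k.1) (D.i m))]
      rw [map_sum, LinearMap.map_smul_of_tower, map_sum, Finset.smul_sum]
      refine Finset.sum_congr rfl fun a _ => ?_
      rw [LinearMap.map_smul_of_tower, LinearMap.map_smul_of_tower, smul_smul]
      rfl
    · rintro ⟨k, hk⟩ _
      obtain ⟨g, hg⟩ := hdown k hk
      have h2 := IsKL.bsMap_eq_desR hI (isKL k) (hne k) hg D.adj_i.left (adj k).left m
      have h3 := hg.eq_desR (hend k) h2
      have h4 := IsKL.desR_eq_zero hI (isKL k) (hne k) hg D.adj_i.right (adj k).right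
        (mmap s (Z k) (bsMap s (f k) (D.i m)))
      rw [← h3] at h4
      rw [LinearMap.map_smul_of_tower, h4, smul_zero]
  · intro j v hv h0
    obtain ⟨m, hm, rfl⟩ := mem_barGr.mp hv
    have h1 : barQ s X (barMap D.adj_i.left (D.R.bk m)) = 0 := h0 none
    have h2 := barMap_mem D.adj_i.left hv
    rw [add_zero] at h2
    obtain ⟨u, hu, huv⟩ := exists_barJ_gr s h2 h1
    have h3 (k : ι) : barMap (adj k).left u = 0 := by
      by_cases hk : cs.length (z k) < cs.length (cs.simple s * z k)
      · obtain ⟨_, h4⟩ := (isKL k).exists_ind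
        refine (h4.lef.isLefExt s).j_inj _ _ (barMap_mem (adj k).left hu) ?_
        rw [← barMap_barJ, huv, barMap_bk, barMap_bk, ← hsum ⟨k, hk⟩ (bsMap s (f k) (D.i m)), map_sum]
        refine Finset.sum_eq_zero fun a _ => ?_
        have h5 : ((E ⟨k, hk⟩).Y a).bk ((E ⟨k, hk⟩).f' a (bsMap s (f k) (D.i m))) = 0 :=
          h0 (some ⟨⟨k, hk⟩, a⟩)
        rw [bk_smul, ← barMap_bk ((E ⟨k, hk⟩).adj a).left, h5, map_zero, smul_zero]
      · obtain ⟨g, hg⟩ := hdown k hk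
        have h4 := IsKL.bsMap_eq_desR hI (isKL k) (hne k) hg D.adj_i.left (adj k).left m
        have h5 : barMap hg.isAdj.left (barJ s (Z k) (barMap (adj k).left u)) = 0 := by
          rw [← barMap_barJ, huv, barMap_bk, barMap_bk, barMap_bk, h4, map_zero]
        obtain ⟨b, hb⟩ := bk_surjective (barMap (adj k).left u)
        rw [← hb, barMap_bk, barMap_bk, desL_jmap] at h5
        rw [← hb, h5]
    rcases inj _ u hu h3 with h4 | h4
    · left
      rw [h4, map_zero] at huv
      have h5 := congrArg (barMap D.adj_i.right) huv
      rw [map_zero, barMap_bk, barMap_bk, D.comp_i] at h5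
      exact h5.symm
    · right
      rw [hl]
      push_cast
      linarith
  · intro t ht
    have ht' : cs.length (cs.simple t * (cs.simple s * x)) <
        cs.length (cs.simple t * (cs.simple t * (cs.simple s * x))) := by
      rwa [cs.simple_mul_simple_cancel_left]
    obtain ⟨X', p', h'⟩ := hA (cs.simple t * (cs.simple s * x)) (by lia)
    obtain ⟨_, h1⟩ := h'.exists_ind
    have h2 := h1.std.bsC_self h1.len ht'
    rw [cs.simple_mul_simple_cancel_left] at h2
    obtain ⟨a, e, e', he, ha, hpos⟩ := (h'.pre_bs ht').exists_split_map hI (by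
      rw [h2, AddMonoidAlgebra.one_def, AddMonoidAlgebra.coeff_single, Finsupp.single_eq_same]
      exact one_ne_zero)
    exact ⟨_, (isDesc_bsD t X').summand (fun h0 => by simp [h0] at hpos) he ha⟩

end

section

variable {B W : Type} [Group W] {M : CoxeterMatrix B} {cs : CoxeterSystem M W}

attribute [local instance] wOrder

open Obj

/-! ### The indecomposable object attached to the identity -/

variable {X P : Obj cs} {k : ℤ}

lemma mem_unit_sup {J : Set W} (h : 1 ∈ J) (m : unit cs) : m ∈ (unit cs).sup J := by
  rw [unit_sup_of_mem h]
  trivial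

lemma unit_act (r p : Pol B) : (unit cs).act r (p • u1 cs) = (r * p) • u1 cs := by
  rw [act_smul, act_of_mem_sup_one u1_mem_sup, smul_smul, mul_comm]

lemma unit_form (p q : Pol B) : (unit cs).form (p • u1 cs) q = p * q :=
  congrArg (· * q) (mul_one p)

lemma unit_bk (p : Pol B) :
    (unit cs).bk (p • u1 cs) = MvPolynomial.constantCoeff p • (unit cs).bk (u1 cs) := by
  induction p using MvPolynomial.induction_on with
  | C a => rw [C_smul, bk_smul, MvPolynomial.constantCoeff_C]
  | add p q hp hq => rw [add_smul, map_add, hp, hq, map_add, add_smul]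
  | mul_X p o _ =>
    rw [mul_comm, ← lin_single, ← unit_act, bk_act, map_mul, constantCoeff_lin, zero_mul, zero_smul]

lemma unit_barForm (a b : ℝ) : barForm (unit cs) (a • (unit cs).bk (u1 cs))
    (b • (unit cs).bk (u1 cs)) = a * b := by
  have h : barForm (unit cs) ((unit cs).bk (u1 cs)) ((unit cs).bk (u1 cs)) = 1 := by
    rw [barForm_bk]
    have h := unit_form (cs := cs) 1 1
    rw [one_smul, mul_one] at h
    exact (congrArg MvPolynomial.constantCoeff h).trans (map_one _)
  rw [map_smul, map_smul, LinearMap.smul_apply, h, smul_eq_mul, smul_eq_mul, mul_one, mul_comm]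

lemma exists_smul_bk_u1 (v : (unit cs).bar) : ∃ a : ℝ, v = a • (unit cs).bk (u1 cs) := by
  obtain ⟨m, rfl⟩ := bk_surjective v
  obtain ⟨p, rfl⟩ := exists_smul_u1 m
  exact ⟨_, unit_bk p⟩

lemma unit_gr {p : Pol B} (h : p • u1 cs ∈ (unit cs).gr k) : hcomp k p = p := by
  have := mem_gr.mp h
  change hcomp k (p * 1) = p * 1 at this
  rwa [mul_one] at this

lemma unit_barGr {v : (unit cs).bar} (hv : v ∈ barGr (unit cs) k) : v = 0 ∨ k = 0 := by
  obtain ⟨m, hm, rfl⟩ := hv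
  obtain ⟨p, rfl⟩ := exists_smul_u1 m
  refine or_iff_not_imp_right.mpr fun hk => ?_
  have h0 : MvPolynomial.constantCoeff p = 0 := by
    have h1 := hcomp_two_mul (B := B) 0
    have h2 := hcomp_hcomp_ne 0 k p (Ne.symm hk)
    rw [unit_gr hm] at h2
    rw [Nat.cast_zero, mul_zero] at h1
    rw [h1, MvPolynomial.homogeneousComponent_zero] at h2
    exact (MvPolynomial.C_eq_zero).mp h2
  refine (unit_bk p).trans ?_
  rw [h0, zero_smul]

lemma barLef_unit : BarLef (unit cs) := by
  refine BarLef.mk ?_ fun k v hv h => ?_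
  · refine Module.Finite.of_surjective
      (LinearMap.toSpanSingleton ℝ (unit cs).bar ((unit cs).bk (u1 cs))) fun v => ?_
    obtain ⟨a, rfl⟩ := exists_smul_bk_u1 v
    exact ⟨a, rfl⟩
  · rcases unit_barGr hv with h0 | rfl
    · exact h0
    · obtain ⟨a, rfl⟩ := exists_smul_bk_u1 v
      have h1 := h ((1 : ℝ) • (unit cs).bk (u1 cs))
        (by rw [one_smul, neg_zero]; exact ⟨_, u1_mem_gr, rfl⟩)
      rw [unit_barForm, mul_one] at h1
      rw [h1, zero_smul]

lemma hr_unit : HR (barGr (unit cs)) (barForm (unit cs)) (rhoE (unit cs)) 0 := by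
  intro k v hv _ h0
  rcases unit_barGr hv with h1 | h1
  · exact absurd h1 h0
  · obtain rfl : k = 0 := by lia
    obtain ⟨a, rfl⟩ := exists_smul_bk_u1 v
    rw [pow_zero, Module.End.one_apply, unit_barForm]
    have ha : a ≠ 0 := by rintro rfl; exact h0 (zero_smul _ _)
    norm_num [theta]
    exact ha

/-- The pairing with an element supported at the identity. -/
def unitMapR {m : P} (hm : m ∈ P.sup {1}) : P →ₗ[Pol B] unit cs :=
  ({ toFun := fun n => P.form m n
     map_add' := fun n n' => map_add _ n n'
     map_smul' := fun r n => by
      rw [← P.form_smul, ← act_of_mem_sup_one hm, P.form_act]; rfl } : P →ₗ[Pol B] Pol B)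

lemma isAdj_unitMap {m : P} (hm : m ∈ P.sup {1}) (hk : m ∈ P.gr k) :
    IsAdj k (unitMap cs m) (unitMapR hm) where
  left := unitMap_mem hm hk
  right := by
    refine ⟨fun r n => P.form_act_right r m n, fun j n => ?_⟩
    have := P.form_pr k j m n
    rw [mem_gr.mp hk, add_comm] at this
    exact this
  form p n := by
    obtain ⟨p, rfl⟩ := exists_smul_u1 p
    rw [map_smul, unitMap_u1, ← act_of_mem_sup_one hm, P.form_act]
    exact (unit_form p _).symm

lemma ind_one : Ind (1 : W) (unit cs) (u1 cs) (Finsupp.single 1 1) where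
  good := good_unit
  char := char_unit
  homChar := homChar_unit
  std := ⟨Finsupp.single_eq_same, fun u hu k _ => by rw [Finsupp.single_eq_of_ne hu]; rfl⟩
  len u hu h := absurd (Finsupp.single_eq_of_ne hu) h
  dual := SelfDual.one
  lef := barLef_unit
  hr := by rw [cs.length_one]; exact hr_unit
  low k hk := by
    rw [cs.length_one] at hk
    exact (congrArg LinearMap.range (hcomp_of_ne (by lia))).trans LinearMap.range_zero
  one_mem := by rw [cs.length_one, Nat.cast_zero, neg_zero]; exact u1_mem_gr
  one_ne := one_ne_zero (α := Pol B)
  gr_one m hm := by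
    obtain ⟨p, rfl⟩ := exists_smul_u1 m
    rw [cs.length_one, Nat.cast_zero, neg_zero] at hm
    have h1 := hcomp_two_mul (B := B) 0
    rw [Nat.cast_zero, mul_zero] at h1
    have h2 := unit_gr hm
    rw [h1, MvPolynomial.homogeneousComponent_zero] at h2
    exact ⟨_, by rw [← C_smul, h2]⟩
  parity k hk := by
    rw [cs.length_one, Nat.cast_zero, sub_zero]
    by_contra h
    refine hk ((congrArg LinearMap.range (hcomp_of_ne fun n hn => h ?_)).trans LinearMap.range_zero)
    rw [hn]
    exact even_two_mul _
  sup m := mem_unit_sup (J := {u | cs.length u < cs.length (1 : W) ∨ u = 1}) (Or.inr rfl) m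
  ext P hP g hg := by
    have h1 : {u | lenHt cs u ≤ lenHt cs 1} = {1} := by
      ext u
      rw [Set.mem_ofPred, Set.mem_singleton_iff]
      refine ⟨fun h => ?_, fun h => h ▸ le_rfl⟩
      by_contra hu
      have h2 : cs.length 1 < cs.length u := by
        rw [cs.length_one]
        exact Nat.pos_of_ne_zero (mt cs.length_eq_zero_iff.mp hu)
      refine h.not_gt ?_
      rw [lenHt, lenHt, Prod.Lex.toLex_lt_toLex]
      exact Or.inl h2
    rw [h1, cs.length_one, Nat.cast_zero, neg_zero] at hg
    obtain ⟨m, hm, hk, rfl⟩ := mem_gimg.mp hg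
    exact ⟨_, _, isAdj_unitMap hm hk, by rw [unitMap_u1]⟩

lemma isKL_one : IsKL (1 : W) (unit cs) (Finsupp.single 1 1) := by
  refine ⟨u1 cs, ind_one, Empty, Empty.elim, fun i => i.elim, fun i => i.elim, fun i => i.elim,
    fun i => i.elim, Empty.elim, fun i => i.elim, fun i => i.elim, fun i => i.elim,
    fun i => i.elim, fun i => i.elim, fun m => ?_, fun k v hv _ => ?_, fun s hs => ?_⟩
  · rw [Finset.univ_eq_empty, Finset.sum_empty, add_zero, map_one]
    exact (act_of_mem_sup_one (mem_unit_sup rfl m) _).symm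
  · rw [cs.length_one]
    exact unit_barGr hv
  · rw [cs.length_one] at hs
    exact absurd hs (Nat.not_lt_zero _)

theorem exists_isKL (w : W) : ∃ (X : Obj cs) (p : W →₀ ℤ[T;T⁻¹]), IsKL w X p := by
  suffices h : ∀ n w, cs.length w ≤ n → ∃ (X : Obj cs) (p : W →₀ ℤ[T;T⁻¹]), IsKL w X p from
    h _ w le_rfl
  intro n
  induction n with
  | zero =>
    intro w hw
    obtain rfl := cs.length_eq_zero_iff.mp (Nat.le_zero.mp hw)
    exact ⟨_, _, isKL_one⟩
  | succ n ih =>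
    intro w hw
    rcases eq_or_ne w 1 with rfl | h1
    · exact ⟨_, _, isKL_one⟩
    · obtain ⟨s, hs⟩ := cs.exists_leftDescent_of_ne_one h1
      have h2 : cs.length (cs.simple s * w) < cs.length w := hs
      obtain ⟨X, p, hX⟩ := ih (cs.simple s * w) (by lia)
      have h3 := hX.exists_up (s := s) (by rwa [cs.simple_mul_simple_cancel_left])
        fun u hu => ih u (by lia)
      rwa [cs.simple_mul_simple_cancel_left] at h3

end

section

variable {B W : Type} [Group W] {M : CoxeterMatrix B} {cs : CoxeterSystem M W}

attribute [local instance] wOrder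

open Obj

/-! ### Characters and the Hecke algebra -/

section Hecke

variable {H : Type} [Ring H] [Algebra ℤ[T;T⁻¹] H] {h : Basis W ℤ[T;T⁻¹] H} {d : H →+* H} {s : B}

lemma repr_simple_add_mul (hH : IsHeckeAlgebra cs h) (s : B) (m : H) :
    h.repr ((h (cs.simple s) + (T 1 : ℤ[T;T⁻¹]) • 1) * m) = bsC cs s (h.repr m) := by
  have key : h.repr.toLinearMap ∘ₗ LinearMap.mulLeft ℤ[T;T⁻¹]
      (h (cs.simple s) + (T 1 : ℤ[T;T⁻¹]) • 1) = bsC cs s ∘ₗ h.repr.toLinearMap := by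
    refine h.ext fun y => h.repr.symm.injective ?_
    simp only [LinearMap.comp_apply, LinearEquiv.coe_coe, LinearMap.mulLeft_apply,
      LinearEquiv.symm_apply_apply, h.repr_self, bsC, Finsupp.linearCombination_single, one_smul,
      map_add, h.repr_symm_single, add_mul, smul_mul_assoc, one_mul]
    split_ifs with hy
    · rw [(hH.2 s y).1 hy, add_comm]
    · rw [(hH.2 s y).2 (lt_of_le_of_ne (not_lt.mp hy) (cs.length_simple_mul_ne y s)), sub_smul]
      abel
  exact LinearMap.congr_fun key m

lemma simple_mul_self (hH : IsHeckeAlgebra cs h) (s : B) :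
    h (cs.simple s) * h (cs.simple s) =
      (T (-1) - T 1 : ℤ[T;T⁻¹]) • h (cs.simple s) + 1 := by
  have := (hH.2 s (cs.simple s)).2 (by simp)
  rwa [cs.simple_mul_simple_self, hH.1] at this

lemma d_simple_add (hH : IsHeckeAlgebra cs h) (hd : IsBarInvolution (fun x : W => h x) d) (s : B) :
    d (h (cs.simple s) + (T 1 : ℤ[T;T⁻¹]) • 1) = h (cs.simple s) + (T 1 : ℤ[T;T⁻¹]) • 1 := by
  have h0 := simple_mul_self hH s
  let u : Hˣ :=
    { val := h (cs.simple s)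
      inv := h (cs.simple s) - (T (-1) - T 1 : ℤ[T;T⁻¹]) • 1
      val_inv := by rw [mul_sub, h0, mul_smul_comm, mul_one]; abel
      inv_val := by rw [sub_mul, h0, smul_mul_assoc, one_mul]; abel }
  have h1 : d (h (cs.simple s)) = h (cs.simple s) - (T (-1) - T 1 : ℤ[T;T⁻¹]) • 1 := by
    refine (hd.2 _).trans ?_
    rw [cs.inv_simple]
    exact Ring.inverse_unit u
  rw [map_add, h1, hd.1, map_one, sub_smul]
  abel

lemma d_smul (hd : IsBarInvolution (fun x : W => h x) d) (a : ℤ[T;T⁻¹]) (m : H) :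
    d (a • m) = invert a • d m := by
  induction a using LaurentPolynomial.induction_on' with
  | add p q hp hq => rw [add_smul, map_add, hp, hq, map_add, add_smul]
  | C_mul_T n a =>
    have h1 : (C a * T n : ℤ[T;T⁻¹]) = a • T n := by
      rw [zsmul_eq_mul]
      rfl
    rw [h1, map_zsmul, invert_T, smul_assoc, smul_assoc, map_zsmul, hd.1]

lemma d_of_selfDual (hH : IsHeckeAlgebra cs h) (hd : IsBarInvolution (fun x : W => h x) d)
    {p : W →₀ ℤ[T;T⁻¹]} (hp : SelfDual cs p) : d (h.repr.symm p) = h.repr.symm p := by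
  induction hp with
  | one => rw [h.repr_symm_single_one, hH.1, map_one]
  | bs s p _ ih =>
    have := repr_simple_add_mul hH s (h.repr.symm p)
    rw [LinearEquiv.apply_symm_apply, ← LinearEquiv.eq_symm_apply] at this
    rw [← this, map_mul, d_simple_add hH hd, ih]
  | sub p q _ _ h1 h2 => rw [map_sub, map_sub, h1, h2]

/-- The bar involution is unitriangular with respect to the length. -/
lemma repr_d_basis (hH : IsHeckeAlgebra cs h) (hd : IsBarInvolution (fun x : W => h x) d)
    (n : ℕ) : ∀ y u : W, cs.length y = n → n ≤ cs.length u →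
      h.repr (d (h y)) u = Finsupp.single y 1 u := by
  induction n with
  | zero =>
    intro y u hy _
    obtain rfl := cs.length_eq_zero_iff.mp hy
    rw [hH.1, map_one, ← hH.1, h.repr_self]
  | succ n ih =>
    intro y u hy hu
    obtain ⟨s, hs⟩ := cs.exists_leftDescent_of_ne_one (w := y)
      (by rintro rfl; rw [cs.length_one] at hy; lia)
    obtain ⟨z, rfl⟩ : ∃ z, y = cs.simple s * z := ⟨cs.simple s * y, by simp⟩
    have hs' : cs.length (cs.simple s * (cs.simple s * z)) < cs.length (cs.simple s * z) := hs
    rw [cs.simple_mul_simple_cancel_left] at hs'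
    have hz := length_up hs'
    have h1 : d (h (cs.simple s * z)) =
        (h (cs.simple s) + (T 1 : ℤ[T;T⁻¹]) • 1) * d (h z) - (T (-1) : ℤ[T;T⁻¹]) • d (h z) := by
      rw [← (hH.2 s z).1 hs', ← d_simple_add hH hd, map_mul, map_add, hd.1, map_one, add_mul,
        smul_mul_assoc, one_mul, add_sub_cancel_right]
    have h2 := cs.length_simple_mul u s
    have h3 : h.repr (d (h z)) u = 0 := by
      rw [ih z u (by lia) (by lia), Finsupp.single_eq_of_ne]
      rintro rfl
      lia
    rw [h1, map_sub, Finsupp.sub_apply, repr_simple_add_mul hH, bsC_apply, map_smul,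
      Finsupp.smul_apply, h3, mul_zero, zero_add, smul_zero, sub_zero, ih z _ (by lia) (by lia)]
    rcases eq_or_ne u (cs.simple s * z) with rfl | hne
    · rw [cs.simple_mul_simple_cancel_left, Finsupp.single_eq_same, Finsupp.single_eq_same]
    · rw [Finsupp.single_eq_of_ne hne, Finsupp.single_eq_of_ne]
      intro h4
      exact hne (by rw [← h4, cs.simple_mul_simple_cancel_left])

lemma eq_zero_of_d_eq (hH : IsHeckeAlgebra cs h) (hd : IsBarInvolution (fun x : W => h x) d)
    {m : H} (hm : d m = m) (h0 : ∀ u, ∀ k ≤ 0, (h.repr m u).coeff k = 0) : m = 0 := by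
  by_contra hne
  have hs : (h.repr m).support.Nonempty := by
    rw [Finsupp.support_nonempty_iff]
    exact fun h1 => hne (h.repr.map_eq_zero_iff.mp h1)
  obtain ⟨y, hy, hmax⟩ := Finset.exists_max_image _ cs.length hs
  have h1 : h.repr (d m) y = invert (h.repr m y) := by
    conv_lhs => rw [← h.linearCombination_repr m, Finsupp.linearCombination_apply, Finsupp.sum,
      map_sum, map_sum, Finsupp.finsetSum_apply]
    rw [Finset.sum_eq_single y]
    · rw [d_smul hd, map_smul, Finsupp.smul_apply, repr_d_basis hH hd _ y y rfl le_rfl,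
        Finsupp.single_eq_same, smul_eq_mul, mul_one]
    · intro u hu huy
      rw [d_smul hd, map_smul, Finsupp.smul_apply, repr_d_basis hH hd _ u y rfl (hmax u hu),
        Finsupp.single_eq_of_ne huy.symm, smul_zero]
    · exact fun h1 => absurd hy h1
  rw [hm] at h1
  refine Finsupp.mem_support_iff.mp hy ?_
  ext k
  rcases le_or_gt k 0 with hk | hk
  · exact h0 y k hk
  · rw [h1, invert_apply]
    exact h0 y _ (by lia)

lemma IsKL.eq_repr_symm (hH : IsHeckeAlgebra cs h) (hd : IsBarInvolution (fun x : W => h x) d)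
    {b : W → H} (hb : IsKLFamily cs h d b) {x : W} {X : Obj cs} {p : W →₀ ℤ[T;T⁻¹]}
    (hX : IsKL x X p) : h.repr (b x) = p := by
  obtain ⟨one, hi⟩ := hX.exists_ind
  rw [← LinearEquiv.eq_symm_apply, ← sub_eq_zero]
  refine eq_zero_of_d_eq hH hd ?_ fun u k hk => ?_
  · rw [map_sub, (hb x).1, d_of_selfDual hH hd hi.dual]
  · rw [map_sub, LinearEquiv.apply_symm_apply, Finsupp.sub_apply]
    rcases eq_or_ne u x with rfl | hu
    · rw [(hb u).2.1, hi.std.self, sub_self]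
      rfl
    · rw [AddMonoidAlgebra.coeff_sub, Finsupp.sub_apply, ((hb x).2.2 u hu).2 k hk,
        hi.std.ne u hu k hk, sub_zero]

end Hecke

end

end

end KL

/-- **Positivity of Kazhdan–Lusztig polynomials.** For all `y, x ∈ W`, the
Kazhdan–Lusztig polynomial `p_{y,x} = h.repr (b x) y` has no negative powers of `v`
and all of its coefficients are nonnegative. -/
theorem kazhdan_lusztig_polynomial_positivity
    {B W : Type} [Group W] {M : CoxeterMatrix B} (cs : CoxeterSystem M W)
    {H : Type} [Ring H] [Algebra (LaurentPolynomial ℤ) H]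
    (h : Module.Basis W (LaurentPolynomial ℤ) H) (hH : IsHeckeAlgebra cs h)
    (d : H →+* H) (hd : IsBarInvolution (fun x : W => h x) d)
    (hinv : ∀ x : W, IsUnit (h x))
    (b : W → H) (hb : IsKLFamily cs h d b)
    (y x : W) :
    ∀ k : ℤ, 0 ≤ (h.repr (b x) y).coeff k ∧ (k < 0 → (h.repr (b x) y).coeff k = 0) := by
  obtain ⟨X, p, hX⟩ := KL.exists_isKL (cs := cs) x
  obtain ⟨one, hi⟩ := hX.exists_ind
  rw [hX.eq_repr_symm hH hd hb]
  exact fun k => ⟨hi.char.nonneg y k, hi.std.coeff_neg y⟩
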